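/- Characterization of indecomposable continua in the 2-sphere: Let S² denote the unit sphere {x ∈ ℝ³ : |x| = 1} with its induced metric, and let X ⊆ S² be a continuum. Then X is indecomposable if and only if there exists a sequence (Uₙ) of complementary domains of X satisfying the double-pass condition. -/

import Mathlib

open Set Metric Filter Topology

/-- A space is locally homeomorphic to ℝ²: every point has an open
neighborhood homeomorphic to the Euclidean plane. -/
def LocallyEuclidean2 (S : Type*) [TopologicalSpace S] : Prop :=
  ∀ x : S, ∃ U : Set S, IsOpen U ∧ x ∈ U ∧
    Nonempty (U ≃ₜ EuclideanSpace ℝ (Fin 2))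

section Defs

variable {S : Type*} [TopologicalSpace S]

/-- A continuum: a nonempty compact connected subset. -/
def IsContinuum (X : Set S) : Prop := IsCompact X ∧ IsConnected X

/-- A complementary domain of `X`: a connected component of the complement of `X`. -/
def IsComplementaryDomain (X U : Set S) : Prop :=
  ∃ x, x ∉ X ∧ U = connectedComponentIn Xᶜ x

/-- A proper subcontinuum of `X`. -/
def IsProperSubcontinuum (X A : Set S) : Prop :=
  A.Nonempty ∧ IsClosed A ∧ IsConnected A ∧ A ⊆ X ∧ A ≠ X

/-- `X` is decomposable: the union of two proper subcontinua. -/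
def IsDecomposable (X : Set S) : Prop :=
  ∃ A B, IsProperSubcontinuum X A ∧ IsProperSubcontinuum X B ∧ A ∪ B = X

/-- `X` is the essential union of three proper subcontinua. -/
def IsEssentialUnionOfThree (X : Set S) : Prop :=
  ∃ X₁ X₂ X₃, IsProperSubcontinuum X X₁ ∧ IsProperSubcontinuum X X₂ ∧
    IsProperSubcontinuum X X₃ ∧ X₁ ∪ X₂ ∪ X₃ = X ∧
    ¬ X₁ ⊆ X₂ ∪ X₃ ∧ ¬ X₂ ⊆ X₁ ∪ X₃ ∧ ¬ X₃ ⊆ X₁ ∪ X₂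

/-- `X` is 2-indecomposable: decomposable but not the essential union of
three proper subcontinua. -/
def Is2Indecomposable (X : Set S) : Prop :=
  IsDecomposable X ∧ ¬ IsEssentialUnionOfThree X

/-- `X` is shielded: no complementary domain has frontier equal to `X`. -/
def IsShielded (X : Set S) : Prop :=
  ∀ U, IsComplementaryDomain X U → frontier U ≠ X

/-- A generalized crosscut of `U`. -/
def IsGenCrosscut (U A : Set S) : Prop :=
  A ⊆ U ∧ Nonempty (A ≃ₜ Set.Ioo (0:ℝ) 1) ∧ closure A \ A ⊆ frontier U

/-- `T` is a shadow of the (generalized) crosscut `A` of `U`. -/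
def IsShadowOf (U A T : Set S) : Prop :=
  ∃ x ∈ U \ A, T = closure (connectedComponentIn (U \ A) x) ∩ frontier U

/-- An arc with endpoints `a` and `b`. -/
def IsArcFrom (A : Set S) (a b : S) : Prop :=
  ∃ f : Set.Icc (0:ℝ) 1 → S, Continuous f ∧ Function.Injective f ∧
    Set.range f = A ∧ f ⟨0, by norm_num⟩ = a ∧ f ⟨1, by norm_num⟩ = b

/-- A crosscut of `U`: a copy of `(0,1)` in `U` whose closure is an arc
meeting the frontier of `U` exactly at the endpoints of the arc. -/
def IsCrosscut (U K : Set S) : Prop :=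
  K ⊆ U ∧ Nonempty (K ≃ₜ Set.Ioo (0:ℝ) 1) ∧
    ∃ a b, IsArcFrom (closure K) a b ∧ closure K ∩ frontier U = {a, b}

/-- A closed disk: a set homeomorphic to the closed unit disk in ℝ². -/
def IsClosedDisk (D : Set S) : Prop :=
  Nonempty (D ≃ₜ Metric.closedBall (0 : EuclideanSpace ℝ (Fin 2)) 1)

/-- A cat's cradle between `d₁` and `d₃`: a family of arcs from `d₁` to `d₃`
whose interiors are pairwise disjoint. -/
def IsCatsCradle {ι : Type*} (d₁ d₃ : S) (A : ι → Set S) : Prop :=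
  (∀ i, IsArcFrom (A i) d₁ d₃) ∧
    Pairwise fun i j => (A i \ {d₁, d₃}) ∩ (A j \ {d₁, d₃}) = ∅

/-- A cat's cradle between `d₁` and `d₃` through `D₂`. -/
def IsCatsCradleThrough {ι : Type*} (d₁ d₃ : S) (D₂ : Set S) (A : ι → Set S) : Prop :=
  IsCatsCradle d₁ d₃ A ∧ D₂ ∩ {d₁, d₃} = ∅ ∧ ∀ i, (A i ∩ D₂).Nonempty

/-- A chord of the closed disk `D`: an arc in `D` meeting the frontier of `D`
exactly at its two endpoints. -/
def IsChord (D A : Set S) : Prop :=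
  ∃ a b, IsArcFrom A a b ∧ A ⊆ D ∧ A ∩ frontier D = {a, b}

/-- A sequence of pairwise disjoint chords of `D` is linearly ordered if each
middle chord separates the earlier ones from the later ones in `D`. -/
def LinearlyOrderedChords (D : Set S) (A : ℕ → Set S) : Prop :=
  (Pairwise fun i j => Disjoint (A i) (A j)) ∧
    ∀ i j k, i < j → j < k → ∀ x ∈ A i, ∀ y ∈ A k,
      connectedComponentIn (D \ A j) x ≠ connectedComponentIn (D \ A j) y

end Defs

section MetricDefs

variable {S : Type*} [MetricSpace S]

/-- Convergence of a sequence of sets to `X` in the Hausdorff metric. -/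
def HausdorffConvergesTo (A : ℕ → Set S) (X : Set S) : Prop :=
  Tendsto (fun n => hausdorffDist (A n) X) atTop (𝓝 0)

/-- The double-pass condition for a sequence of domains. -/
def DoublePassCondition (X : Set S) (U : ℕ → Set S) : Prop :=
  ∀ K : ℕ → Set S, (∀ n, IsGenCrosscut (U n) (K n)) →
    ∃ Sh : ℕ → Set S, (∀ n, IsShadowOf (U n) (K n) (Sh n)) ∧ HausdorffConvergesTo Sh X

/-- The double-pass condition with (genuine) crosscuts. -/
def DoublePassConditionCrosscuts (X : Set S) (U : ℕ → Set S) : Prop :=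
  ∀ K : ℕ → Set S, (∀ n, IsCrosscut (U n) (K n)) →
    ∃ Sh : ℕ → Set S, (∀ n, IsShadowOf (U n) (K n) (Sh n)) ∧ HausdorffConvergesTo Sh X

end MetricDefs

section LogTheory

variable {T : Type*} [TopologicalSpace T]

/-- `g` is a continuous logarithm of `f` on `F`. -/
def IsLog (f g : T → ℂ) (F : Set T) : Prop :=
  ContinuousOn g F ∧ ∀ z ∈ F, Complex.exp (g z) = f z

def HasLog (f : T → ℂ) (F : Set T) : Prop := ∃ g, IsLog f g F

lemma IsLog.mono {f g : T → ℂ} {F F' : Set T} (h : IsLog f g F) (hs : F' ⊆ F) : IsLog f g F' :=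
  ⟨h.1.mono hs, fun z hz => h.2 z (hs hz)⟩

lemma HasLog.mono {f : T → ℂ} {F F' : Set T} (h : HasLog f F) (hs : F' ⊆ F) : HasLog f F' :=
  ⟨h.choose, h.choose_spec.mono hs⟩

lemma IsLog.mul {f g f' g' : T → ℂ} {F : Set T} (h : IsLog f g F) (h' : IsLog f' g' F) :
    IsLog (fun z => f z * f' z) (fun z => g z + g' z) F :=
  ⟨h.1.add h'.1, fun z hz => by rw [Complex.exp_add, h.2 z hz, h'.2 z hz]⟩

lemma IsLog.inv {f g : T → ℂ} {F : Set T} (h : IsLog f g F) :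
    IsLog (fun z => (f z)⁻¹) (fun z => - g z) F :=
  ⟨h.1.neg, fun z hz => by rw [Complex.exp_neg, h.2 z hz]⟩

lemma IsLog.congr {f f' g : T → ℂ} {F : Set T} (h : IsLog f g F) (h' : ∀ z ∈ F, f z = f' z) :
    IsLog f' g F :=
  ⟨h.1, fun z hz => by rw [h.2 z hz, h' z hz]⟩

lemma HasLog.mul {f f' : T → ℂ} {F : Set T} (h : HasLog f F) (h' : HasLog f' F) :
    HasLog (fun z => f z * f' z) F := by
  obtain ⟨g, hg⟩ := h
  obtain ⟨g', hg'⟩ := h'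
  exact ⟨_, hg.mul hg'⟩

lemma HasLog.inv {f : T → ℂ} {F : Set T} (h : HasLog f F) : HasLog (fun z => (f z)⁻¹) F := by
  obtain ⟨g, hg⟩ := h
  exact ⟨_, hg.inv⟩

lemma HasLog.congr {f f' : T → ℂ} {F : Set T} (h : HasLog f F) (h' : ∀ z ∈ F, f z = f' z) :
    HasLog f' F := by
  obtain ⟨g, hg⟩ := h
  exact ⟨_, hg.congr h'⟩

lemma IsLog.add_int {f g : T → ℂ} {F : Set T} (h : IsLog f g F) (n : ℤ) :
    IsLog f (fun z => g z + n * (2 * Real.pi * Complex.I)) F :=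
  ⟨h.1.add continuousOn_const, fun z hz => by
    rw [Complex.exp_add, h.2 z hz, Complex.exp_int_mul_two_pi_mul_I, mul_one]⟩

lemma two_pi_I_ne : (2 * Real.pi * Complex.I : ℂ) ≠ 0 := by
  simp [Real.pi_ne_zero]

/-- Two logarithms on a preconnected set differ by a constant. -/
lemma IsLog.unique {f g g' : T → ℂ} {F : Set T} (h : IsLog f g F) (h' : IsLog f g' F)
    (hF : IsPreconnected F) :
    ∃ n : ℤ, ∀ z ∈ F, g z = g' z + n * (2 * Real.pi * Complex.I) := by
  rcases F.eq_empty_or_nonempty with rfl | ⟨z0, hz0⟩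
  · exact ⟨0, by simp⟩
  have key : ∀ z ∈ F, ∃ n : ℤ, g z = g' z + n * (2 * Real.pi * Complex.I) := fun z hz =>
    Complex.exp_eq_exp_iff_exists_int.1 ((h.2 z hz).trans (h'.2 z hz).symm)
  obtain ⟨n, hn⟩ := key z0 hz0
  refine ⟨n, fun z hz => ?_⟩
  let q : T → ℝ := fun z => ((g z - g' z) / (2 * Real.pi * Complex.I)).re
  have hq : ∀ z (m : ℤ), g z = g' z + m * (2 * Real.pi * Complex.I) → q z = m := by
    intro z m hm
    have : (g z - g' z) / (2 * Real.pi * Complex.I) = (m : ℂ) := by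
      rw [hm, add_sub_cancel_left, mul_div_assoc, div_self two_pi_I_ne, mul_one]
    simp [q, this]
  have hc : ContinuousOn q F :=
    Complex.continuous_re.comp_continuousOn ((h.1.sub h'.1).div_const _)
  have hd : IsDiscrete (range (Int.cast : ℤ → ℝ)) := by
    have e := Int.isClosedEmbedding_coe_real.isEmbedding.toHomeomorph
    exact ⟨e.symm.isEmbedding.discreteTopology⟩
  have := hF.constant_of_mapsTo hd hc
    (fun w hw => by obtain ⟨m, hm⟩ := key w hw; exact ⟨m, (hq w m hm).symm⟩) hz hz0
  obtain ⟨m, hm⟩ := key z hz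
  rw [hq z m hm, hq z0 n hn] at this
  have : m = n := by exact_mod_cast this
  rw [hm, this]

lemma isLog_union {f g : T → ℂ} {F₁ F₂ : Set T} (h1 : IsLog f g F₁) (h2 : IsLog f g F₂)
    (c1 : IsClosed F₁) (c2 : IsClosed F₂) : IsLog f g (F₁ ∪ F₂) :=
  ⟨h1.1.union_of_isClosed h2.1 c1 c2, fun z hz => hz.elim (h1.2 z) (h2.2 z)⟩

lemma IsLog.eqOn {f g g' : T → ℂ} {F : Set T} (h : IsLog f g F) (e : ∀ z ∈ F, g' z = g z) :
    IsLog f g' F :=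
  ⟨h.1.congr e, fun z hz => by rw [e z hz, h.2 z hz]⟩

/-- Gluing of logarithms, keeping the first one. -/
lemma IsLog.glue {f g : T → ℂ} {F₁ F₂ : Set T} (h1 : IsLog f g F₁) (h2 : HasLog f F₂)
    (c1 : IsClosed F₁) (c2 : IsClosed F₂) (hp : IsPreconnected (F₁ ∩ F₂)) :
    ∃ g', IsLog f g' (F₁ ∪ F₂) ∧ ∀ z ∈ F₁, g' z = g z := by
  classical
  obtain ⟨g2, h2⟩ := h2
  obtain ⟨n, hn⟩ := (h1.mono inter_subset_left).unique (h2.mono inter_subset_right) hp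
  have h3 := h2.add_int n
  refine ⟨fun z => if z ∈ F₁ then g z else g2 z + n * (2 * Real.pi * Complex.I),
    isLog_union (h1.eqOn fun z hz => if_pos hz) (h3.eqOn fun z hz => ?_) c1 c2,
    fun z hz => if_pos hz⟩
  by_cases hz1 : z ∈ F₁
  · simp only [if_pos hz1]; exact hn z ⟨hz1, hz⟩
  · simp only [if_neg hz1]

lemma HasLog.glue {f : T → ℂ} {F₁ F₂ : Set T} (h1 : HasLog f F₁) (h2 : HasLog f F₂)
    (c1 : IsClosed F₁) (c2 : IsClosed F₂) (hp : IsPreconnected (F₁ ∩ F₂)) :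
    HasLog f (F₁ ∪ F₂) := by
  obtain ⟨g, hg⟩ := h1
  obtain ⟨g', h, -⟩ := hg.glue h2 c1 c2 hp
  exact ⟨g', h⟩

/-- A function close to one has a logarithm. -/
lemma hasLog_near_one {f : T → ℂ} {F : Set T} (hf : ContinuousOn f F)
    (h : ∀ z ∈ F, ‖f z - 1‖ < 1) : HasLog f F := by
  have hs : ∀ z ∈ F, f z ∈ Complex.slitPlane := fun z hz => by
    have := Complex.mem_slitPlane_of_norm_lt_one (h z hz)
    simpa using this
  exact ⟨fun z => Complex.log (f z), hf.clog hs, fun z hz =>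
    Complex.exp_log (Complex.slitPlane_ne_zero (hs z hz))⟩

lemma hasLog_near {f : T → ℂ} {F : Set T} (c : ℂ) (hf : ContinuousOn f F)
    (h : ∀ z ∈ F, ‖f z - c‖ < ‖c‖) : HasLog f F := by
  rcases F.eq_empty_or_nonempty with rfl | ⟨z0, hz0⟩
  · exact ⟨0, by simp [IsLog]⟩
  have hc : c ≠ 0 := by
    rintro rfl
    have := h z0 hz0
    simp at this
    exact absurd this (not_lt.2 (norm_nonneg _))
  have h1 : HasLog (fun z => f z / c) F := hasLog_near_one (hf.div_const c) fun z hz => by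
    have : f z / c - 1 = (f z - c) / c := by field_simp
    rw [this, norm_div, div_lt_one (norm_pos_iff.2 hc)]
    exact h z hz
  have h2 : HasLog (fun _ : T => c) F :=
    ⟨fun _ => Complex.log c, continuousOn_const, fun _ _ => Complex.exp_log hc⟩
  exact (h1.mul h2).congr fun z _ => div_mul_cancel₀ _ hc

/-- Extension of a continuous logarithm to a neighborhood. -/
lemma IsLog.extend [NormalSpace T] {f g : T → ℂ} {F W : Set T} (h : IsLog f g F)
    (hF : IsClosed F) (hW : IsOpen W) (hFW : F ⊆ W) (hf : ContinuousOn f W) :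
    ∃ N, IsOpen N ∧ F ⊆ N ∧ N ⊆ W ∧ ∃ G, IsLog f G N ∧ ∀ z ∈ F, G z = g z := by
  obtain ⟨G, hG⟩ := ContinuousMap.exists_restrict_eq hF
    (⟨F.domRestrict g, continuousOn_iff_continuous_domRestrict.1 h.1⟩ : C(F, ℂ))
  have hG' : ∀ z ∈ F, G z = g z := fun z hz => by
    exact DFunLike.congr_fun hG ⟨z, hz⟩
  let r : T → ℂ := fun z => f z * Complex.exp (- G z)
  have hr : ContinuousOn r W := hf.mul (by fun_prop)
  have hrF : ∀ z ∈ F, r z = 1 := fun z hz => by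
    simp only [r]
    rw [hG' z hz, ← h.2 z hz, ← Complex.exp_add, add_neg_cancel, Complex.exp_zero]
  let N := W ∩ r ⁻¹' ball 1 1
  have hN : IsOpen N := hr.isOpen_inter_preimage hW isOpen_ball
  have hs : ∀ z ∈ N, r z ∈ Complex.slitPlane := fun z hz => by
    have := hz.2
    rw [mem_preimage, mem_ball, dist_eq_norm] at this
    have := Complex.mem_slitPlane_of_norm_lt_one this
    simpa using this
  refine ⟨N, hN, fun z hz => ⟨hFW hz, by simp [hrF z hz]⟩, inter_subset_left,
    fun z => G z + Complex.log (r z), ⟨?_, fun z hz => ?_⟩, fun z hz => ?_⟩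
  · exact G.continuous.continuousOn.add ((hr.mono inter_subset_left).clog hs)
  · rw [Complex.exp_add, Complex.exp_log (Complex.slitPlane_ne_zero (hs z hz))]
    simp only [r]
    rw [mul_comm, mul_assoc, ← Complex.exp_add, neg_add_cancel, Complex.exp_zero, mul_one]
  · simp [hrF z hz, hG' z hz]

lemma hasLog_univ_of_simplyConnected [SimplyConnectedSpace T] [LocallyPathConnectedSpace T]
    {f : T → ℂ} (hf : Continuous f) (h0 : ∀ z, f z ≠ 0) : HasLog f univ := by
  obtain ⟨t0⟩ : Nonempty T := inferInstance
  obtain ⟨F, ⟨-, hF⟩, -⟩ := Complex.isCoveringMapOn_exp.existsUnique_continuousMap_lifts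
    (⟨f, hf⟩ : C(T, ℂ)) (a₀ := t0) (e₀ := Complex.log (f t0)) (Complex.exp_log (h0 t0))
    (fun a => h0 a)
  exact ⟨F, F.continuous.continuousOn, fun z _ => congrFun hF z⟩

/-- Transport of logs by composition. -/
lemma HasLog.comp {T' : Type*} [TopologicalSpace T'] {f : T → ℂ} {F : Set T} (h : HasLog f F)
    {p : T' → T} {F' : Set T'} (hp : ContinuousOn p F') (hm : MapsTo p F' F) :
    HasLog (f ∘ p) F' := by
  obtain ⟨g, hg⟩ := h
  exact ⟨g ∘ p, hg.1.comp hp hm, fun z hz => hg.2 _ (hm hz)⟩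

/-- The identity has no logarithm on a circle. -/
lemma no_log_circle {r : ℝ} (hr : 0 < r) : ¬ HasLog (fun w : ℂ => w) (sphere 0 r) := by
  rintro ⟨g, hg⟩
  let p : ℝ → ℂ := fun t => r * Complex.exp (t * Complex.I)
  have hp : Continuous p := by fun_prop
  have hm : ∀ t, p t ∈ sphere (0:ℂ) r := fun t => by
    simp [p, Complex.norm_exp_ofReal_mul_I, abs_of_pos hr]
  have h1 : IsLog (fun _ : ℝ => (r : ℂ)) (fun t => g (p t) - t * Complex.I) univ := by
    refine ⟨?_, fun t _ => ?_⟩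
    · have : ContinuousOn (g ∘ p) univ := hg.1.comp hp.continuousOn fun t _ => hm t
      exact this.sub (by fun_prop)
    · rw [Complex.exp_sub, hg.2 _ (hm t)]
      simp only [p]
      exact mul_div_cancel_right₀ _ (Complex.exp_ne_zero _)
  have h2 : IsLog (fun _ : ℝ => (r : ℂ)) (fun _ => Complex.log r) univ :=
    ⟨continuousOn_const, fun _ _ => Complex.exp_log (by exact_mod_cast hr.ne')⟩
  obtain ⟨n, hn⟩ := h1.unique h2 isPreconnected_univ
  have e1 := hn 0 trivial
  have e2 := hn (2 * Real.pi) trivial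
  have e3 : p (2 * Real.pi) = p 0 := by
    simp only [p]
    push_cast
    rw [Complex.exp_two_pi_mul_I]; simp
  rw [e3] at e2
  rw [← e2] at e1
  have : (2 * Real.pi * Complex.I : ℂ) = 0 := by
    push_cast at e1
    linear_combination e1
  exact two_pi_I_ne this

end LogTheory

/-- A space in which the complement of every point is identified with the plane. -/
class SphereLike (S : Type*) [MetricSpace S] where
  sg : S → S → ℂ
  tu : S → ℂ → S
  sg_cont : ∀ v, ContinuousOn (sg v) {v}ᶜ
  tu_cont : ∀ v, Continuous (tu v)
  tu_ne : ∀ v z, tu v z ≠ v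
  sg_tu : ∀ v z, sg v (tu v z) = z
  tu_sg : ∀ v x, x ≠ v → tu v (sg v x) = x

open SphereLike

section SphereLog

set_option linter.unusedSectionVars false

variable {S : Type*} [MetricSpace S] [SphereLike S]

lemma sg_injOn {v x y : S} (hx : x ≠ v) (hy : y ≠ v) (h : sg v x = sg v y) : x = y := by
  rw [← tu_sg v x hx, ← tu_sg v y hy, h]

lemma tu_injective (v : S) : Function.Injective (tu v) := fun x y h => by
  rw [← sg_tu v x, ← sg_tu v y, h]

lemma sg_contAt {v x : S} (hx : x ≠ v) : ContinuousAt (sg v) x :=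
  (sg_cont v).continuousAt (isOpen_compl_singleton.mem_nhds hx)

lemma eventually_sg_large [CompactSpace S] (v : S) (R : ℝ) :
    ∀ᶠ z in 𝓝 v, z ≠ v → R < ‖sg v z‖ := by
  have hc : IsClosed (tu v '' closedBall 0 R) :=
    ((isCompact_closedBall (0:ℂ) R).image (tu_cont v)).isClosed
  have : (tu v '' closedBall 0 R)ᶜ ∈ 𝓝 v := hc.isOpen_compl.mem_nhds (by
    rintro ⟨z, -, hz⟩
    exact tu_ne v z hz)
  filter_upwards [this] with z hz hzv
  by_contra h
  exact hz ⟨sg v z, by simpa using h, tu_sg v z hzv⟩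

open Classical in
/-- The function `(z - a) / (z - b)` in the chart at `v`, equal to `1` at `v`. -/
noncomputable def hh (v a b : S) (z : S) : ℂ :=
  if z = v then 1 else (sg v z - sg v a) / (sg v z - sg v b)

lemma hh_self_base (v a b : S) : hh v a b v = 1 := if_pos rfl

lemma hh_of_ne {v z : S} (a b : S) (h : z ≠ v) :
    hh v a b z = (sg v z - sg v a) / (sg v z - sg v b) := if_neg h

lemma sg_sub_ne {v z b : S} (hz : z ≠ v) (hb : b ≠ v) (h : z ≠ b) : sg v z - sg v b ≠ 0 :=
  fun e => h (sg_injOn hz hb (sub_eq_zero.1 e))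

lemma hh_ne_zero {v a b z : S} (ha : a ≠ v) (hb : b ≠ v) (hza : z ≠ a) (hzb : z ≠ b) :
    hh v a b z ≠ 0 := by
  by_cases hz : z = v
  · subst hz; rw [hh_self_base]; exact one_ne_zero
  · rw [hh_of_ne _ _ hz]
    exact div_ne_zero (sg_sub_ne hz ha hza) (sg_sub_ne hz hb hzb)

lemma hh_mul {v a b c z : S} (hb : b ≠ v) (hzb : z ≠ b) :
    hh v a b z * hh v b c z = hh v a c z := by
  by_cases hz : z = v
  · subst hz; simp [hh_self_base]
  · rw [hh_of_ne _ _ hz, hh_of_ne _ _ hz, hh_of_ne _ _ hz]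
    have := sg_sub_ne hz hb hzb
    field_simp

lemma hh_inv {v a b z : S} : (hh v a b z)⁻¹ = hh v b a z := by
  by_cases hz : z = v
  · subst hz; simp [hh_self_base]
  · rw [hh_of_ne _ _ hz, hh_of_ne _ _ hz, inv_div]

lemma hh_continuousOn [CompactSpace S] {v a b : S} (hb : b ≠ v) :
    ContinuousOn (hh v a b) {b}ᶜ := by
  intro z hz
  refine ContinuousAt.continuousWithinAt ?_
  by_cases hzv : z = v
  · subst hzv
    rw [ContinuousAt, hh_self_base, Metric.tendsto_nhds]
    intro ε hε
    filter_upwards [eventually_sg_large z (‖sg z b‖ + (‖sg z b - sg z a‖ + 1) / ε)] with x hx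
    by_cases hxz : x = z
    · subst hxz; simpa [hh_self_base] using hε
    · have h1 := hx hxz
      rw [hh_of_ne _ _ hxz, dist_eq_norm]
      have h2 : ‖sg z x‖ ≤ ‖sg z x - sg z b‖ + ‖sg z b‖ := norm_le_norm_sub_add _ _
      have h3 : (‖sg z b - sg z a‖ + 1) / ε < ‖sg z x - sg z b‖ := by linarith
      have h4 : 0 < ‖sg z x - sg z b‖ := lt_of_le_of_lt (by positivity) h3
      have h5 : sg z x - sg z b ≠ 0 := norm_pos_iff.1 h4
      have : (sg z x - sg z a) / (sg z x - sg z b) - 1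
          = (sg z b - sg z a) / (sg z x - sg z b) := by field_simp; ring
      rw [this, norm_div, div_lt_iff₀ h4]
      rw [div_lt_iff₀ hε] at h3
      linarith
  · have h1 : ContinuousAt (fun z => (sg v z - sg v a) / (sg v z - sg v b)) z :=
      ((sg_contAt hzv).sub continuousAt_const).div ((sg_contAt hzv).sub continuousAt_const)
        (sg_sub_ne hzv hb hz)
    refine h1.congr ?_
    filter_upwards [isOpen_compl_singleton.mem_nhds hzv] with x hx
    exact (hh_of_ne a b hx).symm

/-- Local lemma: moving a pole slightly. -/
lemma hasLog_hh_near [CompactSpace S] {v c : S} {F : Set S} (hF : IsClosed F) (hc : c ∉ F)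
    (hcv : c ≠ v) : ∀ᶠ c' in 𝓝 c, c' ≠ v ∧ c' ∉ F ∧ HasLog (hh v c c') F := by
  have h1 : tu v ⁻¹' Fᶜ ∈ 𝓝 (sg v c) :=
    (hF.isOpen_compl.preimage (tu_cont v)).mem_nhds (by simpa [tu_sg v c hcv] using hc)
  obtain ⟨δ, hδ, hb⟩ := Metric.mem_nhds_iff.1 h1
  have h2 : ∀ᶠ c' in 𝓝 c, sg v c' ∈ ball (sg v c) δ := (sg_contAt hcv) (ball_mem_nhds _ hδ)
  filter_upwards [h2, hF.isOpen_compl.mem_nhds hc, isOpen_compl_singleton.mem_nhds hcv]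
    with c' h3 h4 h5
  refine ⟨h5, h4, ?_⟩
  have : HasLog (hh v c' c) F := by
    refine hasLog_near_one ((hh_continuousOn hcv).mono fun z hz => ?_) fun z hz => ?_
    · rintro rfl; exact hc hz
    · by_cases hzv : z = v
      · subst hzv; simp [hh_self_base]
      · have hzc : z ≠ c := by rintro rfl; exact hc hz
        have h6 := sg_sub_ne hzv hcv hzc
        have h7 : δ ≤ ‖sg v z - sg v c‖ := by
          by_contra hlt
          push Not at hlt
          have : sg v z ∈ ball (sg v c) δ := by rwa [mem_ball, dist_eq_norm]
          have := hb this
          rw [mem_preimage, tu_sg v z hzv] at this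
          exact this hz
        rw [hh_of_ne _ _ hzv]
        have : (sg v z - sg v c') / (sg v z - sg v c) - 1
          = (sg v c - sg v c') / (sg v z - sg v c) := by field_simp; ring
        rw [this, norm_div, div_lt_one (norm_pos_iff.2 h6)]
        refine lt_of_lt_of_le ?_ h7
        rw [mem_ball, dist_eq_norm, norm_sub_rev] at h3
        exact h3
  exact this.inv.congr fun z _ => hh_inv

/-- E1. -/
lemma hasLog_hh_of_connected [CompactSpace S] {v a b : S} {F C : Set S} (hF : IsClosed F)
    (hv : v ∈ F) (hC : IsPreconnected C) (hCF : Disjoint C F) (ha : a ∈ C) (hb : b ∈ C) :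
    HasLog (hh v a b) F := by
  have hne : ∀ x ∈ C, x ∉ F := fun x hx hxF => disjoint_left.1 hCF hx hxF
  have hnv : ∀ x ∈ C, x ≠ v := fun x hx e => hne x hx (e ▸ hv)
  refine hC.induction₂ (fun x y => HasLog (hh v x y) F) (fun x hx => ?_) ?_ ?_ ha hb
  · refine mem_nhdsWithin_of_mem_nhds ?_
    filter_upwards [hasLog_hh_near hF (hne x hx) (hnv x hx)] with y hy
    exact hy.2.2
  · intro x y z hx hy hz h1 h2
    exact (h1.mul h2).congr fun w hw => hh_mul (hnv y hy) (by rintro rfl; exact hne _ hy hw)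
  · intro x y hx hy h
    exact h.inv.congr fun w hw => hh_inv

/-- E1'. -/
lemma hasLog_sub_of_connected [CompactSpace S] {v a : S} {F C : Set S} (hF : IsClosed F)
    (hC : IsPreconnected C) (hCF : Disjoint C F) (ha : a ∈ C) (hv : v ∈ C) (hav : a ≠ v) :
    HasLog (fun z => sg v z - sg v a) F := by
  have hne : ∀ x ∈ C, x ∉ F := fun x hx hxF => disjoint_left.1 hCF hx hxF
  have hFv : ∀ z ∈ F, z ≠ v := fun z hz e => hne v hv (e ▸ hz)
  let Q : S → Prop := fun x => x = v ∨ HasLog (fun z => sg v z - sg v x) F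
  have : Q v ↔ Q a := by
    refine hC.induction₂ (fun x y => Q x ↔ Q y) (fun x hx => ?_) ?_ ?_ hv ha
    · refine mem_nhdsWithin_of_mem_nhds ?_
      by_cases hxv : x = v
      · subst hxv
        have hcomp : IsCompact (sg x '' F) := hF.isCompact.image_of_continuousOn
          ((sg_cont x).mono fun z hz => hFv z hz)
        obtain ⟨R, hR⟩ := hcomp.isBounded.exists_norm_le
        filter_upwards [eventually_sg_large x R] with y hy
        refine iff_of_true (Or.inl rfl) ?_
        by_cases hyx : y = x
        · exact Or.inl hyx
        · refine Or.inr (hasLog_near (- sg x y)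
            (((sg_cont x).mono fun z hz => hFv z hz).sub continuousOn_const) fun z hz => ?_)
          have h1 := hy hyx
          have h2 := hR _ (mem_image_of_mem _ hz)
          rw [norm_neg]
          have : sg x z - sg x y - - sg x y = sg x z := by ring
          rw [this]; linarith
      · filter_upwards [hasLog_hh_near hF (hne x hx) hxv] with y hy
        have e : ∀ z ∈ F, hh v x y z * (sg v z - sg v y) = sg v z - sg v x := fun z hz => by
          rw [hh_of_ne _ _ (hFv z hz)]
          exact div_mul_cancel₀ _ (sg_sub_ne (hFv z hz) hy.1 (by rintro rfl; exact hy.2.1 hz))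
        have e' : ∀ z ∈ F, (hh v x y z)⁻¹ * (sg v z - sg v x) = sg v z - sg v y := fun z hz => by
          rw [hh_inv, hh_of_ne _ _ (hFv z hz)]
          exact div_mul_cancel₀ _ (sg_sub_ne (hFv z hz) hxv (by rintro rfl; exact hne _ hx hz))
        constructor
        · rintro (h | h)
          · exact absurd h hxv
          · exact Or.inr ((hy.2.2.inv.mul h).congr e')
        · rintro (h | h)
          · exact absurd h hy.1
          · exact Or.inr ((hy.2.2.mul h).congr e)
    · intro x y z _ _ _ h1 h2; exact h1.trans h2
    · intro x y _ _ h; exact h.symm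
  exact (this.1 (Or.inl rfl)).resolve_left hav

/-- Any nonvanishing continuous function on the complement of a point has a log. -/
lemma hasLog_compl_singleton {b : S} {f : S → ℂ} (hf : ContinuousOn f {b}ᶜ)
    (h0 : ∀ z, z ≠ b → f z ≠ 0) : HasLog f {b}ᶜ := by
  have h1 : HasLog (f ∘ tu b) univ := by
    refine hasLog_univ_of_simplyConnected ?_ fun z => h0 _ (tu_ne b z)
    exact hf.comp_continuous (tu_cont b) fun z => tu_ne b z
  refine (h1.comp (p := sg b) (sg_cont b) (mapsTo_univ _ _)).congr fun z hz => ?_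
  simp [tu_sg b z hz]

lemma frontier_component_subset [LocallyConnectedSpace S] {F : Set S} (hF : IsClosed F) (a : S) :
    frontier (connectedComponentIn Fᶜ a) ⊆ F := by
  intro z hz
  by_contra hzF
  have ho : IsOpen (connectedComponentIn Fᶜ a) := hF.isOpen_compl.connectedComponentIn
  rw [ho.frontier_eq] at hz
  have hn : connectedComponentIn Fᶜ z ∈ 𝓝 z :=
    hF.isOpen_compl.connectedComponentIn.mem_nhds (mem_connectedComponentIn hzF)
  obtain ⟨y, hy1, hy2⟩ := mem_closure_iff_nhds.1 hz.1 _ hn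
  apply hz.2
  rw [connectedComponentIn_eq hy2, ← connectedComponentIn_eq hy1]
  exact mem_connectedComponentIn hzF

/-- E2. -/
lemma mem_component_of_hasLog [CompactSpace S] [LocallyConnectedSpace S] {v a b : S} {F : Set S}
    (hF : IsClosed F) (ha : a ∉ F) (hb : b ∉ F) (hav : a ≠ v) (hbv : b ≠ v)
    (hlog : HasLog (hh v a b) F) : b ∈ connectedComponentIn Fᶜ a := by
  classical
  by_contra hbD
  set D := connectedComponentIn Fᶜ a with hD
  have haD : a ∈ D := mem_connectedComponentIn ha
  have hDo : IsOpen D := hF.isOpen_compl.connectedComponentIn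
  have hfr : frontier D ⊆ F := frontier_component_subset hF a
  have hbcl : b ∉ closure D := fun h => hb (hfr (by rw [hDo.frontier_eq]; exact ⟨h, hbD⟩))
  obtain ⟨g, hg⟩ := hlog
  obtain ⟨G, hG⟩ := ContinuousMap.exists_restrict_eq hF
    (⟨F.domRestrict g, continuousOn_iff_continuous_domRestrict.1 hg.1⟩ : C(F, ℂ))
  have hG' : ∀ z ∈ F, G z = g z := fun z hz => DFunLike.congr_fun hG ⟨z, hz⟩
  let φ : S → ℂ := D.piecewise (fun z => Complex.exp (G z)) (hh v a b)
  have hφ : ContinuousOn φ {b}ᶜ := by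
    refine ContinuousOn.piecewise (fun z hz => ?_) (by fun_prop) ?_
    · rw [hG' z (hfr hz.2), hg.2 z (hfr hz.2)]
    · exact (hh_continuousOn hbv).mono inter_subset_left
  have hφ0 : ∀ z, z ≠ b → φ z ≠ 0 := fun z hz => by
    by_cases hzD : z ∈ D
    · simp only [φ, piecewise_eq_of_mem _ _ _ hzD]; exact Complex.exp_ne_zero _
    · simp only [φ, piecewise_eq_of_notMem _ _ _ hzD]
      exact hh_ne_zero hav hbv (by rintro rfl; exact hzD haD) hz
  have hlogφ := hasLog_compl_singleton hφ hφ0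
  have hab : sg v b - sg v a ≠ 0 := sg_sub_ne hbv hav (by rintro rfl; exact hbD haD)
  have h1 : tu v ⁻¹' (closure D)ᶜ ∈ 𝓝 (sg v b) :=
    (isClosed_closure.isOpen_compl.preimage (tu_cont v)).mem_nhds
      (by simpa [tu_sg v b hbv] using hbcl)
  obtain ⟨δ, hδ, hball⟩ := Metric.mem_nhds_iff.1 h1
  let r := min (δ / 2) (‖sg v b - sg v a‖ / 2)
  have hr : 0 < r := lt_min (half_pos hδ) (half_pos (norm_pos_iff.2 hab))
  have hrδ : r < δ := lt_of_le_of_lt (min_le_left _ _) (half_lt_self hδ)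
  have hrab : r < ‖sg v b - sg v a‖ :=
    lt_of_le_of_lt (min_le_right _ _) (half_lt_self (norm_pos_iff.2 hab))
  apply no_log_circle hr
  let p : ℂ → S := fun w => tu v (sg v b + w)
  have hp : Continuous p := (tu_cont v).comp (by fun_prop)
  have hw0 : ∀ w ∈ sphere (0:ℂ) r, w ≠ 0 := fun w hw e => by
    subst e; simp at hw; exact hr.ne hw
  have h2 : HasLog (φ ∘ p) (sphere 0 r) := hlogφ.comp hp.continuousOn fun w hw => by
    intro e
    have : sg v b + w = sg v b := by rw [← sg_tu v (sg v b + w)]; exact congrArg _ e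
    exact hw0 w hw (by simpa using this)
  have h3 : HasLog (fun w : ℂ => w + (sg v b - sg v a)) (sphere 0 r) :=
    hasLog_near (sg v b - sg v a) (by fun_prop) fun w hw => by
      simp at hw ⊢; rwa [hw]
  refine (h2.inv.mul h3).congr fun w hw => ?_
  have hpD : p w ∉ D := by
    have : sg v b + w ∈ ball (sg v b) δ := by
      simp at hw; simp [hw, hrδ]
    exact fun h => hball this (subset_closure h)
  have e : φ (p w) = (w + (sg v b - sg v a)) / w := by
    simp only [φ, piecewise_eq_of_notMem _ _ _ hpD]
    rw [hh_of_ne _ _ (tu_ne _ _), sg_tu]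
    ring
  simp only [Function.comp]
  have hne : w + (sg v b - sg v a) ≠ 0 := fun h => by
    have : w = -(sg v b - sg v a) := eq_neg_of_add_eq_zero_left h
    simp at hw
    rw [this, norm_neg] at hw
    exact hrab.ne hw.symm
  rw [e, inv_div, div_mul_cancel₀ _ hne]

lemma hasLog_univ [CompactSpace S] [Nonempty S] {f : S → ℂ} (hf : Continuous f)
    (h0 : ∀ z, f z ≠ 0) : HasLog f univ := by
  obtain ⟨v⟩ : Nonempty S := inferInstance
  have h1 : {z | ‖f z - f v‖ < ‖f v‖} ∈ 𝓝 v :=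
    (isOpen_lt (by fun_prop) continuous_const).mem_nhds (by simp [h0])
  have h2 : ∃ R > 0, ∀ z, z ≠ v → R ≤ ‖sg v z‖ → ‖f z - f v‖ < ‖f v‖ := by
    have hK : IsCompact (sg v '' (interior {z | ‖f z - f v‖ < ‖f v‖})ᶜ) :=
      (isOpen_interior.isClosed_compl.isCompact).image_of_continuousOn
        ((sg_cont v).mono fun z hz e => hz (by
          rw [mem_singleton_iff.1 e]; exact mem_interior_iff_mem_nhds.2 h1))
    obtain ⟨R, hR⟩ := hK.isBounded.exists_norm_le
    refine ⟨|R| + 1, by positivity, fun z hz hzR => ?_⟩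
    by_contra hcon
    have hmem : z ∈ (interior {z | ‖f z - f v‖ < ‖f v‖})ᶜ := fun h => by
      have := interior_subset h
      exact hcon this
    have := hR _ (mem_image_of_mem _ hmem)
    have := le_abs_self R
    linarith
  obtain ⟨R, hR, hRz⟩ := h2
  let F1 : Set S := tu v '' closedBall 0 R
  let F2 : Set S := (tu v '' ball 0 R)ᶜ
  have hF1 : IsClosed F1 := ((isCompact_closedBall (0:ℂ) R).image (tu_cont v)).isClosed
  have hF2 : IsClosed F2 := by
    have : tu v '' ball 0 R = {v}ᶜ ∩ sg v ⁻¹' ball 0 R := by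
      ext z
      constructor
      · rintro ⟨w, hw, rfl⟩
        exact ⟨tu_ne v w, by rwa [mem_preimage, sg_tu]⟩
      · rintro ⟨hz, hz'⟩
        exact ⟨sg v z, hz', tu_sg v z hz⟩
    have ho : IsOpen (tu v '' ball 0 R) := by
      rw [this]
      exact (sg_cont v).isOpen_inter_preimage isOpen_compl_singleton isOpen_ball
    exact ho.isClosed_compl
  have hl1 : HasLog f F1 := (hasLog_compl_singleton hf.continuousOn fun z _ => h0 z).mono (by
    rintro _ ⟨w, -, rfl⟩; exact tu_ne v w)
  have hl2 : HasLog f F2 := hasLog_near (f v) hf.continuousOn fun z hz => by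
    by_cases hzv : z = v
    · subst hzv; simp [h0]
    · refine hRz z hzv ?_
      by_contra hlt
      exact hz ⟨sg v z, by simpa using hlt, tu_sg v z hzv⟩
  have hi : F1 ∩ F2 = tu v '' sphere 0 R := by
    ext z
    constructor
    · rintro ⟨⟨w, hw, rfl⟩, h2⟩
      refine ⟨w, ?_, rfl⟩
      by_contra hne
      apply h2
      refine ⟨w, ?_, rfl⟩
      simp at hw hne ⊢
      exact lt_of_le_of_ne hw hne
    · rintro ⟨w, hw, rfl⟩
      refine ⟨⟨w, sphere_subset_closedBall hw, rfl⟩, ?_⟩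
      rintro ⟨w', hw', e⟩
      rw [tu_injective v e] at hw'
      simp at hw hw'
      exact hw'.ne hw
  have hpre : IsPreconnected (F1 ∩ F2) := by
    rw [hi]
    refine (isPreconnected_sphere ?_ _ _).image _ (tu_cont v).continuousOn
    rw [Complex.rank_real_complex]; exact Nat.one_lt_ofNat
  refine (hl1.glue hl2 hF1 hF2 hpre).mono fun z _ => ?_
  by_cases hz : z ∈ F1
  · exact Or.inl hz
  · refine Or.inr fun ⟨w, hw, e⟩ => hz ⟨w, ball_subset_closedBall hw, e⟩

/-- Unicoherence. -/
lemma unicoherent [CompactSpace S] {A B : Set S} (hA : IsClosed A) (hB : IsClosed B)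
    (hAc : IsPreconnected A) (hBc : IsPreconnected B) (hU : A ∪ B = univ) :
    IsPreconnected (A ∩ B) := by
  classical
  rw [isPreconnected_closed_iff]
  intro t t' ht ht' hsub ⟨p, hp⟩ ⟨q, hq⟩
  by_contra hne
  rw [not_nonempty_iff_eq_empty] at hne
  have : Nonempty S := ⟨p⟩
  have hdisj : Disjoint (A ∩ B ∩ t) (A ∩ B ∩ t') := by
    rw [disjoint_iff_inter_eq_empty, ← hne]
    ext z; simp only [mem_inter_iff]; tauto
  obtain ⟨u, hu0, hu1, -⟩ := exists_continuous_zero_one_of_isClosed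
    ((hA.inter hB).inter ht) ((hA.inter hB).inter ht') hdisj
  let φ : S → ℂ := fun z => if z ∈ A then Complex.exp (u z * (2 * Real.pi * Complex.I)) else 1
  have hφA : ∀ z ∈ A, φ z = Complex.exp (u z * (2 * Real.pi * Complex.I)) := fun z hz => if_pos hz
  have hφB : ∀ z ∈ B, φ z = 1 := fun z hz => by
    by_cases hzA : z ∈ A
    · rw [hφA z hzA]
      rcases hsub ⟨hzA, hz⟩ with h | h
      · rw [hu0 ⟨⟨hzA, hz⟩, h⟩]; simp
      · rw [hu1 ⟨⟨hzA, hz⟩, h⟩]; simp [Complex.exp_two_pi_mul_I]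
    · exact if_neg hzA
  have hφ : Continuous φ := by
    rw [← continuousOn_univ, ← hU]
    refine ContinuousOn.union_of_isClosed ?_ ?_ hA hB
    · exact ContinuousOn.congr (by fun_prop) hφA
    · exact continuousOn_const.congr hφB
  have hφ0 : ∀ z, φ z ≠ 0 := fun z => by
    by_cases hzA : z ∈ A
    · rw [hφA z hzA]; exact Complex.exp_ne_zero _
    · simp [φ, hzA]
  obtain ⟨g, hg⟩ := hasLog_univ hφ hφ0
  have l1 : IsLog φ (fun z => u z * (2 * Real.pi * Complex.I)) A :=
    ⟨by fun_prop, fun z hz => (hφA z hz).symm⟩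
  have l2 : IsLog φ (fun _ => 0) B :=
    ⟨by fun_prop, fun z hz => by simp [hφB z hz]⟩
  obtain ⟨n, hn⟩ := (hg.mono (subset_univ A)).unique l1 hAc
  obtain ⟨m, hm⟩ := (hg.mono (subset_univ B)).unique l2 hBc
  have e1 := (hn p hp.1.1).symm.trans (hm p hp.1.2)
  have e2 := (hn q hq.1.1).symm.trans (hm q hq.1.2)
  simp only [hu0 hp] at e1
  simp only [hu1 hq] at e2
  apply two_pi_I_ne
  simp only [Pi.zero_apply, Pi.one_apply, Complex.ofReal_zero, Complex.ofReal_one] at e1 e2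
  linear_combination e2 - e1

end SphereLog

section GenTop

variable {T : Type*} [TopologicalSpace T]

/-- The complement of a component of the complement of a connected set is connected. -/
lemma isPreconnected_compl_component [PreconnectedSpace T] {C : Set T} (hC : IsPreconnected C)
    (x : T) : IsPreconnected (connectedComponentIn Cᶜ x)ᶜ := by
  by_cases hx : x ∈ C
  · have : connectedComponentIn Cᶜ x = ∅ := connectedComponentIn_eq_empty (by simpa using hx)
    rw [this, compl_empty]; exact isPreconnected_univ
  set L := connectedComponentIn Cᶜ x with hL
  have hxL : x ∈ L := mem_connectedComponentIn hx
  have hLp : IsPreconnected L := isPreconnected_connectedComponentIn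
  have hCL : C ⊆ Lᶜ := fun z hz hzL => connectedComponentIn_subset _ _ hzL hz
  -- key claim
  have key : ∀ u v : Set T, IsOpen u → IsOpen v → Lᶜ ⊆ u ∪ v → Lᶜ ∩ (u ∩ v) = ∅ → C ⊆ u →
      ¬ (Lᶜ ∩ v).Nonempty := by
    intro u v hu hv huv hd hCu ⟨q, hqL, hqv⟩
    have hp : IsPreconnected (L ∪ (Lᶜ ∩ v)) := by
      have aux : ∀ s t : Set T, IsOpen s → IsOpen t → L ∪ (Lᶜ ∩ v) ⊆ s ∪ t →
          (L ∪ (Lᶜ ∩ v)) ∩ (s ∩ t) = ∅ → L ⊆ s → ¬ ((L ∪ (Lᶜ ∩ v)) ∩ t).Nonempty := by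
        intro s t hs ht hst hd' hLs ⟨w, hw, hwt⟩
        have hwL : w ∉ L := fun h => by
          have : w ∈ (L ∪ (Lᶜ ∩ v)) ∩ (s ∩ t) := ⟨hw, hLs h, hwt⟩
          rw [hd'] at this; exact this
        have hwv : w ∈ v := (hw.resolve_left hwL).2
        have hvt : ∀ y, y ∈ v → y ∈ t → y ∉ L := fun y h1 h2 h => by
          have : y ∈ (L ∪ (Lᶜ ∩ v)) ∩ (s ∩ t) := ⟨Or.inl h, hLs h, h2⟩
          rw [hd'] at this; exact this
        have hclop : IsClopen (v ∩ t) := by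
          refine ⟨⟨?_⟩, hv.inter ht⟩
          rw [isOpen_iff_forall_mem_open]
          intro y hy
          by_cases hyQ : y ∈ L ∪ (Lᶜ ∩ v)
          · have hys : y ∈ s := by
              rcases hst hyQ with h | h
              · exact h
              · by_cases hyL : y ∈ L
                · exact hLs hyL
                · exact absurd ⟨(hyQ.resolve_left hyL).2, h⟩ hy
            refine ⟨s, fun z hz hz' => ?_, hs, hys⟩
            have : z ∈ (L ∪ (Lᶜ ∩ v)) ∩ (s ∩ t) :=
              ⟨Or.inr ⟨hvt z hz'.1 hz'.2, hz'.1⟩, hz, hz'.2⟩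
            rw [hd'] at this; exact this
          · have hyL : y ∉ L := fun h => hyQ (Or.inl h)
            have hyu : y ∈ u := (huv hyL).resolve_right fun h => hyQ (Or.inr ⟨hyL, h⟩)
            refine ⟨u, fun z hz hz' => ?_, hu, hyu⟩
            have : z ∈ Lᶜ ∩ (u ∩ v) := ⟨hvt z hz'.1 hz'.2, hz, hz'.1⟩
            rw [hd] at this; exact this
        have := hclop.eq_univ ⟨w, hwv, hwt⟩
        have hx' : x ∈ v ∩ t := this ▸ mem_univ x
        exact hvt x hx'.1 hx'.2 hxL
      intro s t hs ht hst h1 h2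
      by_contra hne
      rw [not_nonempty_iff_eq_empty] at hne
      have hd'' : L ∩ (s ∩ t) = ∅ := by
        rw [← subset_empty_iff, ← hne]
        exact inter_subset_inter_left _ subset_union_left
      rcases isPreconnected_iff_subset_of_disjoint.1 hLp s t hs ht
        (subset_union_left.trans hst) hd'' with h | h
      · exact aux s t hs ht hst hne h h2
      · exact aux t s ht hs (by rwa [union_comm t s]) (by rwa [inter_comm t s]) h h1
    have hsub : L ∪ (Lᶜ ∩ v) ⊆ L := by
      refine hp.subset_connectedComponentIn (Or.inl hxL) ?_
      rintro z (hz | ⟨hz1, hz2⟩) hzC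
      · exact hCL hzC hz
      · have : z ∈ Lᶜ ∩ (u ∩ v) := ⟨hz1, hCu hzC, hz2⟩
        rw [hd] at this; exact this
    exact hqL (hsub (Or.inr ⟨hqL, hqv⟩))
  intro u v hu hv huv h1 h2
  by_contra hne
  rw [not_nonempty_iff_eq_empty] at hne
  have hdC : C ∩ (u ∩ v) = ∅ := by
    rw [← subset_empty_iff, ← hne]
    exact inter_subset_inter_left _ hCL
  rcases isPreconnected_iff_subset_of_disjoint.1 hC u v hu hv (hCL.trans huv) hdC with h | h
  · exact key u v hu hv huv hne h h2
  · exact key v u hv hu (by rwa [union_comm v u]) (by rwa [inter_comm v u]) h h1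

/-- A preconnected set meeting an open set and its complement meets its frontier. -/
lemma IsPreconnected.meets_frontier {C V : Set T} (hC : IsPreconnected C)
    (h1 : (C ∩ V).Nonempty) (h2 : (C ∩ Vᶜ).Nonempty) : (C ∩ frontier V).Nonempty := by
  by_contra hne
  rw [not_nonempty_iff_eq_empty] at hne
  have hsub : C ⊆ interior V ∪ (closure V)ᶜ := fun z hz => by
    by_contra h
    simp only [mem_union, mem_compl_iff, not_or, not_not] at h
    have : z ∈ C ∩ frontier V := ⟨hz, h.2, h.1⟩
    rw [hne] at this; exact this
  obtain ⟨p, hp1, hp2⟩ := h1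
  obtain ⟨q, hq1, hq2⟩ := h2
  obtain ⟨w, -, hw1, hw2⟩ := hC _ _ isOpen_interior isClosed_closure.isOpen_compl hsub
    ⟨p, hp1, (hsub hp1).resolve_right fun h => h (subset_closure hp2)⟩
    ⟨q, hq1, (hsub hq1).resolve_left fun h => hq2 (interior_subset h)⟩
  exact hw2 (subset_closure (interior_subset hw1))

/-- Clopen splitting of a compact set away from a component. -/
lemma exists_split [T2Space T] {A : Set T} (hA : IsCompact A) {e z : T} (he : e ∈ A) (hz : z ∈ A)
    (h : z ∉ connectedComponentIn A e) :
    ∃ P Q, IsClosed P ∧ IsClosed Q ∧ P ∪ Q = A ∧ Disjoint P Q ∧ z ∈ P ∧ e ∈ Q := by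
  have : CompactSpace A := isCompact_iff_compactSpace.1 hA
  rw [connectedComponentIn_eq_image he] at h
  have h' : (⟨z, hz⟩ : A) ∉ connectedComponent (⟨e, he⟩ : A) := fun h2 => h ⟨_, h2, rfl⟩
  rw [connectedComponent_eq_iInter_isClopen, mem_iInter] at h'
  push Not at h'
  obtain ⟨⟨s, hs, hes⟩, hzs⟩ := h'
  have hcl : ∀ {s : Set A}, IsClosed s → IsClosed ((↑) '' s : Set T) := fun {s} h =>
    (hA.isClosed.isClosedEmbedding_subtypeVal.isClosedMap) _ h
  refine ⟨(↑) '' sᶜ, (↑) '' s, hcl hs.2.isClosed_compl, hcl hs.1, ?_, ?_, ⟨_, hzs, rfl⟩,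
    ⟨_, hes, rfl⟩⟩
  · rw [← image_union, compl_union_self, image_univ, Subtype.range_coe]
  · exact (disjoint_image_iff Subtype.val_injective).2 disjoint_compl_left

end GenTop

section Lines

set_option linter.unusedSectionVars false

variable {S : Type*} [MetricSpace S] [CompactSpace S]

/-- A properly embedded line in the open set `U`. -/
structure IsLine (U : Set S) (γ : ℝ → S) : Prop where
  cont : Continuous γ
  inj : Function.Injective γ
  mem : ∀ t, γ t ∈ U
  proper : ∀ C, IsCompact C → C ⊆ U → ∃ R : ℝ, ∀ t, γ t ∈ C → |t| ≤ R

namespace IsLine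

variable {U : Set S} {γ : ℝ → S}

lemma tails (h : IsLine U γ) {N : Set S} (hN : IsOpen N) (hUN : Uᶜ ⊆ N) :
    ∃ R : ℝ, ∀ t, R < |t| → γ t ∈ N := by
  obtain ⟨R, hR⟩ := h.proper Nᶜ hN.isClosed_compl.isCompact (compl_subset_comm.1 hUN)
  refine ⟨R, fun t ht => ?_⟩
  by_contra hc
  exact absurd (hR t hc) (not_le.2 ht)

lemma exists_nhd (h : IsLine U γ) (hU : IsOpen U) {z : S} (hz : z ∈ U) :
    ∃ W, IsOpen W ∧ z ∈ W ∧ W ⊆ U ∧ ∃ R : ℝ, ∀ t, γ t ∈ W → |t| ≤ R := by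
  obtain ⟨C, hC, hzC, hCU⟩ := exists_compact_subset hU hz
  obtain ⟨R, hR⟩ := h.proper C hC hCU
  exact ⟨interior C, isOpen_interior, hzC, interior_subset.trans hCU, R,
    fun t ht => hR t (interior_subset ht)⟩

lemma isClosed_union_image (h : IsLine U γ) (hU : IsOpen U) {I : Set ℝ} (hI : IsClosed I) :
    IsClosed (Uᶜ ∪ γ '' I) := by
  rw [← isOpen_compl_iff, isOpen_iff_forall_mem_open]
  intro z hz
  simp only [compl_union, compl_compl] at hz
  obtain ⟨W, hW, hzW, hWU, R, hR⟩ := h.exists_nhd hU hz.1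
  have hcl : IsClosed (γ '' (I ∩ Icc (-R) R)) :=
    ((isCompact_Icc.inter_left hI).image h.cont).isClosed
  refine ⟨W ∩ (γ '' (I ∩ Icc (-R) R))ᶜ, ?_, hW.inter hcl.isOpen_compl, hzW, ?_⟩
  · rintro y ⟨hy1, hy2⟩
    simp only [compl_union, compl_compl]
    refine ⟨hWU hy1, ?_⟩
    rintro ⟨t, ht, rfl⟩
    exact hy2 ⟨t, ⟨ht, abs_le.1 (hR t hy1)⟩, rfl⟩
  · exact fun ⟨t, ht, e⟩ => hz.2 ⟨t, ht.1, e⟩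

lemma isEmbedding (h : IsLine U γ) (hU : IsOpen U) : IsEmbedding γ := by
  refine ⟨isInducing_iff_nhds.2 fun t0 => le_antisymm h.cont.continuousAt.le_comap ?_, h.inj⟩
  intro s hs
  obtain ⟨ε, hε, hball⟩ := Metric.mem_nhds_iff.1 hs
  obtain ⟨W, hW, hzW, hWU, R, hR⟩ := h.exists_nhd hU (h.mem t0)
  have hcl : IsClosed (γ '' (Icc (-R) R \ ball t0 ε)) :=
    ((isCompact_Icc.diff isOpen_ball).image h.cont).isClosed
  refine ⟨W ∩ (γ '' (Icc (-R) R \ ball t0 ε))ᶜ, (hW.inter hcl.isOpen_compl).mem_nhds ⟨hzW, ?_⟩, ?_⟩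
  · rintro ⟨t, ht, e⟩
    rw [h.inj e] at ht
    exact ht.2 (mem_ball_self hε)
  · rintro t ⟨h1, h2⟩
    apply hball
    by_contra hc
    exact h2 ⟨t, ⟨abs_le.1 (hR t h1), hc⟩, rfl⟩

lemma continuousOn_inv (h : IsLine U γ) (hU : IsOpen U) :
    ContinuousOn (Function.invFun γ) (range γ) := by
  rintro _ ⟨t, rfl⟩
  have hl := Function.leftInverse_invFun h.inj
  rw [ContinuousWithinAt, ← (h.isEmbedding hU).map_nhds_eq, tendsto_map'_iff, hl t]
  have : Function.invFun γ ∘ γ = id := funext hl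
  rw [this]; exact tendsto_id

lemma frontier_sub (h : IsLine U γ) (hU : IsOpen U) : closure (range γ) \ range γ ⊆ frontier U := by
  rintro z ⟨hz1, hz2⟩
  have hc := h.isClosed_union_image hU isClosed_univ
  rw [image_univ] at hc
  have h1 : z ∈ Uᶜ ∪ range γ := closure_minimal subset_union_right hc hz1
  rw [hU.frontier_eq]
  exact ⟨closure_mono (range_subset_iff.2 h.mem) hz1, h1.resolve_right hz2⟩

lemma isGenCrosscut (h : IsLine U γ) (hU : IsOpen U) : IsGenCrosscut U (range γ) := by
  refine ⟨range_subset_iff.2 h.mem, ?_, h.frontier_sub hU⟩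
  have e1 : ℝ ≃ₜ range γ := (h.isEmbedding hU).toHomeomorph
  have e2 : ℝ ≃ₜ ball (0:ℝ) 1 := Homeomorph.unitBall
  have e3 : ball (0:ℝ) 1 ≃ₜ Ioo (-1:ℝ) 1 := Homeomorph.setCongr (by
    rw [Real.ball_eq_Ioo]; norm_num)
  have e4 : Ioo (-1:ℝ) 1 ≃ₜ Ioo (0:ℝ) 1 :=
    { toFun := fun t => ⟨(t.1 + 1) / 2, by have := t.2.1; have := t.2.2; constructor <;> linarith⟩
      invFun := fun t => ⟨2 * t.1 - 1, by have := t.2.1; have := t.2.2; constructor <;> linarith⟩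
      left_inv := fun t => by ext; simp; ring
      right_inv := fun t => by ext; simp
      continuous_toFun := by fun_prop
      continuous_invFun := by fun_prop }
  exact ⟨e1.symm.trans (e2.trans (e3.trans e4))⟩

end IsLine

lemma IsGenCrosscut.exists_line {U K : Set S} (hU : IsOpen U) (h : IsGenCrosscut U K) :
    ∃ γ, IsLine U γ ∧ range γ = K := by
  obtain ⟨hKU, ⟨e⟩, hfr⟩ := h
  have e2 : ℝ ≃ₜ ball (0:ℝ) 1 := Homeomorph.unitBall
  have e3 : ball (0:ℝ) 1 ≃ₜ Ioo (-1:ℝ) 1 := Homeomorph.setCongr (by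
    rw [Real.ball_eq_Ioo]; norm_num)
  have e4 : Ioo (-1:ℝ) 1 ≃ₜ Ioo (0:ℝ) 1 :=
    { toFun := fun t => ⟨(t.1 + 1) / 2, by have := t.2.1; have := t.2.2; constructor <;> linarith⟩
      invFun := fun t => ⟨2 * t.1 - 1, by have := t.2.1; have := t.2.2; constructor <;> linarith⟩
      left_inv := fun t => by ext; simp; ring
      right_inv := fun t => by ext; simp
      continuous_toFun := by fun_prop
      continuous_invFun := by fun_prop }
  let f : ℝ ≃ₜ K := (e2.trans (e3.trans e4)).trans e.symm
  refine ⟨fun t => f t, ⟨by fun_prop, fun s t h => f.injective (Subtype.ext h),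
    fun t => hKU (f t).2, fun C hC hCU => ?_⟩, ?_⟩
  · have h1 : closure K ∩ C = K ∩ C := by
      refine Subset.antisymm (fun z hz => ⟨?_, hz.2⟩) (inter_subset_inter_left _ subset_closure)
      by_contra hzK
      have := hfr ⟨hz.1, hzK⟩
      rw [hU.frontier_eq] at this
      exact this.2 (hCU hz.2)
    have h2 : IsCompact (K ∩ C) := h1 ▸ hC.inter_left isClosed_closure
    have h3 : IsCompact ((↑) ⁻¹' C : Set K) := by
      rw [Subtype.isCompact_iff, Subtype.image_preimage_coe]; exact h2
    have h4 : IsCompact (f ⁻¹' ((↑) ⁻¹' C)) := f.isCompact_preimage.2 h3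
    obtain ⟨R, hR⟩ := h4.isBounded.exists_norm_le
    exact ⟨R, fun t ht => hR t ht⟩
  · ext z
    constructor
    · rintro ⟨t, rfl⟩; exact (f t).2
    · intro hz; exact ⟨f.symm ⟨z, hz⟩, by simp⟩

end Lines

section LineSphere

set_option linter.unusedSectionVars false

variable {S : Type*} [MetricSpace S] [CompactSpace S] [SphereLike S] [LocallyConnectedSpace S]
  [PreconnectedSpace S]

namespace IsLine

variable {U : Set S} {γ : ℝ → S}

lemma hasLog_Icc (h : IsLine U γ) (hU : IsOpen U) {f : S → ℂ} {a b : ℝ} (hab : a ≤ b)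
    (hf : ContinuousOn f (γ '' Icc a b)) (h0 : ∀ z ∈ γ '' Icc a b, f z ≠ 0) :
    HasLog f (γ '' Icc a b) := by
  have h1 : HasLog (fun t : ℝ => f (γ (projIcc a b hab t))) univ := by
    refine hasLog_univ_of_simplyConnected ?_ fun t => h0 _ ⟨_, (projIcc a b hab t).2, rfl⟩
    exact hf.comp_continuous (h.cont.comp (continuous_subtype_val.comp continuous_projIcc))
      fun t => ⟨_, (projIcc a b hab t).2, rfl⟩
  have h2 := h1.comp (p := Function.invFun γ) (F' := γ '' Icc a b)
    ((h.continuousOn_inv hU).mono (image_subset_range _ _)) (mapsTo_univ _ _)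
  refine h2.congr ?_
  rintro _ ⟨t, ht, rfl⟩
  simp only [Function.comp, Function.leftInverse_invFun h.inj t]
  rw [projIcc_of_mem hab ht]

/-- Extending a log from the complement of `U` along the two tails of a line. -/
lemma hasLog_tails (h : IsLine U γ) (hU : IsOpen U) {f : S → ℂ} {s t : ℝ} (hst : s < t)
    {W : Set S} (hW : IsOpen W) (hf : ContinuousOn f W) (hUW : Uᶜ ⊆ W)
    (h0 : ∀ z ∈ W, f z ≠ 0) (hs : γ '' Iic s ⊆ W) (ht : γ '' Ici t ⊆ W)
    (hl : HasLog f Uᶜ) : HasLog f (Uᶜ ∪ γ '' (Iic s ∪ Ici t)) := by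
  obtain ⟨g, hg⟩ := hl
  obtain ⟨N, hN, hUN, hNW, G, hG, -⟩ := hg.extend hU.isClosed_compl hW hUW hf
  obtain ⟨R0, hR0⟩ := h.tails hN hUN
  let R := |R0| + |s| + |t| + 1
  have hR1 : R0 < R := by
    have := le_abs_self R0; have := abs_nonneg s; have := abs_nonneg t; simp only [R]; linarith
  have hRs : -R < s := by
    have := neg_abs_le s; have := abs_nonneg R0; have := abs_nonneg t; simp only [R]; linarith
  have hRt : t < R := by
    have := le_abs_self t; have := abs_nonneg R0; have := abs_nonneg s; simp only [R]; linarith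
  have hR : 0 < R := by positivity
  have l0 : HasLog f (Uᶜ ∪ γ '' (Iic (-R) ∪ Ici R)) := by
    refine ⟨G, hG.mono ?_⟩
    rintro z (hz | ⟨x, hx, rfl⟩)
    · exact hUN hz
    · apply hR0
      rcases hx with hx | hx
      · have := neg_le_abs x
        have : x ≤ -R := hx
        linarith
      · have := le_abs_self x
        have : R ≤ x := hx
        linarith
  have c0 := h.isClosed_union_image hU (isClosed_Iic (a := -R) |>.union (isClosed_Ici (a := R)))
  have d1 : HasLog f (γ '' Icc (-R) s) := by
    have hsub : γ '' Icc (-R) s ⊆ W := (image_mono Icc_subset_Iic_self).trans hs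
    exact h.hasLog_Icc hU hRs.le (hf.mono hsub) fun z hz => h0 z (hsub hz)
  have d2 : HasLog f (γ '' Icc t R) := by
    have hsub : γ '' Icc t R ⊆ W := (image_mono Icc_subset_Ici_self).trans ht
    exact h.hasLog_Icc hU hRt.le (hf.mono hsub) fun z hz => h0 z (hsub hz)
  have e1 : IsClosed (γ '' Icc (-R) s) := (isCompact_Icc.image h.cont).isClosed
  have e2 : IsClosed (γ '' Icc t R) := (isCompact_Icc.image h.cont).isClosed
  have l1 := l0.glue d1 c0 e1 (by
    refine Set.Subsingleton.isPreconnected ?_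
    have : ∀ z ∈ (Uᶜ ∪ γ '' (Iic (-R) ∪ Ici R)) ∩ γ '' Icc (-R) s, z = γ (-R) := by
      rintro z ⟨hz | ⟨x, hx, rfl⟩, y, hy, e⟩
      · exact absurd (e ▸ h.mem y) hz
      · rw [h.inj e] at hy
        rcases hx with hx | hx
        · rw [le_antisymm hx hy.1]
        · exact absurd (hy.2.trans_lt (hst.trans hRt)) (not_lt.2 hx)
    intro z hz w hw
    rw [this z hz, this w hw])
  have l2 := l1.glue d2 (c0.union e1) e2 (by
    refine Set.Subsingleton.isPreconnected ?_
    have : ∀ z ∈ ((Uᶜ ∪ γ '' (Iic (-R) ∪ Ici R)) ∪ γ '' Icc (-R) s) ∩ γ '' Icc t R,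
        z = γ R := by
      rintro z ⟨(hz | ⟨x, hx, rfl⟩) | ⟨x, hx, rfl⟩, y, hy, e⟩
      · exact absurd (e ▸ h.mem y) hz
      · rw [h.inj e] at hy
        rcases hx with hx | hx
        · exact absurd (hRs.trans (hst.trans_le hy.1)) (not_lt.2 hx)
        · rw [le_antisymm hy.2 hx]
      · rw [h.inj e] at hy
        exact absurd (hx.2.trans_lt hst) (not_lt.2 hy.1)
    intro z hz w hw
    rw [this z hz, this w hw])
  refine l2.mono ?_
  rintro z (hz | ⟨x, hx | hx, rfl⟩)
  · exact Or.inl (Or.inl (Or.inl hz))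
  · by_cases hxR : x ≤ -R
    · exact Or.inl (Or.inl (Or.inr ⟨x, Or.inl hxR, rfl⟩))
    · exact Or.inl (Or.inr ⟨x, ⟨(not_le.1 hxR).le, hx⟩, rfl⟩)
  · by_cases hxR : R ≤ x
    · exact Or.inl (Or.inl (Or.inr ⟨x, Or.inr hxR, rfl⟩))
    · exact Or.inr ⟨x, ⟨hx, (not_le.1 hxR).le⟩, rfl⟩

lemma isClosed_union_range (h : IsLine U γ) (hU : IsOpen U) : IsClosed (Uᶜ ∪ range γ) := by
  have := h.isClosed_union_image hU isClosed_univ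
  rwa [image_univ] at this

/-- F1: every component of the complement of a line accumulates on the whole line. -/
lemma range_subset_closure (h : IsLine U γ) (hU : IsOpen U) (hUc : IsPreconnected U)
    {v : S} (hv : v ∉ U) {a : S} (ha : a ∈ U \ range γ) :
    range γ ⊆ closure (connectedComponentIn (U \ range γ) a) := by
  rintro _ ⟨t0, rfl⟩
  by_contra hcl
  have hUeq : U \ range γ = (Uᶜ ∪ range γ)ᶜ := by
    rw [compl_union, compl_compl]; rfl
  set V := connectedComponentIn (U \ range γ) a with hV
  have hfr : frontier V ⊆ Uᶜ ∪ range γ := by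
    rw [hV, hUeq]; exact frontier_component_subset (h.isClosed_union_range hU) a
  have haV : a ∈ V := mem_connectedComponentIn ha
  have hn : γ ⁻¹' (closure V)ᶜ ∈ 𝓝 t0 :=
    (isClosed_closure.isOpen_compl.preimage h.cont).mem_nhds hcl
  obtain ⟨δ, hδ, hball⟩ := Metric.mem_nhds_iff.1 hn
  let F := Uᶜ ∪ γ '' (Iic (t0 - δ / 2) ∪ Ici (t0 + δ / 2))
  have hF : IsClosed F := h.isClosed_union_image hU (isClosed_Iic.union isClosed_Ici)
  have hkF : γ t0 ∉ F := by
    rintro (hz | ⟨x, hx, e⟩)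
    · exact hz (h.mem t0)
    · rw [h.inj e] at hx
      rcases hx with hx | hx
      · have : t0 ≤ t0 - δ / 2 := hx; linarith
      · have : t0 + δ / 2 ≤ t0 := hx; linarith
  have haF : a ∉ F := by
    rintro (hz | ⟨x, hx, e⟩)
    · exact hz ha.1
    · exact ha.2 ⟨x, e⟩
  have hav : a ≠ v := by rintro rfl; exact hv ha.1
  have hkv : γ t0 ≠ v := by rintro rfl; exact hv (h.mem t0)
  have hlog : HasLog (hh v a (γ t0)) F := by
    refine h.hasLog_tails hU (by linarith) (W := {a, γ t0}ᶜ) ?_ ?_ ?_ ?_ ?_ ?_ ?_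
    · exact (Set.toFinite _).isClosed.isOpen_compl
    · exact (hh_continuousOn hkv).mono fun z hz e => hz (Or.inr e)
    · rintro z hz (rfl | e)
      · exact hz ha.1
      · rw [mem_singleton_iff.1 e] at hz; exact hz (h.mem t0)
    · intro z hz
      exact hh_ne_zero hav hkv (fun e => hz (Or.inl e)) (fun e => hz (Or.inr e))
    · rintro z hz (rfl | e)
      · exact haF (Or.inr (image_mono subset_union_left hz))
      · exact hkF (Or.inr (image_mono subset_union_left (by rwa [mem_singleton_iff.1 e] at hz)))
    · rintro z hz (rfl | e)
      · exact haF (Or.inr (image_mono subset_union_right hz))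
      · exact hkF (Or.inr (image_mono subset_union_right (by rwa [mem_singleton_iff.1 e] at hz)))
    · exact hasLog_hh_of_connected hU.isClosed_compl hv hUc disjoint_compl_right ha.1 (h.mem t0)
  have hmem := mem_component_of_hasLog hF haF hkF hav hkv hlog
  have hpc : IsPreconnected (connectedComponentIn Fᶜ a) := isPreconnected_connectedComponentIn
  obtain ⟨z, hz1, hz2⟩ := hpc.meets_frontier (V := V) ⟨a, mem_connectedComponentIn haF, haV⟩
    ⟨γ t0, hmem, fun hh => hcl (subset_closure hh)⟩
  have hzF : z ∉ F := connectedComponentIn_subset _ _ hz1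
  rcases hfr hz2 with hz | ⟨x, rfl⟩
  · exact hzF (Or.inl hz)
  · have hx : x ∈ ball t0 δ := by
      rw [Real.ball_eq_Ioo]
      by_contra hc
      apply hzF
      refine Or.inr ⟨x, ?_, rfl⟩
      by_contra hc2
      simp only [mem_union, mem_Iic, mem_Ici, not_or, not_le] at hc2
      exact hc ⟨by linarith, by linarith⟩
    exact hball hx (frontier_subset_closure hz2)

/-- The complement of a line in `U` is nonempty. -/
lemma exists_notMem (h : IsLine U γ) (hU : IsOpen U) (hUc : IsPreconnected U)
    {v : S} (hv : v ∉ U) : (U \ range γ).Nonempty := by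
  by_contra hne
  rw [not_nonempty_iff_eq_empty, sdiff_eq_empty] at hne
  let F := Uᶜ ∪ {γ 0}
  have hF : IsClosed F := hU.isClosed_compl.union isClosed_singleton
  have hmem : ∀ t, t ≠ 0 → γ t ∉ F := by
    rintro t ht (hz | e)
    · exact hz (h.mem t)
    · exact ht (h.inj e)
  have hnv : ∀ t, γ t ≠ v := fun t e => hv (e ▸ h.mem t)
  have hlog : HasLog (hh v (γ (-1)) (γ 1)) F := by
    have l1 : HasLog (hh v (γ (-1)) (γ 1)) Uᶜ :=
      hasLog_hh_of_connected hU.isClosed_compl hv hUc disjoint_compl_right (h.mem _) (h.mem _)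
    have l2 : HasLog (hh v (γ (-1)) (γ 1)) {γ 0} := by
      refine hasLog_near (hh v (γ (-1)) (γ 1) (γ 0)) (continuousOn_singleton _ _) fun z hz => ?_
      rw [mem_singleton_iff.1 hz, sub_self, norm_zero, norm_pos_iff]
      refine hh_ne_zero (hnv _) (hnv _) (fun e => ?_) (fun e => ?_)
      · have := h.inj e; norm_num at this
      · have := h.inj e; norm_num at this
    refine l1.glue l2 hU.isClosed_compl isClosed_singleton ?_
    have : Uᶜ ∩ {γ 0} = ∅ := by
      rw [← disjoint_iff_inter_eq_empty, disjoint_singleton_right]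
      exact fun hz => hz (h.mem 0)
    rw [this]; exact isPreconnected_empty
  have hm := mem_component_of_hasLog hF (hmem (-1) (by norm_num)) (hmem 1 (by norm_num))
    (hnv _) (hnv _) hlog
  have hpc : IsPreconnected (connectedComponentIn Fᶜ (γ (-1))) :=
    isPreconnected_connectedComponentIn
  have hsub : connectedComponentIn Fᶜ (γ (-1)) ⊆ range γ := fun z hz => by
    have := connectedComponentIn_subset _ _ hz
    refine hne ?_
    by_contra hc
    exact this (Or.inl hc)
  have hpi := hpc.image _ ((h.continuousOn_inv hU).mono hsub)
  have hl := Function.leftInverse_invFun h.inj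
  have m1 : (-1:ℝ) ∈ Function.invFun γ '' connectedComponentIn Fᶜ (γ (-1)) :=
    ⟨γ (-1), mem_connectedComponentIn (hmem (-1) (by norm_num)), hl _⟩
  have m2 : (1:ℝ) ∈ Function.invFun γ '' connectedComponentIn Fᶜ (γ (-1)) := ⟨γ 1, hm, hl _⟩
  obtain ⟨z, hz, e⟩ := hpi.Icc_subset m1 m2 (by norm_num : (0:ℝ) ∈ Icc (-1:ℝ) 1)
  obtain ⟨t, rfl⟩ := hsub hz
  rw [hl] at e
  subst e
  exact connectedComponentIn_subset _ _ hz (Or.inr rfl)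

/-- The tails have limit points outside `U`. -/
lemma exists_cluster (h : IsLine U γ) (hU : IsOpen U) {l : Filter ℝ} [l.NeBot]
    (hl : ∀ R : ℝ, ∀ᶠ t in l, R < |t|) :
    ∃ e, e ∉ U ∧ MapClusterPt e l γ := by
  obtain ⟨e, he⟩ := exists_clusterPt_of_compactSpace (map γ l)
  refine ⟨e, fun heU => ?_, he⟩
  obtain ⟨W, hW, heW, -, R, hR⟩ := h.exists_nhd hU heU
  have := (mapClusterPt_iff_frequently.1 he) W (hW.mem_nhds heW)
  obtain ⟨t, ht1, ht2⟩ := (this.and_eventually (hl R)).exists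
  exact absurd (hR t ht1) (not_le.2 ht2)

end IsLine

lemma isPreconnected_frontier_component {M : Set S} (hM : IsClosed M) (hMc : IsPreconnected M)
    (x : S) : IsPreconnected (frontier (connectedComponentIn Mᶜ x)) := by
  have ho : IsOpen (connectedComponentIn Mᶜ x) := hM.isOpen_compl.connectedComponentIn
  rw [ho.frontier_eq, sdiff_eq]
  refine unicoherent isClosed_closure ho.isClosed_compl
    isPreconnected_connectedComponentIn.closure (isPreconnected_compl_component hMc x) ?_
  refine eq_univ_of_forall fun z => ?_
  by_cases hz : z ∈ connectedComponentIn Mᶜ x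
  · exact Or.inl (subset_closure hz)
  · exact Or.inr hz

namespace IsLine

variable {U : Set S} {γ : ℝ → S}

lemma closure_diff_subset (h : IsLine U γ) (hU : IsOpen U) (hUc : IsPreconnected U)
    {v : S} (hv : v ∉ U) {a : S} (ha : a ∈ U \ range γ) {z : S} (hz : z ∈ closure (range γ))
    (hzU : z ∉ U) : z ∈ closure (connectedComponentIn (U \ range γ) a) ∩ frontier U :=
  ⟨closure_minimal (h.range_subset_closure hU hUc hv ha) isClosed_closure hz,
    h.frontier_sub hU ⟨hz, fun ⟨t, e⟩ => hzU (e ▸ h.mem t)⟩⟩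

lemma mem_closure_range_of_cluster {l : Filter ℝ} {e : S} (he : MapClusterPt e l γ) :
    e ∈ closure (range γ) := by
  rw [mem_closure_iff_nhds]
  intro W hW
  obtain ⟨t, ht⟩ := ((mapClusterPt_iff_frequently.1 he) W hW).exists
  exact ⟨γ t, ht, t, rfl⟩

/-- Structure of shadows: every point of the shadow is in the component of one of the ends. -/
lemma shadow_components (h : IsLine U γ) (hU : IsOpen U) (hUc : IsPreconnected U)
    (hUcc : IsPreconnected Uᶜ) {v : S} (hv : v ∉ U) {a : S} (ha : a ∈ U \ range γ)
    {e₁ e₂ : S} (h1 : MapClusterPt e₁ atBot γ) (h2 : MapClusterPt e₂ atTop γ)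
    (he1 : e₁ ∉ U) (he2 : e₂ ∉ U) {T : Set S}
    (hT : T = closure (connectedComponentIn (U \ range γ) a) ∩ frontier U) {z : S} (hz : z ∈ T) :
    z ∈ connectedComponentIn T e₁ ∪ connectedComponentIn T e₂ := by
  by_contra hc
  have hUeq : U \ range γ = (Uᶜ ∪ range γ)ᶜ := by
    rw [compl_union, compl_compl]; rfl
  have hMc := h.isClosed_union_range hU
  have hcl1 : e₁ ∈ closure (range γ) := mem_closure_range_of_cluster h1
  have hcl2 : e₂ ∈ closure (range γ) := mem_closure_range_of_cluster h2
  have heT1 : e₁ ∈ T := hT ▸ h.closure_diff_subset hU hUc hv ha hcl1 he1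
  have heT2 : e₂ ∈ T := hT ▸ h.closure_diff_subset hU hUc hv ha hcl2 he2
  have hTcl : IsClosed T := hT ▸ isClosed_closure.inter isClosed_frontier
  have hTU : ∀ w ∈ T, w ∉ U := fun w hw hwU => by
    rw [hT, hU.frontier_eq] at hw
    exact hw.2.2 hwU
  simp only [mem_union, not_or] at hc
  obtain ⟨P1, Q1, cP1, cQ1, e1, d1, z1, q1⟩ := exists_split hTcl.isCompact heT1 hz hc.1
  obtain ⟨P2, Q2, cP2, cQ2, e2, d2, z2, q2⟩ := exists_split hTcl.isCompact heT2 hz hc.2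
  have hd : Disjoint (P1 ∩ P2) (Q1 ∪ Q2) := by
    rw [disjoint_left]
    rintro w ⟨hw1, hw2⟩ (hw | hw)
    · exact disjoint_left.1 d1 hw1 hw
    · exact disjoint_left.1 d2 hw2 hw
  have hcov : ∀ w ∈ T, w ∈ P1 ∩ P2 ∨ w ∈ Q1 ∪ Q2 := fun w hw => by
    rcases (e1 ▸ hw : w ∈ P1 ∪ Q1) with a1 | a1
    · rcases (e2 ▸ hw : w ∈ P2 ∪ Q2) with a2 | a2
      · exact Or.inl ⟨a1, a2⟩
      · exact Or.inr (Or.inr a2)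
    · exact Or.inr (Or.inl a1)
  obtain ⟨NP, NQ, oP, oQ, sP, sQ, dN⟩ :=
    normal_separation (cP1.inter cP2) (cQ1.union cQ2) hd
  obtain ⟨R, hR⟩ := h.tails (N := NP ∪ NQ ∪ (closure (range γ))ᶜ)
    ((oP.union oQ).union isClosed_closure.isOpen_compl) (fun w hw => by
      by_cases hwc : w ∈ closure (range γ)
      · have hwT : w ∈ T := hT ▸ h.closure_diff_subset hU hUc hv ha hwc hw
        exact Or.inl ((hcov w hwT).imp (fun x => sP x) (fun x => sQ x))
      · exact Or.inr hwc)
  have hR' : ∀ t, R < |t| → γ t ∈ NP ∪ NQ := fun t ht =>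
    (hR t ht).resolve_right fun hh => hh (subset_closure ⟨t, rfl⟩)
  have htail : ∀ t, |R| < |t| → γ t ∈ NQ := by
    have ht2 : γ '' Ioi |R| ⊆ NQ := by
      have hpre : IsPreconnected (γ '' Ioi |R|) :=
        isPreconnected_Ioi.image _ h.cont.continuousOn
      refine hpre.subset_right_of_subset_union oP oQ dN ?_ ?_
      · rintro _ ⟨t, ht, rfl⟩
        exact hR' t ((le_abs_self R).trans_lt (lt_of_lt_of_le ht (le_abs_self t)))
      · obtain ⟨t, ht1, ht2⟩ := (((mapClusterPt_iff_frequently.1 h2) NQ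
          (oQ.mem_nhds (sQ (Or.inr q2)))).and_eventually (eventually_gt_atTop |R|)).exists
        exact ⟨γ t, ⟨t, ht2, rfl⟩, ht1⟩
    have ht1 : γ '' Iio (-|R|) ⊆ NQ := by
      have hpre : IsPreconnected (γ '' Iio (-|R|)) :=
        isPreconnected_Iio.image _ h.cont.continuousOn
      refine hpre.subset_right_of_subset_union oP oQ dN ?_ ?_
      · rintro _ ⟨t, ht, rfl⟩
        have : t < -|R| := ht
        have := neg_le_abs t
        have := le_abs_self R
        exact hR' t (by linarith)
      · obtain ⟨t, ht1, ht2⟩ := (((mapClusterPt_iff_frequently.1 h1) NQ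
          (oQ.mem_nhds (sQ (Or.inl q1)))).and_eventually (eventually_lt_atBot (-|R|))).exists
        exact ⟨γ t, ⟨t, ht2, rfl⟩, ht1⟩
    intro t ht
    rcases lt_abs.1 ht with h3 | h3
    · exact ht2 ⟨t, h3, rfl⟩
    · exact ht1 ⟨t, by rw [mem_Iio]; linarith, rfl⟩
  have hMp : IsPreconnected (Uᶜ ∪ range γ) := by
    have e : Uᶜ ∪ range γ = Uᶜ ∪ closure (range γ) := by
      refine Subset.antisymm (union_subset_union_right _ subset_closure) ?_
      exact union_subset subset_union_left (closure_minimal subset_union_right hMc)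
    rw [e]
    exact hUcc.union e₁ he1 hcl1 (isPreconnected_range h.cont).closure
  have hfp := isPreconnected_frontier_component hMc hMp a
  rw [← hUeq] at hfp
  set V := connectedComponentIn (U \ range γ) a with hV
  have hVo : IsOpen V := by
    rw [hV, hUeq]; exact hMc.isOpen_compl.connectedComponentIn
  have hVU : V ⊆ U := (connectedComponentIn_subset _ _).trans sdiff_subset
  have hfr : frontier V ⊆ Uᶜ ∪ range γ := by
    rw [hV, hUeq]; exact frontier_component_subset hMc a
  have hTV : ∀ w ∈ T, w ∈ frontier V := fun w hw => by
    rw [hVo.frontier_eq]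
    exact ⟨(hT ▸ hw : w ∈ closure V ∩ frontier U).1, fun hh => hTU w hw (hVU hh)⟩
  rw [isPreconnected_closed_iff] at hfp
  obtain ⟨w, hw, hwP, hwQ⟩ := hfp (P1 ∩ P2) ((Q1 ∪ Q2) ∪ closure (range γ)) (cP1.inter cP2)
    ((cQ1.union cQ2).union isClosed_closure) (fun w hw => by
      rcases hfr hw with hw1 | hw1
      · have : w ∈ T := by
          rw [hT]
          refine ⟨frontier_subset_closure hw, ?_⟩
          rw [hU.frontier_eq]
          exact ⟨closure_mono hVU (frontier_subset_closure hw), hw1⟩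
        exact (hcov w this).imp id Or.inl
      · exact Or.inr (Or.inr (subset_closure hw1)))
    ⟨z, hTV z hz, z1, z2⟩ ⟨e₁, hTV _ heT1, Or.inl (Or.inl q1)⟩
  have hwc : w ∈ closure (range γ) :=
    hwQ.resolve_left fun hh => disjoint_left.1 hd hwP hh
  have hwU : w ∉ U := hTU w (e1 ▸ Or.inl hwP.1)
  have hcpt : IsClosed (γ '' Icc (-|R|) |R|) := (isCompact_Icc.image h.cont).isClosed
  obtain ⟨_, ⟨hy1, hy2⟩, t, rfl⟩ := mem_closure_iff.1 hwc (NP ∩ (γ '' Icc (-|R|) |R|)ᶜ)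
    (oP.inter hcpt.isOpen_compl) ⟨sP hwP, fun ⟨t, _, e⟩ => hwU (e ▸ h.mem t)⟩
  refine disjoint_left.1 dN hy1 (htail t ?_)
  by_contra hlt
  exact hy2 ⟨t, abs_le.1 (not_lt.1 hlt), rfl⟩

end IsLine

end LineSphere

section Indec

set_option linter.unusedSectionVars false

variable {S : Type*} [MetricSpace S] [CompactSpace S]

/-- Limit of sets along a filter. -/
def ulim {ι : Type*} (l : Filter ι) (A : ι → Set S) : Set S :=
  {z | ∀ W, IsOpen W → z ∈ W → ∀ᶠ n in l, (A n ∩ W).Nonempty}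

lemma isClosed_ulim {ι : Type*} (l : Filter ι) (A : ι → Set S) : IsClosed (ulim l A) := by
  refine isClosed_of_closure_subset fun z hz W hW hzW => ?_
  obtain ⟨y, hyW, hy⟩ := mem_closure_iff.1 hz W hW hzW
  exact hy W hW hyW

lemma exists_mem_ulim {ι : Type*} (l : Ultrafilter ι) (A : ι → Set S) {D : Set S}
    (hD : IsClosed D) (h : ∀ᶠ n in (l : Filter ι), (A n ∩ D).Nonempty) :
    ∃ z ∈ D, z ∈ ulim l A := by
  obtain ⟨n0, p0, -⟩ := h.exists
  classical
  let x : ι → S := fun n => if hn : (A n ∩ D).Nonempty then hn.some else p0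
  have hx : ∀ᶠ n in (l : Filter ι), x n ∈ A n ∩ D := by
    filter_upwards [h] with n hn
    simp only [x, dif_pos hn]
    exact hn.some_mem
  obtain ⟨z, hz, hle⟩ := hD.isCompact.ultrafilter_le_nhds (l.map x) (by
    rw [le_principal_iff]
    exact hx.mono fun n hn => hn.2)
  refine ⟨z, hz, fun W hW hzW => ?_⟩
  have : ∀ᶠ n in (l : Filter ι), x n ∈ W := hle (hW.mem_nhds hzW)
  filter_upwards [this, hx] with n h1 h2
  exact ⟨x n, h2.1, h1⟩

lemma isPreconnected_ulim {ι : Type*} (l : Ultrafilter ι) (A : ι → Set S)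
    (h : ∀ᶠ n in (l : Filter ι), IsPreconnected (A n)) : IsPreconnected (ulim (l : Filter ι) A) := by
  rw [isPreconnected_closed_iff]
  intro t t' ht ht' hsub ⟨p, hpL, hpt⟩ ⟨q, hqL, hqt⟩
  by_contra hne
  rw [not_nonempty_iff_eq_empty] at hne
  have hL := isClosed_ulim (l : Filter ι) A
  have hd : Disjoint (ulim (l : Filter ι) A ∩ t) (ulim (l : Filter ι) A ∩ t') := by
    rw [disjoint_iff_inter_eq_empty, ← inter_inter_distrib_left]; exact hne
  obtain ⟨NP, NQ, oP, oQ, sP, sQ, dN⟩ := normal_separation (hL.inter ht) (hL.inter ht') hd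
  have hev : ∀ᶠ n in (l : Filter ι), (A n ∩ (NP ∪ NQ)ᶜ).Nonempty := by
    filter_upwards [h, hpL NP oP (sP ⟨hpL, hpt⟩), hqL NQ oQ (sQ ⟨hqL, hqt⟩)] with n h1 h2 h3
    by_contra hemp
    have hs : A n ⊆ NP ∪ NQ := fun z hz => by
      by_contra hc
      exact hemp ⟨z, hz, hc⟩
    obtain ⟨w, -, hw⟩ := h1 NP NQ oP oQ hs h2 h3
    exact disjoint_left.1 dN hw.1 hw.2
  obtain ⟨z, hz, hzL⟩ := exists_mem_ulim l A (oP.union oQ).isClosed_compl hev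
  rcases hsub hzL with h1 | h1
  · exact hz (Or.inl (sP ⟨hzL, h1⟩))
  · exact hz (Or.inr (sQ ⟨hzL, h1⟩))

lemma ulim_subset {ι : Type*} (l : Filter ι) [l.NeBot] (A : ι → Set S) {X : Set S}
    (hX : IsClosed X) (h : ∀ᶠ n in l, A n ⊆ X) : ulim l A ⊆ X := by
  intro z hz
  by_contra hzX
  obtain ⟨n, ⟨y, hy1, hy2⟩, hn⟩ := ((hz Xᶜ hX.isOpen_compl hzX).and h).exists
  exact hy2 (hn hy1)

lemma mem_ulim_of_union {ι κ : Type*} [Finite κ] (l : Ultrafilter ι) (A : κ → ι → Set S) {z : S}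
    (h : ∀ W, IsOpen W → z ∈ W → ∀ᶠ n in (l : Filter ι), ∃ k, (A k n ∩ W).Nonempty) :
    ∃ k, z ∈ ulim (l : Filter ι) (A k) := by
  by_contra hc
  push Not at hc
  have : ∀ k, ∃ W, IsOpen W ∧ z ∈ W ∧ ∀ᶠ n in (l : Filter ι), ¬ (A k n ∩ W).Nonempty := fun k => by
    have := hc k
    simp only [ulim, mem_ofPred_eq, not_forall] at this
    obtain ⟨W, hW, hzW, hn⟩ := this
    exact ⟨W, hW, hzW, Ultrafilter.eventually_not.2 hn⟩
  choose W hW hzW hn using this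
  have h1 := h (⋂ k, W k) (isOpen_iInter_of_finite hW) (mem_iInter.2 hzW)
  have h2 : ∀ᶠ n in (l : Filter ι), ∀ k, ¬ (A k n ∩ W k).Nonempty := eventually_all.2 hn
  obtain ⟨n, ⟨k, y, hy1, hy2⟩, hn'⟩ := (h1.and h2).exists
  exact hn' k ⟨y, hy1, mem_iInter.1 hy2 k⟩

/-- A finite union of proper closed connected subsets is not everything. -/
lemma indec_finite {X : Set S} (hXc : IsPreconnected X) (hXn : X.Nonempty)
    (hind : ¬ IsDecomposable X) : ∀ (n : ℕ) (s : Finset (Set S)), s.card ≤ n →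
    (∀ A ∈ s, IsClosed A ∧ IsPreconnected A ∧ A ⊆ X ∧ A ≠ X) → X ≠ ⋃₀ (s : Set (Set S)) := by
  classical
  intro n
  induction n with
  | zero =>
    intro s hs _ e
    have : s = ∅ := Finset.card_eq_zero.1 (Nat.le_zero.1 hs)
    subst this
    simp at e
    exact hXn.ne_empty e
  | succ n ih =>
    intro s hs hA e
    -- choose a member
    obtain ⟨x, hx⟩ := hXn
    obtain ⟨A, hAs, hxA⟩ := (e ▸ hx : x ∈ ⋃₀ (s : Set (Set S)))
    have hAs : A ∈ s := hAs
    by_cases hm : ∃ B ∈ s.erase A, (A ∩ B).Nonempty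
    · obtain ⟨B, hB, y, hyA, hyB⟩ := hm
      have hBs := Finset.mem_of_mem_erase hB
      obtain ⟨a1, a2, a3, a4⟩ := hA A hAs
      obtain ⟨b1, b2, b3, b4⟩ := hA B hBs
      by_cases hAB : A ∪ B = X
      · exact hind ⟨A, B, ⟨⟨y, hyA⟩, a1, ⟨⟨y, hyA⟩, a2⟩, a3, a4⟩,
          ⟨⟨y, hyB⟩, b1, ⟨⟨y, hyB⟩, b2⟩, b3, b4⟩, hAB⟩
      · refine ih (insert (A ∪ B) ((s.erase A).erase B)) ?_ ?_ ?_
        · have h1 := Finset.card_insert_le (A ∪ B) ((s.erase A).erase B)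
          have h2 := Finset.card_erase_of_mem hB
          have h3 := Finset.card_erase_of_mem hAs
          have h4 : 0 < (s.erase A).card := Finset.card_pos.2 ⟨B, hB⟩
          omega
        · intro C hC
          rcases Finset.mem_insert.1 hC with rfl | hC
          · exact ⟨a1.union b1, a2.union y hyA hyB b2, union_subset a3 b3, hAB⟩
          · exact hA C (Finset.mem_of_mem_erase (Finset.mem_of_mem_erase hC))
        · conv_lhs => rw [e]
          ext z
          simp only [mem_sUnion, Finset.coe_insert, mem_insert_iff, Finset.coe_erase]
          constructor
          · rintro ⟨C, hC, hz⟩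
            by_cases h1 : C = A
            · exact ⟨_, Or.inl rfl, Or.inl (h1 ▸ hz)⟩
            · by_cases h2 : C = B
              · exact ⟨_, Or.inl rfl, Or.inr (h2 ▸ hz)⟩
              · exact ⟨C, Or.inr ⟨⟨hC, h1⟩, h2⟩, hz⟩
          · rintro ⟨C, rfl | hC, hz⟩
            · rcases hz with hz | hz
              · exact ⟨A, hAs, hz⟩
              · exact ⟨B, hBs, hz⟩
            · exact ⟨C, hC.1.1, hz⟩
    · push Not at hm
      have hcl : IsClosed (⋃₀ ((s.erase A : Finset (Set S)) : Set (Set S))) :=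
        by
          rw [sUnion_eq_biUnion]
          exact (Finset.finite_toSet _).isClosed_biUnion fun C hC =>
            (hA C (Finset.mem_of_mem_erase (by exact_mod_cast hC))).1
      have hsub : X ⊆ A ∪ ⋃₀ ((s.erase A : Finset (Set S)) : Set (Set S)) := by
        intro z hz
        rw [e] at hz
        obtain ⟨C, hC, hzC⟩ := hz
        by_cases h1 : C = A
        · exact Or.inl (h1 ▸ hzC)
        · exact Or.inr ⟨C, by simpa using ⟨hC, h1⟩, hzC⟩
      by_cases hne : (X ∩ ⋃₀ ((s.erase A : Finset (Set S)) : Set (Set S))).Nonempty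
      · obtain ⟨w, -, hwA, C, hC, hwC⟩ := isPreconnected_closed_iff.1 hXc A _ (hA A hAs).1 hcl hsub
          ⟨x, hx, hxA⟩ hne
        have := hm C (by exact_mod_cast hC)
        exact this.le ⟨hwA, hwC⟩
      · refine (hA A hAs).2.2.2 (Subset.antisymm (hA A hAs).2.2.1 fun z hz => ?_)
        exact (hsub hz).resolve_right fun h => hne ⟨z, hz, h⟩

/-- Proper subcontinua of an indecomposable continuum are nowhere dense. -/
lemma indec_nowhere {X A : Set S} (hX : IsClosed X) (hXc : IsPreconnected X)
    (hind : ¬ IsDecomposable X) (hA : IsClosed A) (hAc : IsPreconnected A) (hAX : A ⊆ X)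
    (hne : A ≠ X) : X ⊆ closure (X \ A) := by
  by_contra hcon
  have hAne : A.Nonempty := by
    by_contra h
    rw [not_nonempty_iff_eq_empty] at h
    apply hcon
    rw [h, sdiff_empty]; exact subset_closure
  have hBX : closure (X \ A) ⊆ X := closure_minimal sdiff_subset hX
  have hBne : (X \ A).Nonempty := by
    by_contra h
    rw [not_nonempty_iff_eq_empty, sdiff_eq_empty] at h
    exact hne (Subset.antisymm hAX h)
  have hcov : ∀ z ∈ X, z ∈ A ∨ z ∈ closure (X \ A) := fun z hz => by
    by_cases h : z ∈ A
    · exact Or.inl h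
    · exact Or.inr (subset_closure ⟨hz, h⟩)
  by_cases hB : IsPreconnected (closure (X \ A))
  · refine hind ⟨A, closure (X \ A), ⟨hAne, hA, ⟨hAne, hAc⟩, hAX, hne⟩,
      ⟨hBne.closure, isClosed_closure, ⟨hBne.closure, hB⟩, hBX, fun e => hcon e.ge⟩, ?_⟩
    exact Subset.antisymm (union_subset hAX hBX) hcov
  · rw [isPreconnected_closed_iff] at hB
    push Not at hB
    obtain ⟨t, t', ht, ht', hsub, h1, h2, h3⟩ := hB
    have key : ∀ t t' : Set S, IsClosed t → IsClosed t' → closure (X \ A) ⊆ t ∪ t' →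
        (closure (X \ A) ∩ t').Nonempty → closure (X \ A) ∩ (t ∩ t') = ∅ →
        IsProperSubcontinuum X (A ∪ (closure (X \ A) ∩ t)) := by
      intro t t' ht ht' hsub h2 h3
      have hclP : IsClosed (A ∪ (closure (X \ A) ∩ t)) := hA.union (isClosed_closure.inter ht)
      have hclQ : IsClosed (closure (X \ A) ∩ t') := isClosed_closure.inter ht'
      have hpre : IsPreconnected (A ∪ (closure (X \ A) ∩ t)) := by
        rw [isPreconnected_closed_iff]
        have aux : ∀ s s' : Set S, IsClosed s → IsClosed s' →
            A ∪ (closure (X \ A) ∩ t) ⊆ s ∪ s' → (A ∪ (closure (X \ A) ∩ t)) ∩ (s ∩ s') = ∅ →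
            A ⊆ s → ¬ ((A ∪ (closure (X \ A) ∩ t)) ∩ s').Nonempty := by
          intro s s' hs hs' hss hd hAs ⟨w, hw1, hw2⟩
          obtain ⟨a, haA⟩ := hAne
          obtain ⟨y, hyX, hy1, hy2⟩ := isPreconnected_closed_iff.1 hXc
            ((A ∪ (closure (X \ A) ∩ t)) ∩ s')
            ((closure (X \ A) ∩ t') ∪ ((A ∪ (closure (X \ A) ∩ t)) ∩ s))
            (hclP.inter hs') (hclQ.union (hclP.inter hs))
            (fun z hz => by
              by_cases hzP : z ∈ A ∪ (closure (X \ A) ∩ t)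
              · rcases hss hzP with h | h
                · exact Or.inr (Or.inr ⟨hzP, h⟩)
                · exact Or.inl ⟨hzP, h⟩
              · have hz' := (hcov z hz).resolve_left fun h => hzP (Or.inl h)
                exact Or.inr (Or.inl ⟨hz', (hsub hz').resolve_left
                  fun h => hzP (Or.inr ⟨hz', h⟩)⟩))
            ⟨w, (union_subset hAX (inter_subset_left.trans hBX)) hw1, hw1, hw2⟩
            ⟨a, hAX haA, Or.inr ⟨Or.inl haA, hAs haA⟩⟩
          have hyA : y ∉ A := fun h => by
            have : y ∈ (A ∪ (closure (X \ A) ∩ t)) ∩ (s ∩ s') := ⟨Or.inl h, hAs h, hy1.2⟩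
            rw [hd] at this; exact this
          have hyt := hy1.1.resolve_left hyA
          rcases hy2 with h | h
          · have : y ∈ closure (X \ A) ∩ (t ∩ t') := ⟨h.1, hyt.2, h.2⟩
            rw [h3] at this; exact this
          · have : y ∈ (A ∪ (closure (X \ A) ∩ t)) ∩ (s ∩ s') := ⟨hy1.1, h.2, hy1.2⟩
            rw [hd] at this; exact this
        intro s s' hs hs' hss m1 m2
        by_contra hcc
        rw [not_nonempty_iff_eq_empty] at hcc
        have hAss : A ⊆ s ∪ s' := subset_union_left.trans hss
        have hAd : A ∩ (s ∩ s') = ∅ := by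
          rw [← subset_empty_iff, ← hcc]
          exact inter_subset_inter_left _ subset_union_left
        rcases isPreconnected_iff_subset_of_disjoint_closed.1 hAc s s' hs hs' hAss hAd with h | h
        · exact aux s s' hs hs' hss hcc h m2
        · exact aux s' s hs' hs (by rwa [union_comm s' s]) (by rwa [inter_comm s' s]) h m1
      refine ⟨hAne.inl, hclP, ⟨hAne.inl, hpre⟩, union_subset hAX (inter_subset_left.trans hBX),
        fun e => ?_⟩
      obtain ⟨q, hq1, hq2⟩ := h2
      have hsub2 : X \ A ⊆ t := fun z hz => by
        have hzz : z ∈ A ∪ (closure (X \ A) ∩ t) := by rw [e]; exact hz.1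
        exact (hzz.resolve_left hz.2).2
      have : q ∈ closure (X \ A) ∩ (t ∩ t') := ⟨hq1, closure_minimal hsub2 ht hq1, hq2⟩
      rw [h3] at this; exact this
    refine hind ⟨_, _, key t t' ht ht' hsub h2 h3,
      key t' t ht' ht (by rwa [union_comm t' t]) h1 (by rwa [inter_comm t' t]), ?_⟩
    refine Subset.antisymm (union_subset (union_subset hAX (inter_subset_left.trans hBX))
      (union_subset hAX (inter_subset_left.trans hBX))) fun z hz => ?_
    rcases hcov z hz with h | h
    · exact Or.inl (Or.inl h)
    · rcases hsub h with h' | h'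
      · exact Or.inl (Or.inr ⟨h, h'⟩)
      · exact Or.inr (Or.inr ⟨h, h'⟩)

/-- `p` and `q` lie in a common proper subcontinuum. -/
def SameComposant (X : Set S) (p q : S) : Prop :=
  ∃ A, IsClosed A ∧ IsPreconnected A ∧ A ⊆ X ∧ A ≠ X ∧ p ∈ A ∧ q ∈ A

lemma SameComposant.symm {X : Set S} {p q : S} (h : SameComposant X p q) :
    SameComposant X q p := by
  obtain ⟨A, h1, h2, h3, h4, h5, h6⟩ := h
  exact ⟨A, h1, h2, h3, h4, h6, h5⟩

lemma exists_notMem_countable {X : Set S} (hX : IsClosed X) (hXc : IsConnected X)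
    (hind : ¬ IsDecomposable X) {𝒞 : Set (Set S)} (hc : 𝒞.Countable)
    (h : ∀ A ∈ 𝒞, IsClosed A ∧ IsPreconnected A ∧ A ⊆ X ∧ A ≠ X) :
    ∃ x ∈ X, ∀ A ∈ 𝒞, x ∉ A := by
  have : CompactSpace X := isCompact_iff_compactSpace.1 hX.isCompact
  have : Nonempty X := hXc.nonempty.to_subtype
  have hd : Dense (⋂ A ∈ 𝒞, ((↑) ⁻¹' Aᶜ : Set X)) := by
    refine dense_biInter_of_isOpen (fun A hA => ?_) hc fun A hA => ?_
    · exact (h A hA).1.isOpen_compl.preimage continuous_subtype_val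
    · obtain ⟨h1, h2, h3, h4⟩ := h A hA
      have hnw := indec_nowhere hX hXc.isPreconnected hind h1 h2 h3 h4
      intro x
      rw [_root_.mem_closure_iff]
      intro o ho hxo
      obtain ⟨W, hW, rfl⟩ := isOpen_induced_iff.1 ho
      obtain ⟨y, hyW, hy⟩ := mem_closure_iff.1 (hnw x.2) W hW hxo
      exact ⟨⟨y, hy.1⟩, hyW, hy.2⟩
  obtain ⟨x, hx⟩ := hd.nonempty
  refine ⟨x, x.2, fun A hA hxA => ?_⟩
  exact (mem_iInter₂.1 hx A hA) hxA

lemma isClosed_component_of_closed {F : Set S} (hF : IsClosed F) (p : S) :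
    IsClosed (connectedComponentIn F p) := by
  by_cases hp : p ∈ F
  · refine isClosed_of_closure_subset ?_
    exact isPreconnected_connectedComponentIn.closure.subset_connectedComponentIn
      (subset_closure (mem_connectedComponentIn hp))
      (closure_minimal (connectedComponentIn_subset _ _) hF)
  · rw [connectedComponentIn_eq_empty hp]; exact isClosed_empty

/-- Countable family covering a composant. -/
lemma exists_composant_family {X : Set S} (hX : IsClosed X) (p : S) :
    ∃ 𝒞 : Set (Set S), 𝒞.Countable ∧
      (∀ A ∈ 𝒞, IsClosed A ∧ IsPreconnected A ∧ A ⊆ X ∧ A ≠ X) ∧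
      ∀ q, SameComposant X p q → ∃ A ∈ 𝒞, q ∈ A := by
  refine ⟨(fun B => connectedComponentIn (X \ B) p) ''
    {B ∈ TopologicalSpace.countableBasis S | (X ∩ B).Nonempty},
    ((TopologicalSpace.countable_countableBasis S).mono (sep_subset _ _)).image _, ?_, ?_⟩
  · rintro _ ⟨B, ⟨hB, y, hyX, hyB⟩, rfl⟩
    have ho : IsOpen B := TopologicalSpace.isOpen_of_mem_countableBasis hB
    have hs : connectedComponentIn (X \ B) p ⊆ X \ B := connectedComponentIn_subset _ _
    refine ⟨isClosed_component_of_closed (hX.sdiff ho) p, isPreconnected_connectedComponentIn,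
      hs.trans sdiff_subset, fun e => ?_⟩
    have : y ∈ connectedComponentIn (X \ B) p := by
      have e' : connectedComponentIn (X \ B) p = X := e
      rw [e']; exact hyX
    exact (hs this).2 hyB
  · rintro q ⟨A, h1, h2, h3, h4, h5, h6⟩
    obtain ⟨x, hxX, hxA⟩ : ∃ x ∈ X, x ∉ A := by
      by_contra hc
      push Not at hc
      exact h4 (Subset.antisymm h3 hc)
    obtain ⟨B, hB, hxB, hBA⟩ := (TopologicalSpace.isBasis_countableBasis S).mem_nhds_iff.1
      (h1.isOpen_compl.mem_nhds hxA)
    refine ⟨connectedComponentIn (X \ B) p, ⟨B, ⟨hB, x, hxX, hxB⟩, rfl⟩, ?_⟩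
    have hAB : A ⊆ X \ B := fun z hz => ⟨h3 hz, fun hzB => hBA hzB hz⟩
    exact h2.subset_connectedComponentIn h5 hAB h6

lemma exists_three {X : Set S} (hX : IsClosed X) (hXc : IsConnected X)
    (hind : ¬ IsDecomposable X) : ∃ x ∈ X, ∃ y ∈ X, ∃ z ∈ X, ¬ SameComposant X x y ∧
      ¬ SameComposant X x z ∧ ¬ SameComposant X y z := by
  obtain ⟨x, hx⟩ := hXc.nonempty
  obtain ⟨C1, c1, h1, m1⟩ := exists_composant_family hX x
  obtain ⟨y, hy, hy1⟩ := exists_notMem_countable hX hXc hind c1 h1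
  obtain ⟨C2, c2, h2, m2⟩ := exists_composant_family hX y
  obtain ⟨z, hz, hz1⟩ := exists_notMem_countable hX hXc hind (c1.union c2)
    (fun A hA => hA.elim (h1 A) (h2 A))
  refine ⟨x, hx, y, hy, z, hz, fun h => ?_, fun h => ?_, fun h => ?_⟩
  · obtain ⟨A, hA, hyA⟩ := m1 y h; exact hy1 A hA hyA
  · obtain ⟨A, hA, hyA⟩ := m1 z h; exact hz1 A (Or.inl hA) hyA
  · obtain ⟨A, hA, hyA⟩ := m2 z h; exact hz1 A (Or.inr hA) hyA

end Indec

section Forward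

set_option linter.unusedSectionVars false

variable {S : Type*} [MetricSpace S] [CompactSpace S] [SphereLike S] [LocallyConnectedSpace S]
  [PreconnectedSpace S]

lemma frontier_comp_nonempty {X : Set S} (hX : X.Nonempty) {u : S} (hu : u ∉ X) :
    (frontier (connectedComponentIn Xᶜ u)).Nonempty := by
  obtain ⟨x, hx⟩ := hX
  have := (isPreconnected_univ (α := S)).meets_frontier (V := connectedComponentIn Xᶜ u)
    ⟨u, trivial, mem_connectedComponentIn hu⟩
    ⟨x, trivial, fun h => connectedComponentIn_subset _ _ h hx⟩
  rwa [univ_inter] at this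

/-- The set `B` together with all domains meeting `B`. -/
def domHull (X B : Set S) : Set S :=
  B ∪ {u | u ∉ X ∧ (connectedComponentIn Xᶜ u ∩ B).Nonempty}

lemma isPreconnected_domHull {X B : Set S} (hB : IsPreconnected B) :
    IsPreconnected (domHull X B) := by
  rcases B.eq_empty_or_nonempty with rfl | ⟨b, hb⟩
  · simpa [domHull] using isPreconnected_empty
  refine isPreconnected_of_forall b fun u hu => ?_
  rcases hu with hu | ⟨huX, w, hw1, hw2⟩
  · exact ⟨B, subset_union_left, hb, hu, hB⟩
  · refine ⟨B ∪ connectedComponentIn Xᶜ u, union_subset subset_union_left fun t ht => Or.inr ?_,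
      Or.inl hb, Or.inr (mem_connectedComponentIn huX),
      hB.union w hw2 hw1 isPreconnected_connectedComponentIn⟩
    refine ⟨connectedComponentIn_subset _ _ ht, ?_⟩
    rw [← connectedComponentIn_eq ht]
    exact ⟨w, hw1, hw2⟩

lemma star_lemma {X B D : Set S} (hX : IsClosed X) (hXc : IsPreconnected X) (hB : IsOpen B)
    (hD : IsPreconnected D) (hDB : Disjoint D (domHull X B)) {p q : S} (hp : p ∈ X) (hq : q ∈ X)
    (hpD : p ∈ D) (hqD : q ∈ D) : q ∈ connectedComponentIn (X \ B) p := by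
  have hDn : ∀ z ∈ D, z ∉ B := fun z hz h => disjoint_left.1 hDB hz (Or.inl h)
  by_contra hc
  obtain ⟨P, Q, hP, hQ, hPQ, hd, hqP, hpQ⟩ := exists_split (hX.sdiff hB).isCompact
    (⟨hp, hDn p hpD⟩ : p ∈ X \ B) ⟨hq, hDn q hqD⟩ hc
  have hfr : ∀ u ∈ D, u ∉ X → frontier (connectedComponentIn Xᶜ u) ⊆ P ∨
      frontier (connectedComponentIn Xᶜ u) ⊆ Q := by
    intro u hu huX
    refine isPreconnected_iff_subset_of_disjoint_closed.1 (isPreconnected_frontier_component hX hXc u)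
      P Q hP hQ ?_ ?_
    · rw [hPQ]
      intro z hz
      refine ⟨frontier_component_subset hX u hz, fun hzB => ?_⟩
      obtain ⟨w, hw1, hw2⟩ := _root_.mem_closure_iff.1 (frontier_subset_closure hz) B hB hzB
      exact disjoint_left.1 hDB hu (Or.inr ⟨huX, w, hw2, hw1⟩)
    · rw [hd.inter_eq, inter_empty]
  let DD : Set S → Set S := fun P => {z | z ∈ P ∨ (z ∉ X ∧ frontier (connectedComponentIn Xᶜ z) ⊆ P)}
  have hop : ∀ P Q : Set S, IsClosed Q → P ∪ Q = X \ B → Disjoint P Q → (∀ u ∈ D, u ∉ X →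
      frontier (connectedComponentIn Xᶜ u) ⊆ P ∨ frontier (connectedComponentIn Xᶜ u) ⊆ Q) →
      ∀ z ∈ D, z ∈ DD P → z ∈ interior (DD P ∪ Dᶜ) := by
    intro P Q hQ hPQ hd hfr z hzD hz
    rw [mem_interior]
    rcases hz with hz | ⟨hzX, hz⟩
    · have hzQ : z ∉ Q := disjoint_left.1 hd hz
      obtain ⟨W, hWQ, hW, hzW, hWc⟩ := locallyConnectedSpace_iff_subsets_isOpen_isConnected.1
        ‹_› z Qᶜ (hQ.isOpen_compl.mem_nhds hzQ)
      refine ⟨W, fun w hw => ?_, hW, hzW⟩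
      by_cases hwD : w ∈ D
      · left
        by_cases hwX : w ∈ X
        · have : w ∈ P ∪ Q := by rw [hPQ]; exact ⟨hwX, hDn w hwD⟩
          exact Or.inl (this.resolve_right (hWQ hw))
        · refine Or.inr ⟨hwX, ?_⟩
          have hzX : z ∈ X := by
            have : z ∈ X \ B := hPQ ▸ Or.inl hz
            exact this.1
          obtain ⟨y, hyW, hy⟩ := hWc.isPreconnected.meets_frontier
            (V := connectedComponentIn Xᶜ w) ⟨w, hw, mem_connectedComponentIn hwX⟩
            ⟨z, hzW, fun h => connectedComponentIn_subset _ _ h hzX⟩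
          exact (hfr w hwD hwX).resolve_right fun h => hWQ hyW (h hy)
      · exact Or.inr hwD
    · refine ⟨connectedComponentIn Xᶜ z, fun w hw => Or.inl (Or.inr ?_),
        hX.isOpen_compl.connectedComponentIn, mem_connectedComponentIn hzX⟩
      refine ⟨connectedComponentIn_subset _ _ hw, ?_⟩
      rw [← connectedComponentIn_eq hw]; exact hz
  have h1 := hop P Q hQ hPQ hd hfr
  have h2 := hop Q P hP (by rw [union_comm, hPQ]) hd.symm fun u hu huX => (hfr u hu huX).symm
  have hcov : D ⊆ interior (DD P ∪ Dᶜ) ∪ interior (DD Q ∪ Dᶜ) := fun z hz => by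
    by_cases hzX : z ∈ X
    · have : z ∈ P ∪ Q := by rw [hPQ]; exact ⟨hzX, hDn z hz⟩
      rcases this with h | h
      · exact Or.inl (h1 z hz (Or.inl h))
      · exact Or.inr (h2 z hz (Or.inl h))
    · rcases hfr z hz hzX with h | h
      · exact Or.inl (h1 z hz (Or.inr ⟨hzX, h⟩))
      · exact Or.inr (h2 z hz (Or.inr ⟨hzX, h⟩))
  obtain ⟨y, hyD, hy1, hy2⟩ := hD _ _ isOpen_interior isOpen_interior hcov
    ⟨q, hqD, h1 q hqD (Or.inl hqP)⟩ ⟨p, hpD, h2 p hpD (Or.inl hpQ)⟩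
  have hy1 := (interior_subset hy1).resolve_right fun h => h hyD
  have hy2 := (interior_subset hy2).resolve_right fun h => h hyD
  have hsub : ∀ z, z ∈ P ∪ Q → z ∈ X := fun z hz => by rw [hPQ] at hz; exact hz.1
  rcases hy1 with hy1 | ⟨hyX, hy1⟩
  · rcases hy2 with hy2 | ⟨hyX, -⟩
    · exact disjoint_left.1 hd hy1 hy2
    · exact hyX (hsub y (Or.inl hy1))
  · rcases hy2 with hy2 | ⟨-, hy2⟩
    · exact hyX (hsub y (Or.inr hy2))
    · obtain ⟨w, hw⟩ := frontier_comp_nonempty ⟨p, hp⟩ hyX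
      exact disjoint_left.1 hd (hy1 hw) (hy2 hw)

lemma star_composant {X B D : Set S} (hX : IsClosed X) (hXc : IsPreconnected X) (hB : IsOpen B)
    (hBX : (X ∩ B).Nonempty)
    (hD : IsPreconnected D) (hDB : Disjoint D (domHull X B)) {p q : S} (hp : p ∈ X) (hq : q ∈ X)
    (hpD : p ∈ D) (hqD : q ∈ D) : SameComposant X p q := by
  have h := star_lemma hX hXc hB hD hDB hp hq hpD hqD
  have hs : connectedComponentIn (X \ B) p ⊆ X \ B := connectedComponentIn_subset _ _
  obtain ⟨y, hyX, hyB⟩ := hBX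
  refine ⟨connectedComponentIn (X \ B) p, isClosed_component_of_closed (hX.sdiff hB) p,
    isPreconnected_connectedComponentIn, hs.trans sdiff_subset, fun e => ?_,
    mem_connectedComponentIn ⟨hp, fun h => disjoint_left.1 hDB hpD (Or.inl h)⟩, h⟩
  have : y ∈ connectedComponentIn (X \ B) p := by rw [e]; exact hyX
  exact (hs this).2 hyB

lemma exists_domain_two {X B₁ B₂ : Set S} (hX : IsClosed X) (hXc : IsConnected X)
    (hind : ¬ IsDecomposable X) (h1 : IsOpen B₁) (h2 : IsOpen B₂) (c1 : IsPreconnected B₁)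
    (c2 : IsPreconnected B₂) (m1 : (X ∩ B₁).Nonempty) (m2 : (X ∩ B₂).Nonempty)
    (hd : Disjoint B₁ B₂) : ∃ u, u ∉ X ∧ (connectedComponentIn Xᶜ u ∩ B₁).Nonempty ∧
      (connectedComponentIn Xᶜ u ∩ B₂).Nonempty := by
  by_contra hcon
  push Not at hcon
  have hdG : Disjoint (domHull X B₁) (domHull X B₂) := by
    rw [disjoint_left]
    rintro z (hz | ⟨hzX, hz⟩) (hz' | ⟨hzX', hz'⟩)
    · exact disjoint_left.1 hd hz hz'
    · exact (hcon z hzX' ⟨z, mem_connectedComponentIn hzX', hz⟩).le hz'.some_mem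
    · exact (hcon z hzX hz).le ⟨mem_connectedComponentIn hzX, hz'⟩
    · exact (hcon z hzX hz).le hz'.some_mem
  obtain ⟨g, hgX, hg⟩ := m2
  set L := connectedComponentIn (domHull X B₁)ᶜ g with hL
  have hG2L : domHull X B₂ ⊆ L :=
    (isPreconnected_domHull c2).subset_connectedComponentIn (Or.inl hg)
      fun z hz h => disjoint_left.1 hdG h hz
  have k1 : ∀ p q, p ∈ X → q ∈ X → p ∈ L → q ∈ L → SameComposant X p q := fun p q hp hq hpL hqL =>
    star_composant hX hXc.isPreconnected h1 m1 isPreconnected_connectedComponentIn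
      (disjoint_left.2 fun z hz h => (connectedComponentIn_subset (domHull X B₁)ᶜ g hz : z ∈ (domHull X B₁)ᶜ) h) hp hq hpL hqL
  have k2 : ∀ p q, p ∈ X → q ∈ X → p ∉ L → q ∉ L → SameComposant X p q := fun p q hp hq hpL hqL =>
    star_composant hX hXc.isPreconnected h2 ⟨g, hgX, hg⟩
      (isPreconnected_compl_component (isPreconnected_domHull c1) g)
      (disjoint_left.2 fun z hz h => hz (hG2L h)) hp hq hpL hqL
  obtain ⟨x, hx, y, hy, z, hz, n1, n2, n3⟩ := exists_three hX hXc hind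
  by_cases x1 : x ∈ L <;> by_cases y1 : y ∈ L <;> by_cases z1 : z ∈ L
  · exact n1 (k1 _ _ hx hy x1 y1)
  · exact n1 (k1 _ _ hx hy x1 y1)
  · exact n2 (k1 _ _ hx hz x1 z1)
  · exact n3 (k2 _ _ hy hz y1 z1)
  · exact n3 (k1 _ _ hy hz y1 z1)
  · exact n2 (k2 _ _ hx hz x1 z1)
  · exact n1 (k2 _ _ hx hy x1 y1)
  · exact n1 (k2 _ _ hx hy x1 y1)

/-- Domains whose frontiers become dense. -/
lemma exists_dense_domains {X : Set S} (hX : IsClosed X) (hXc : IsConnected X)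
    (hind : ¬ IsDecomposable X) (hns : ¬ X.Subsingleton) :
    ∃ u : ℕ → S, (∀ n, u n ∉ X) ∧ ∀ W, IsOpen W → (X ∩ W).Nonempty →
      ∀ᶠ n in atTop, (frontier (connectedComponentIn Xᶜ (u n)) ∩ W).Nonempty := by
  obtain ⟨x, hx, y, hy, -, -, hxy, -⟩ := exists_three hX hXc hind
  have hne : x ≠ y := by
    rintro rfl
    refine hxy ⟨{x}, isClosed_singleton, isPreconnected_singleton, singleton_subset_iff.2 hx, ?_,
      rfl, rfl⟩
    rintro rfl
    exact hns subsingleton_singleton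
  have hdp : 0 < dist x y := dist_pos.2 hne
  have hex : ∀ n : ℕ, ∃ u, u ∉ X ∧
      (frontier (connectedComponentIn Xᶜ u) ∩ ball x (1/((n:ℝ)+1))).Nonempty ∧
      (frontier (connectedComponentIn Xᶜ u) ∩ ball y (1/((n:ℝ)+1))).Nonempty := by
    intro n
    have hr : 0 < min (1/((n:ℝ)+1)) (dist x y / 2) := lt_min (by positivity) (by positivity)
    set r := min (1/((n:ℝ)+1)) (dist x y / 2) with hrdef
    obtain ⟨B1, s1, o1, hx1, c1⟩ := locallyConnectedSpace_iff_subsets_isOpen_isConnected.1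
        ‹_› x _ (ball_mem_nhds x hr)
    obtain ⟨B2, s2, o2, hy2, c2⟩ := locallyConnectedSpace_iff_subsets_isOpen_isConnected.1
        ‹_› y _ (ball_mem_nhds y hr)
    have hd : Disjoint B1 B2 := by
      refine (ball_disjoint_ball ?_).mono s1 s2
      have := min_le_right (1/((n:ℝ)+1)) (dist x y / 2)
      linarith
    obtain ⟨u, huX, h1, h2⟩ := exists_domain_two hX hXc hind o1 o2 c1.isPreconnected
      c2.isPreconnected ⟨x, hx, hx1⟩ ⟨y, hy, hy2⟩ hd
    refine ⟨u, huX, ?_, ?_⟩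
    · obtain ⟨w, hw1, hw2⟩ := c1.isPreconnected.meets_frontier (by rwa [inter_comm])
        (⟨x, hx1, fun h => (connectedComponentIn_subset Xᶜ u h : x ∈ Xᶜ) hx⟩)
      exact ⟨w, hw2, ball_subset_ball (min_le_left _ _) (s1 hw1)⟩
    · obtain ⟨w, hw1, hw2⟩ := c2.isPreconnected.meets_frontier (by rwa [inter_comm])
        (⟨y, hy2, fun h => (connectedComponentIn_subset Xᶜ u h : y ∈ Xᶜ) hy⟩)
      exact ⟨w, hw2, ball_subset_ball (min_le_left _ _) (s2 hw1)⟩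
  choose u hu hux huy using hex
  refine ⟨u, hu, fun W hW ⟨p, hpX, hpW⟩ => ?_⟩
  by_contra hcon
  have hfr := not_eventually.1 hcon
  have := frequently_iff_neBot.1 hfr
  let l : Ultrafilter ℕ := Ultrafilter.of (atTop ⊓ 𝓟 {n | ¬ (frontier (connectedComponentIn Xᶜ (u n)) ∩ W).Nonempty})
  have hl : (l : Filter ℕ) ≤ _ := Ultrafilter.of_le _
  have hl1 : (l : Filter ℕ) ≤ atTop := hl.trans inf_le_left
  have hl2 : ∀ᶠ n in (l : Filter ℕ), ¬ (frontier (connectedComponentIn Xᶜ (u n)) ∩ W).Nonempty :=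
    le_principal_iff.1 (hl.trans inf_le_right)
  have hmem : ∀ x, (∀ n : ℕ, (frontier (connectedComponentIn Xᶜ (u n)) ∩ ball x (1/((n:ℝ)+1))).Nonempty) →
      x ∈ ulim (l : Filter ℕ) (fun n => frontier (connectedComponentIn Xᶜ (u n))) := by
    intro x hx W hW hxW
    obtain ⟨ε, hε, hb⟩ := Metric.isOpen_iff.1 hW x hxW
    have : ∀ᶠ n : ℕ in atTop, 1/((n:ℝ)+1) < ε :=
      (tendsto_one_div_add_atTop_nhds_zero_nat).eventually_lt_const hε
    filter_upwards [hl1 this] with n hn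
    exact (hx n).mono (inter_subset_inter_right _ ((ball_subset_ball (le_of_lt hn)).trans hb))
  refine hxy ⟨ulim (l : Filter ℕ) (fun n => frontier (connectedComponentIn Xᶜ (u n))),
    isClosed_ulim _ _, isPreconnected_ulim _ _ (Eventually.of_forall fun n =>
      isPreconnected_frontier_component hX hXc.isPreconnected _),
    ulim_subset _ _ hX (Eventually.of_forall fun n => frontier_component_subset hX _), fun e => ?_,
    hmem x hux, hmem y huy⟩
  have : p ∈ ulim (l : Filter ℕ) (fun n => frontier (connectedComponentIn Xᶜ (u n))) := by
    rw [e]; exact hpX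
  obtain ⟨n, hn1, hn2⟩ := ((this W hW hpW).and hl2).exists
  exact hn2 hn1

/-- Every point of the frontier is approximated by shadows. -/
lemma exists_shadow_meets {U : Set S} {γ : ℝ → S} (h : IsLine U γ) (hU : IsOpen U)
    (hUc : IsPreconnected U) {v : S} (hv : v ∉ U) {W : Set S} (hW : IsOpen W)
    (hm : (frontier U ∩ W).Nonempty) : ∃ T, IsShadowOf U (range γ) T ∧ (T ∩ W).Nonempty := by
  obtain ⟨w, hwF, hwW⟩ := hm
  have hwU : w ∉ U := by rw [hU.frontier_eq] at hwF; exact hwF.2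
  have hcl := h.isClosed_union_range hU
  have hUeq : U \ range γ = (Uᶜ ∪ range γ)ᶜ := by
    rw [compl_union, compl_compl]; rfl
  by_cases hwK : w ∈ closure (range γ)
  · obtain ⟨a, ha⟩ := h.exists_notMem hU hUc hv
    exact ⟨_, ⟨a, ha, rfl⟩, w, h.closure_diff_subset hU hUc hv ha hwK hwU, hwW⟩
  · obtain ⟨C, hCs, hC, hwC, hCc⟩ := locallyConnectedSpace_iff_subsets_isOpen_isConnected.1
        ‹_› w (W ∩ (closure (range γ))ᶜ) ((hW.inter isClosed_closure.isOpen_compl).mem_nhds ⟨hwW, hwK⟩)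
    obtain ⟨u, huC, huU⟩ := _root_.mem_closure_iff.1 (frontier_subset_closure hwF) C hC hwC
    have hu : u ∈ U \ range γ := ⟨huU, fun hr => (hCs huC).2 (subset_closure hr)⟩
    obtain ⟨y, hyC, hy⟩ := hCc.isPreconnected.meets_frontier
      (V := connectedComponentIn (U \ range γ) u) ⟨u, huC, mem_connectedComponentIn hu⟩
      ⟨w, hwC, fun h => hwU (connectedComponentIn_subset _ _ h).1⟩
    refine ⟨_, ⟨u, hu, rfl⟩, y, ⟨frontier_subset_closure hy, ?_⟩, (hCs hyC).1⟩
    have hyF : y ∈ Uᶜ ∪ range γ := by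
      rw [hUeq] at hy
      exact frontier_component_subset hcl u hy
    rw [hU.frontier_eq]
    exact ⟨closure_mono ((connectedComponentIn_subset _ _).trans sdiff_subset)
      (frontier_subset_closure hy), hyF.resolve_right fun hr => (hCs hyC).2 (subset_closure hr)⟩

theorem forward_direction {X : Set S} (hX : IsClosed X) (hXc : IsConnected X)
    (hind : ¬ IsDecomposable X) (hns : ¬ X.Subsingleton) :
    ∃ U : ℕ → Set S, (∀ n, IsComplementaryDomain X (U n)) ∧ DoublePassCondition X U := by
  obtain ⟨u, hu, hdense⟩ := exists_dense_domains hX hXc hind hns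
  set U : ℕ → Set S := fun n => connectedComponentIn Xᶜ (u n) with hUdef
  refine ⟨U, fun n => ⟨u n, hu n, rfl⟩, fun K hK => ?_⟩
  have hUo : ∀ n, IsOpen (U n) := fun n => hX.isOpen_compl.connectedComponentIn
  have hUc : ∀ n, IsPreconnected (U n) := fun n => isPreconnected_connectedComponentIn
  have hUcc : ∀ n, IsPreconnected (U n)ᶜ := fun n => isPreconnected_compl_component hXc.isPreconnected _
  have hFX : ∀ n, frontier (U n) ⊆ X := fun n => frontier_component_subset hX _
  obtain ⟨v, hvX⟩ := hXc.nonempty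
  have hv : ∀ n, v ∉ U n := fun n h => connectedComponentIn_subset _ _ h hvX
  have hline : ∀ n, ∃ γ, IsLine (U n) γ ∧ range γ = K n := fun n => (hK n).exists_line (hUo n)
  choose γ hγ hγK using hline
  have hb : ∀ n, ∃ e, e ∉ U n ∧ MapClusterPt e atBot (γ n) := fun n =>
    (hγ n).exists_cluster (hUo n) fun R => (tendsto_abs_atBot_atTop).eventually_gt_atTop R
  have ht : ∀ n, ∃ e, e ∉ U n ∧ MapClusterPt e atTop (γ n) := fun n =>
    (hγ n).exists_cluster (hUo n) fun R => (tendsto_abs_atTop_atTop).eventually_gt_atTop R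
  choose e1 he1 hc1 using hb
  choose e2 he2 hc2 using ht
  have key : ∀ ε > 0, ∀ᶠ n in atTop, ∃ T, IsShadowOf (U n) (K n) T ∧ hausdorffDist T X ≤ ε := by
    intro ε hε
    obtain ⟨t, htX, htf, hcov⟩ := hX.isCompact.finite_cover_balls (half_pos hε)
    have hT : ∀ n T, IsShadowOf (U n) (K n) T → (∀ c ∈ t, (T ∩ ball c (ε/2)).Nonempty) →
        hausdorffDist T X ≤ ε := by
      intro n T ⟨a, ha, hTe⟩ hm
      refine hausdorffDist_le_of_mem_dist hε.le (fun z hz => ⟨z, ?_, by simp [hε.le]⟩) fun z hz => ?_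
      · rw [hTe] at hz; exact hFX n hz.2
      · obtain ⟨c, hc, hzc⟩ := mem_iUnion₂.1 (hcov hz)
        obtain ⟨w, hw, hwc⟩ := hm c hc
        refine ⟨w, hw, ?_⟩
        have := dist_triangle_right z w c
        rw [mem_ball] at hzc hwc
        linarith
    by_contra hcon
    have hfr := not_eventually.1 hcon
    have := frequently_iff_neBot.1 hfr
    let l : Ultrafilter ℕ := Ultrafilter.of (atTop ⊓ 𝓟 {n | ¬ ∃ T, IsShadowOf (U n) (K n) T ∧ hausdorffDist T X ≤ ε})
    have hl : (l : Filter ℕ) ≤ _ := Ultrafilter.of_le _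
    have hl1 : (l : Filter ℕ) ≤ atTop := hl.trans inf_le_left
    have hl2 : ∀ᶠ n in (l : Filter ℕ), ¬ ∃ T, IsShadowOf (U n) (K n) T ∧ hausdorffDist T X ≤ ε :=
      le_principal_iff.1 (hl.trans inf_le_right)
    have : Finite t := htf
    let ej : Bool → ℕ → S := fun b n => if b then e1 n else e2 n
    let A : t × Bool → ℕ → Set S := fun k n =>
      ⋃₀ {C | ∃ T, IsShadowOf (U n) (K n) T ∧ T ∩ ball k.1.1 (ε/2) = ∅ ∧ C = connectedComponentIn T (ej k.2 n)}
    have hejT : ∀ b n T, IsShadowOf (U n) (K n) T → ej b n ∈ T := by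
      intro b n T ⟨a, ha, hTe⟩
      rw [hTe, ← hγK n]
      rw [← hγK n] at ha
      cases b
      · exact (hγ n).closure_diff_subset (hUo n) (hUc n) (hv n) ha
          (IsLine.mem_closure_range_of_cluster (hc2 n)) (he2 n)
      · exact (hγ n).closure_diff_subset (hUo n) (hUc n) (hv n) ha
          (IsLine.mem_closure_range_of_cluster (hc1 n)) (he1 n)
    have hAc : ∀ k n, IsPreconnected (A k n) := by
      intro k n
      refine isPreconnected_sUnion (ej k.2 n) _ ?_ ?_
      · rintro _ ⟨T, hT, -, rfl⟩
        exact mem_connectedComponentIn (hejT _ _ _ hT)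
      · rintro _ ⟨T, hT, -, rfl⟩
        exact isPreconnected_connectedComponentIn
    have hAsub : ∀ k n, A k n ⊆ X \ ball k.1.1 (ε/2) := by
      rintro k n z ⟨_, ⟨T, ⟨a, ha, hTe⟩, hT2, rfl⟩, hz⟩
      have hzT := connectedComponentIn_subset _ _ hz
      refine ⟨?_, fun h => hT2.le ⟨hzT, h⟩⟩
      rw [hTe] at hzT; exact hFX n hzT.2
    have hLsub : ∀ k, ulim (l : Filter ℕ) (A k) ⊆ X \ ball k.1.1 (ε/2) := fun k =>
      ulim_subset _ _ (hX.sdiff isOpen_ball) (Eventually.of_forall (hAsub k))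
    have hcovX : ∀ z ∈ X, ∃ k, z ∈ ulim (l : Filter ℕ) (A k) := by
      intro z hz
      refine mem_ulim_of_union l A fun W hW hzW => ?_
      filter_upwards [hl1 (hdense W hW ⟨z, hz, hzW⟩), hl2] with n hn1 hn2
      obtain ⟨T, hT1, w, hwT, hwW⟩ := exists_shadow_meets (hγ n) (hUo n) (hUc n) (hv n) hW hn1
      rw [hγK n] at hT1
      have hmiss : ∃ c ∈ t, ¬ (T ∩ ball c (ε/2)).Nonempty := by
        by_contra hcc
        push Not at hcc
        exact hn2 ⟨T, hT1, hT n T hT1 hcc⟩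
      obtain ⟨c, hc, hcm⟩ := hmiss
      rw [not_nonempty_iff_eq_empty] at hcm
      obtain ⟨a, ha, hTe⟩ := id hT1
      rw [← hγK n] at ha hTe
      rcases (hγ n).shadow_components (hUo n) (hUc n) (hUcc n) (hv n) ha (hc1 n) (hc2 n) (he1 n) (he2 n)
        hTe hwT with h | h
      · exact ⟨(⟨c, hc⟩, true), w, ⟨_, ⟨T, hT1, hcm, rfl⟩, h⟩, hwW⟩
      · exact ⟨(⟨c, hc⟩, false), w, ⟨_, ⟨T, hT1, hcm, rfl⟩, h⟩, hwW⟩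
    have hfin : (range fun k => ulim (l : Filter ℕ) (A k)).Finite := finite_range _
    refine indec_finite hXc.isPreconnected hXc.nonempty hind _ hfin.toFinset le_rfl ?_ ?_
    · intro C hC
      rw [Finite.mem_toFinset] at hC
      obtain ⟨k, rfl⟩ := hC
      refine ⟨isClosed_ulim _ _, isPreconnected_ulim _ _ (Eventually.of_forall (hAc k)),
        (hLsub k).trans sdiff_subset, fun e => ?_⟩
      have : k.1.1 ∈ ulim (l : Filter ℕ) (A k) := by
        have e' : ulim (l : Filter ℕ) (A k) = X := e
        rw [e']; exact htX k.1.2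
      exact (hLsub k this).2 (mem_ball_self (half_pos hε))
    · rw [Finite.coe_toFinset]
      refine Subset.antisymm (fun z hz => ?_) ?_
      · obtain ⟨k, hk⟩ := hcovX z hz
        exact ⟨_, ⟨k, rfl⟩, hk⟩
      · rintro z ⟨_, ⟨k, rfl⟩, hz⟩
        exact (hLsub k hz).1
  have hch : ∀ n : ℕ, ∃ T, IsShadowOf (U n) (K n) T ∧ ∀ T', IsShadowOf (U n) (K n) T' →
      hausdorffDist T X ≤ hausdorffDist T' X + 1/((n:ℝ)+1) := by
    intro n
    have hne : ((fun T => hausdorffDist T X) '' {T | IsShadowOf (U n) (K n) T}).Nonempty := by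
      obtain ⟨a, ha⟩ := (hγ n).exists_notMem (hUo n) (hUc n) (hv n)
      rw [hγK n] at ha
      exact ⟨_, _, ⟨a, ha, rfl⟩, rfl⟩
    have hbd : BddBelow ((fun T => hausdorffDist T X) '' {T | IsShadowOf (U n) (K n) T}) :=
      ⟨0, by rintro _ ⟨T, -, rfl⟩; exact hausdorffDist_nonneg⟩
    have hpos : (0:ℝ) < 1/((n:ℝ)+1) := by positivity
    obtain ⟨_, ⟨T, hT, rfl⟩, hlt⟩ := exists_lt_of_csInf_lt hne (lt_add_of_pos_right _ hpos)
    refine ⟨T, hT, fun T' hT' => ?_⟩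
    have := csInf_le hbd ⟨T', hT', rfl⟩
    simp only at hlt this
    linarith
  choose Sh hSh hmin using hch
  refine ⟨Sh, hSh, ?_⟩
  rw [HausdorffConvergesTo, Metric.tendsto_atTop']
  intro ε hε
  have h1 : ∀ᶠ n : ℕ in atTop, 1/((n:ℝ)+1) < ε/2 :=
    (tendsto_one_div_add_atTop_nhds_zero_nat).eventually_lt_const (half_pos hε)
  obtain ⟨N, hN⟩ := eventually_atTop.1 (h1.and (key (ε/2/2) (by positivity)))
  refine ⟨N, fun n hn => ?_⟩
  obtain ⟨h1, T, hT, h2⟩ := hN n hn.le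
  have := hmin n T hT
  rw [Real.dist_eq, sub_zero, abs_of_nonneg hausdorffDist_nonneg]
  linarith

end Forward

section Combi

/-- In a locally finite graph, an infinite component contains a ray. -/
lemma exists_ray {α : Type*} (R : α → α → Prop) (hfin : ∀ i, {j | R i j}.Finite)
    (T : Set α) (x : α) (hxT : x ∈ T)
    (hinf : {z | Relation.ReflTransGen (fun i j => R i j ∧ j ∈ T) x z}.Infinite) :
    ∃ w : ℕ → α, w 0 = x ∧ (∀ n, R (w n) (w (n+1))) ∧ (∀ n, w n ∈ T) ∧ Function.Injective w ∧
      ∀ n, Relation.ReflTransGen (fun i j => R i j ∧ j ∈ T) x (w n) := by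
  classical
  let St := {s : Set α × α // s.2 ∈ s.1 ∧
    {z | Relation.ReflTransGen (fun i j => R i j ∧ j ∈ s.1) s.2 z}.Infinite}
  have step : ∀ s : St, ∃ s' : St, s'.1.1 = s.1.1 \ {s.1.2} ∧ R s.1.2 s'.1.2 := by
    rintro ⟨⟨T, x⟩, hx, hinf⟩
    simp only at hx hinf ⊢
    by_contra hcon
    have hfin2 : ∀ y ∈ {y | R x y ∧ y ∈ T \ {x}},
        {z | Relation.ReflTransGen (fun i j => R i j ∧ j ∈ T \ {x}) y z}.Finite := by
      intro y hy
      by_contra h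
      exact hcon ⟨⟨(T \ {x}, y), hy.2, h⟩, rfl, hy.1⟩
    have hf : ({y | R x y ∧ y ∈ T \ {x}}).Finite := (hfin x).subset fun y hy => hy.1
    refine hinf (((hf.biUnion hfin2).insert x).subset ?_)
    intro z hz
    induction hz with
    | refl => exact mem_insert _ _
    | @tail b c _ hbc ih =>
      by_cases hcx : c = x
      · exact Or.inl hcx
      · right
        rcases ih with rfl | ih
        · exact mem_iUnion₂.2 ⟨c, ⟨hbc.1, hbc.2, hcx⟩, Relation.ReflTransGen.refl⟩
        · obtain ⟨y, hy, hyb⟩ := mem_iUnion₂.1 ih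
          exact mem_iUnion₂.2 ⟨y, hy, Relation.ReflTransGen.tail hyb ⟨hbc.1, hbc.2, hcx⟩⟩
  choose nx hnx1 hnx2 using step
  let s : ℕ → St := fun n => nx^[n] ⟨(T, x), hxT, hinf⟩
  have hs : ∀ n, s (n+1) = nx (s n) := fun n => Function.iterate_succ_apply' _ _ _
  have hmono : ∀ n k, (s (n + k)).1.1 ⊆ (s n).1.1 := by
    intro n k
    induction k with
    | zero => exact subset_rfl
    | succ k ih =>
      rw [← add_assoc, hs, hnx1]
      exact sdiff_subset.trans ih
  have hT : ∀ n, (s n).1.1 ⊆ T := fun n => by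
    have h := hmono 0 n
    rw [zero_add] at h
    exact h
  have hmem : ∀ n, (s n).1.2 ∈ T := fun n => hT n (s n).2.1
  refine ⟨fun n => (s n).1.2, rfl, fun n => ?_, hmem, ?_, fun n => ?_⟩
  · simp only [hs]; exact hnx2 _
  · have hlt : ∀ n k, (s n).1.2 ≠ (s (n + 1 + k)).1.2 := by
      intro n k e
      have h1 := hmono (n+1) k (s (n+1+k)).2.1
      rw [← e, hs, hnx1] at h1
      exact h1.2 rfl
    intro n m e
    rcases lt_trichotomy n m with h | h | h
    · obtain ⟨k, rfl⟩ := Nat.exists_eq_add_of_lt h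
      exact absurd e (by rw [show n + k + 1 = n + 1 + k by ring]; exact hlt n k)
    · exact h
    · obtain ⟨k, rfl⟩ := Nat.exists_eq_add_of_lt h
      exact absurd e.symm (by rw [show m + k + 1 = m + 1 + k by ring]; exact hlt m k)
  · induction n with
    | zero => exact Relation.ReflTransGen.refl
    | succ n ih =>
      refine ih.tail ⟨?_, hmem _⟩
      simp only [hs]; exact hnx2 _

/-- Extraction of an induced biinfinite path. -/
lemma exists_induced (R : ℤ → ℤ → Prop) (hsymm : ∀ i j, R i j → R j i)
    (hnext : ∀ i, R i (i+1)) (hfin : ∀ i, {j | R i j}.Finite)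
    (M : ℤ) (hM : ∀ i j, i ≤ -M → M ≤ j → ¬ R i j) :
    ∃ φ : ℤ → ℤ, StrictMono φ ∧ (∀ k, R (φ k) (φ (k+1))) ∧
      ∀ k l, k + 2 ≤ l → ¬ R (φ k) (φ l) := by
  have hmax : ∀ i, ∃ j, R i j ∧ ∀ j', R i j' → j' ≤ j := fun i => by
    obtain ⟨j, hj, hj'⟩ := (hfin i).exists_maximal ⟨i+1, hnext i⟩
    exact ⟨j, hj, fun j' h => by
      by_contra hc
      exact hc (hj' h (by lia))⟩
  have hmin : ∀ i, ∃ j, R i j ∧ ∀ j', R i j' → j ≤ j' := fun i => by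
    obtain ⟨j, hj, hj'⟩ := (hfin i).exists_minimal ⟨i+1, hnext i⟩
    exact ⟨j, hj, fun j' h => by
      by_contra hc
      exact hc (hj' h (by lia))⟩
  choose nx hnx hnx' using hmax
  choose pv hpv hpv' using hmin
  obtain ⟨q, ⟨i0, hi0, hi0q⟩, hq⟩ : ∃ q, (∃ i ≤ 0, R i q) ∧ ∀ q', (∃ i ≤ 0, R i q') → q' ≤ q := by
    have hb : {j | ∃ i, i ≤ 0 ∧ R i j} ⊆ Iio M ∪ ⋃ i ∈ Icc (-M) 0, {j | R i j} := by
      rintro j ⟨i, hi, hij⟩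
      by_cases h : j < M
      · exact Or.inl h
      · right
        refine mem_iUnion₂.2 ⟨i, ⟨?_, hi⟩, hij⟩
        by_contra hc
        exact hM i j (by lia) (by lia) hij
    have hba : BddAbove {j | ∃ i, i ≤ 0 ∧ R i j} := by
      refine BddAbove.mono hb (bddAbove_Iio.union ?_)
      exact ((finite_Icc _ _).biUnion fun i _ => hfin i).bddAbove
    have hne : {j | ∃ i, i ≤ 0 ∧ R i j}.Nonempty := ⟨0+1, 0, le_rfl, hnext 0⟩
    exact ⟨sSup _, Int.csSup_mem hne hba, fun q' h => le_csSup hba h⟩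
  have hq1 : 1 ≤ q := hq 1 ⟨0, le_rfl, hnext 0⟩
  set p := pv q with hp
  have hpi : p ≤ 0 := (hpv' q i0 (hsymm _ _ hi0q)).trans hi0
  let φ : ℤ → ℤ := fun k => if 1 ≤ k then nx^[(k-1).toNat] q else pv^[(-k).toNat] p
  have h1 : φ 1 = q := by simp [φ]
  have h0 : φ 0 = p := by simp [φ]
  have hup : ∀ k, 1 ≤ k → φ (k+1) = nx (φ k) := by
    intro k hk
    simp only [φ]
    rw [if_pos hk, if_pos (by lia), show (k + 1 - 1).toNat = (k-1).toNat + 1 by lia,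
      Function.iterate_succ_apply']
  have hdn : ∀ k, k ≤ 0 → φ (k-1) = pv (φ k) := by
    intro k hk
    simp only [φ]
    rw [if_neg (by lia), if_neg (by lia), show (-(k-1)).toNat = (-k).toNat + 1 by lia,
      Function.iterate_succ_apply']
  have hlt : ∀ k, φ k < φ (k+1) := by
    intro k
    rcases lt_trichotomy k 0 with h | rfl | h
    · have := hdn (k+1) (by lia)
      rw [add_sub_cancel_right] at this
      rw [this]
      have h2 := hpv' (φ (k+1)) _ (hsymm _ _ (by simpa using hnext (φ (k+1) - 1)))
      lia
    · rw [h0, zero_add, h1]; lia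
    · rw [hup k (by lia)]
      have := hnx' (φ k) _ (hnext _)
      lia
  have hsm : StrictMono φ := strictMono_int_of_lt_succ hlt
  refine ⟨φ, hsm, fun k => ?_, fun k l hkl hR => ?_⟩
  · rcases lt_trichotomy k 0 with h | rfl | h
    · have := hdn (k+1) (by lia)
      rw [add_sub_cancel_right] at this
      rw [this]
      exact hsymm _ _ (hpv _)
    · rw [h0, zero_add, h1]; exact hsymm _ _ (hpv _)
    · rw [hup k (by lia)]; exact hnx _
  · by_cases hk : 1 ≤ k
    · have := hnx' _ _ hR
      rw [← hup k hk] at this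
      have := hsm (show k + 1 < l by lia)
      lia
    · by_cases hl : l ≤ 0
      · have := hpv' _ _ (hsymm _ _ hR)
        rw [← hdn l hl] at this
        have := hsm (show k < l - 1 by lia)
        lia
      · by_cases hl1 : l = 1
        · subst hl1
          rw [h1] at hR
          have := hpv' _ _ (hsymm _ _ hR)
          rw [← hp, ← h0] at this
          have := hsm (show k < 0 by lia)
          lia
        · have h2 := hq (φ l) ⟨φ k, ?_, hR⟩
          · rw [← h1] at h2
            have := hsm (show 1 < l by lia)
            lia
          · have := hsm.monotone (show k ≤ 0 by lia)
            rw [h0] at this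
            lia

end Combi

section Polygon

lemma seg_no_cross {E : Type*} [NormedAddCommGroup E] [NormedSpace ℝ E] {a b c d p : E}
    {ra rb rc rd : ℝ} (hp : p ∈ segment ℝ a b)
    (hp' : p ∈ segment ℝ c d) (h1 : dist a b ≤ ra + rb) (h2 : dist c d ≤ rc + rd)
    (h3 : ra + rc < dist a c) (h4 : rb + rd < dist b d) : False := by
  have e1 := dist_add_dist_of_mem_segment hp
  have e2 := dist_add_dist_of_mem_segment hp'
  have t1 := dist_triangle a p c
  have t2 := dist_triangle b p d
  rw [dist_comm p b] at e1
  rw [dist_comm c p] at e2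
  linarith

lemma seg_no_overlap {E : Type*} [NormedAddCommGroup E] [NormedSpace ℝ E] {c0 c1 c2 : E}
    {s0 s1 s2 α β : ℝ} (hα : 0 < α) (hβ : 0 < β)
    (h : α • (c0 - c1) = β • (c2 - c1)) (h01 : dist c0 c1 ≤ s0 + s1) (h12 : dist c1 c2 ≤ s1 + s2)
    (h02 : s0 + s2 < dist c0 c2) (g0 : s1 * (8/9) ≤ dist c0 c1) (g2 : s1 * (8/9) ≤ dist c1 c2)
    (k0 : s1 ≤ 2 * s0) (k2 : s1 ≤ 2 * s2) (hs : 0 < s1) : False := by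
  have e : c2 - c1 = (α/β) • (c0 - c1) := by
    rw [div_eq_inv_mul, mul_smul, h, smul_smul, inv_mul_cancel₀ hβ.ne', one_smul]
  have hl : 0 < α/β := div_pos hα hβ
  generalize α/β = l at e hl
  have e2 : c0 - c2 = (1 - l) • (c0 - c1) := by
    rw [sub_smul, one_smul, ← e]; abel
  rw [dist_eq_norm, e2, norm_smul, Real.norm_eq_abs] at h02
  rw [dist_comm c1 c2, dist_eq_norm, e, norm_smul, Real.norm_eq_abs, abs_of_pos hl] at h12 g2
  rw [dist_eq_norm] at h01 g0
  rcases le_total l 1 with h | h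
  · rw [abs_of_nonneg (by linarith)] at h02
    nlinarith
  · rw [abs_of_nonpos (by linarith)] at h02
    nlinarith

lemma exists_polygon {c : ℤ → ℂ} {s : ℤ → ℝ} (hs : ∀ k, 0 < s k)
    (hadj : ∀ k, dist (c k) (c (k+1)) ≤ s k + s (k+1))
    (hnon : ∀ k l, k + 2 ≤ l → s k + s l < dist (c k) (c l))
    (hsep : ∀ k, s k * (8/9) ≤ dist (c k) (c (k+1)) ∧ s (k+1) * (8/9) ≤ dist (c k) (c (k+1)))
    (hcomp : ∀ k, s k ≤ 2 * s (k+1) ∧ s (k+1) ≤ 2 * s k) :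
    ∃ γ : ℝ → ℂ, Continuous γ ∧ Function.Injective γ ∧
      ∀ t, γ t ∈ closedBall (c ⌊t⌋) (s ⌊t⌋) ∨ γ t ∈ closedBall (c (⌊t⌋+1)) (s (⌊t⌋+1)) := by
  let γ : ℝ → ℂ := fun t => AffineMap.lineMap (c ⌊t⌋) (c (⌊t⌋+1)) (Int.fract t)
  have hcne : ∀ k, c k ≠ c (k+1) := fun k e => by
    have := (hsep k).1
    rw [e, dist_self] at this
    have := hs k
    linarith
  have hseg : ∀ t, γ t ∈ segment ℝ (c ⌊t⌋) (c (⌊t⌋+1)) := fun t => by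
    rw [segment_eq_image_lineMap]
    exact ⟨_, ⟨Int.fract_nonneg t, (Int.fract_lt_one t).le⟩, rfl⟩
  have hIcc : ∀ (k : ℤ) (t : ℝ), t ∈ Icc (k:ℝ) (k+1) →
      γ t = AffineMap.lineMap (c k) (c (k+1)) (t - k) := by
    intro k t ht
    rcases eq_or_lt_of_le ht.2 with h | h
    · have hf : ⌊t⌋ = k + 1 := by rw [h]; exact_mod_cast Int.floor_intCast (k+1)
      have hfr : Int.fract t = 0 := by rw [Int.fract, hf, h]; push_cast; ring
      simp only [γ]
      rw [hfr, hf, h, add_sub_cancel_left, AffineMap.lineMap_apply_zero, AffineMap.lineMap_apply_one]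
    · have hf : ⌊t⌋ = k := Int.floor_eq_iff.2 ⟨ht.1, h⟩
      simp only [γ]
      rw [Int.fract, hf]
  refine ⟨γ, ?_, ?_, ?_⟩
  · rw [continuous_iff_continuousAt]
    intro t
    have hc : ∀ k : ℤ, ContinuousOn γ (Icc (k:ℝ) (k+1)) := fun k => by
      refine ContinuousOn.congr (Continuous.continuousOn ?_) (hIcc k)
      exact AffineMap.lineMap_continuous.comp (continuous_id.sub continuous_const)
    have h1 := hc (⌊t⌋ - 1)
    have h2 := hc ⌊t⌋
    have h3 := h1.union_of_isClosed h2 isClosed_Icc isClosed_Icc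
    refine h3.continuousAt ?_
    have l1 := Int.floor_le t
    have l2 := Int.lt_floor_add_one t
    refine mem_of_superset (Ioo_mem_nhds (a := (⌊t⌋:ℝ) - 1) (b := ⌊t⌋ + 1) (by linarith) l2) ?_
    intro u hu
    rcases le_total u ⌊t⌋ with h | h
    · left; refine ⟨?_, ?_⟩ <;> push_cast <;> linarith [hu.1]
    · right; exact ⟨h, hu.2.le⟩
  · have key : ∀ t u, ⌊t⌋ ≤ ⌊u⌋ → γ t = γ u → t = u := by
      intro t u hle e
      rcases eq_or_lt_of_le hle with h | h
      · simp only [γ] at e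
        rw [← h] at e
        have h2 := AffineMap.lineMap_injective ℝ (hcne ⌊t⌋) e
        have h3 := Int.self_sub_floor t
        have h4 := Int.self_sub_floor u
        rw [← h] at h4
        linarith
      · exfalso
        rcases eq_or_lt_of_le (Int.add_one_le_iff.2 h) with h' | h'
        · have f1 := Int.fract_lt_one t
          have f0 := Int.fract_nonneg u
          have e' : (1 - Int.fract t) • (c ⌊t⌋ - c (⌊t⌋+1)) =
              Int.fract u • (c (⌊t⌋+1+1) - c (⌊t⌋+1)) := by
            simp only [γ] at e
            rw [← h', AffineMap.lineMap_apply, AffineMap.lineMap_apply] at e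
            simp only [vsub_eq_sub, vadd_eq_add] at e
            simp only [Complex.real_smul] at e ⊢
            push_cast
            linear_combination e
          have f0' : 0 < Int.fract u := by
            refine lt_of_le_of_ne f0 fun hz => ?_
            rw [← hz, zero_smul, smul_eq_zero] at e'
            rcases e' with h | h
            · linarith
            · exact hcne _ (sub_eq_zero.1 h)
          exact seg_no_overlap (by linarith) f0' e' (hadj _) (hadj _) (hnon _ _ (by lia))
            (hsep _).2 (hsep _).1 (hcomp _).2 (hcomp _).1 (hs _)
        · have q := hseg t
          rw [e] at q
          exact seg_no_cross q (hseg u) (hadj _) (hadj _) (hnon _ _ (by lia)) (hnon _ _ (by lia))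
    intro t u e
    rcases le_total ⌊t⌋ ⌊u⌋ with h | h
    · exact key t u h e
    · exact (key u t h e.symm).symm
  · intro t
    by_contra hc
    push Not at hc
    rw [mem_closedBall, mem_closedBall, not_le, not_le] at hc
    have := dist_add_dist_of_mem_segment (hseg t)
    rw [dist_comm (c ⌊t⌋)] at this
    have := hadj ⌊t⌋
    linarith [hc.1, hc.2]

end Polygon

section GlobalLog

lemma exists_global_log {α T : Type*} [TopologicalSpace T] {D : α → Set T}
    (hD : ∀ i, IsPreconnected (D i)) {x : α → T} (hx : ∀ i, x i ∈ D i) {h : T → ℂ}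
    (hfin : ∀ F : Finset α, HasLog h (⋃ i ∈ F, D i)) : ∃ L, ∀ i, IsLog h L (D i) := by
  classical
  choose L hL using hfin
  have hsub : ∀ (F : Finset α) i, i ∈ F → D i ⊆ ⋃ i ∈ F, D i := fun F i hi =>
    subset_biUnion_of_mem (u := fun i => D i) (show i ∈ (F : Set α) from hi)
  have diff : ∀ (F F' : Finset α) (Q : Set T), IsPreconnected Q → Q ⊆ (⋃ i ∈ F, D i) →
      Q ⊆ (⋃ i ∈ F', D i) → ∀ y ∈ Q, ∀ z ∈ Q, L F y - L F z = L F' y - L F' z := by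
    intro F F' Q hQ h1 h2 y hy z hz
    obtain ⟨n, hn⟩ := ((hL F).mono h1).unique ((hL F').mono h2) hQ
    rw [hn y hy, hn z hz]; ring
  let r : α → α → Prop := fun i j => (D i ∩ D j).Nonempty
  have claim : ∀ i j, Relation.EqvGen r i j → ∃ F0 : Finset α, i ∈ F0 ∧ j ∈ F0 ∧
      ∀ F, F0 ⊆ F → L F (x i) - L F (x j) = L F0 (x i) - L F0 (x j) := by
    intro i j hij
    induction hij with
    | rel i j hij =>
      obtain ⟨w, hw1, hw2⟩ := hij
      refine ⟨{i, j}, by simp, by simp, fun F hF => ?_⟩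
      refine diff F {i, j} (D i ∪ D j) ((hD i).union w hw1 hw2 (hD j)) ?_ ?_ _ (Or.inl (hx i)) _
        (Or.inr (hx j))
      · exact union_subset (hsub F i (hF (by simp))) (hsub F j (hF (by simp)))
      · exact union_subset (hsub _ i (by simp)) (hsub _ j (by simp))
    | refl i => exact ⟨{i}, by simp, by simp, fun F hF => by simp⟩
    | symm i j _ ih =>
      obtain ⟨F0, h1, h2, h3⟩ := ih
      refine ⟨F0, h2, h1, fun F hF => ?_⟩
      have := h3 F hF
      linear_combination -this
    | trans i j k _ _ ih1 ih2 =>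
      obtain ⟨F1, a1, a2, a3⟩ := ih1
      obtain ⟨F2, b1, b2, b3⟩ := ih2
      refine ⟨F1 ∪ F2, Finset.mem_union_left _ a1, Finset.mem_union_right _ b2, fun F hF => ?_⟩
      have e1 := a3 F (Finset.subset_union_left.trans hF)
      have e2 := b3 F (Finset.subset_union_right.trans hF)
      have e3 := a3 (F1 ∪ F2) Finset.subset_union_left
      have e4 := b3 (F1 ∪ F2) Finset.subset_union_right
      linear_combination e1 + e2 - e3 - e4
  let rep : α → α := fun i => (Quot.mk r i).out
  have hrep : ∀ i, Relation.EqvGen r i (rep i) := fun i =>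
    (Quot.eqvGen_exact (Quot.out_eq (Quot.mk r i))).symm
  have hrep2 : ∀ i j, r i j → rep i = rep j := fun i j hij => by
    simp only [rep]; rw [Quot.sound hij]
  choose F0 hF1 hF2 hF3 using fun i => claim i (rep i) (hrep i)
  let l : α → T → ℂ := fun i z => L (F0 i) z - L (F0 i) (x (rep i)) + L {rep i} (x (rep i))
  have hl : ∀ i, IsLog h (l i) (D i) := by
    intro i
    have h1 := (hL (F0 i)).mono (hsub _ _ (hF1 i))
    refine ⟨(h1.1.sub continuousOn_const).add continuousOn_const, fun z hz => ?_⟩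
    have e1 := (hL (F0 i)).2 _ (hsub _ _ (hF2 i) (hx _))
    have e2 := (hL {rep i}).2 _ (hsub _ _ (Finset.mem_singleton_self _) (hx (rep i)))
    simp only [l]
    rw [Complex.exp_add, Complex.exp_sub, h1.2 z hz, e1, e2, div_mul_cancel₀]
    rw [← e2]; exact Complex.exp_ne_zero _
  have hcons : ∀ i j z, z ∈ D i → z ∈ D j → l i z = l j z := by
    intro i j z hi hj
    have hr := hrep2 i j ⟨z, hi, hj⟩
    have a1 := hF3 i (F0 i ∪ F0 j) Finset.subset_union_left
    have a2 := hF3 j (F0 i ∪ F0 j) Finset.subset_union_right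
    have b1 := diff (F0 i ∪ F0 j) (F0 i) (D i) (hD i) (hsub _ _ (Finset.mem_union_left _ (hF1 i)))
      (hsub _ _ (hF1 i)) z hi _ (hx i)
    have b2 := diff (F0 i ∪ F0 j) (F0 j) (D j) (hD j) (hsub _ _ (Finset.mem_union_right _ (hF1 j)))
      (hsub _ _ (hF1 j)) z hj _ (hx j)
    simp only [l]
    rw [← hr] at a2 ⊢
    linear_combination -a1 - b1 + a2 + b2
  refine ⟨fun z => if hz : ∃ i, z ∈ D i then l hz.choose z else 0, fun i => (hl i).eqOn ?_⟩
  intro z hz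
  have hz' : ∃ i, z ∈ D i := ⟨i, hz⟩
  simp only [dif_pos hz']
  exact hcons _ _ z hz'.choose_spec hz

end GlobalLog

section Dichotomy

/-- `w` is a proper ray starting from `x` which eventually has value `c`. -/
def RayFrom {α : Type*} (R : α → α → Prop) (Out : Set α) (m : α → ℤ) (x : α) (c : ℤ) : Prop :=
  ∃ w : ℕ → α, w 0 = x ∧ (∀ n, R (w n) (w (n+1))) ∧ (∀ a, {n | w n = a}.Finite) ∧
    ∃ N, ∀ n, N ≤ n → w n ∈ Out ∧ m (w n) = c

lemma RayFrom.step {α : Type*} {R : α → α → Prop} {Out : Set α} {m : α → ℤ} {x y : α} {c : ℤ}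
    (h : RayFrom R Out m x c) (hyx : R y x) : RayFrom R Out m y c := by
  obtain ⟨w, h0, h1, h2, N, h3⟩ := h
  refine ⟨fun n => Nat.casesOn n y w, rfl, ?_, ?_, N+1, ?_⟩
  · intro n
    cases n with
    | zero => simpa [h0] using hyx
    | succ n => exact h1 n
  · intro a
    refine (((h2 a).image Nat.succ).union (finite_singleton 0)).subset ?_
    intro n hn
    cases n with
    | zero => right; rfl
    | succ n => left; exact ⟨n, hn, rfl⟩
  · intro n hn
    cases n with
    | zero => omega
    | succ n => exact h3 n (by omega)

lemma graph_dichotomy {α : Type*} (R : α → α → Prop) (hrefl : ∀ i, R i i)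
    (hsymm : ∀ i j, R i j → R j i)
    (hfin : ∀ i, {j | R i j}.Finite) (Out : Set α) (hOut : Outᶜ.Finite) (m : α → ℤ)
    (hm : ∀ i j, i ∈ Out → j ∈ Out → R i j → m i = m j) :
    (∃ (n : α → ℤ) (core : Set α), core.Finite ∧ (∀ i j, R i j → n i = n j) ∧
      ∀ i, i ∉ core → i ∈ Out ∧ n i = m i) ∨
    (∃ κ : ℤ → α, (∀ k, R (κ k) (κ (k+1))) ∧ (∀ k l, k + 2 ≤ l → ¬ R (κ k) (κ l)) ∧
      ∃ p q T : ℤ, p ≠ q ∧ (∀ k, T ≤ k → κ k ∈ Out ∧ m (κ k) = p) ∧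
        ∀ k, k ≤ -T → κ k ∈ Out ∧ m (κ k) = q) := by
  classical
  by_cases hII : ∃ i c c', c ≠ c' ∧ RayFrom R Out m i c ∧ RayFrom R Out m i c'
  · right
    obtain ⟨i, c, c', hcc, ⟨w, w0, w1, w2, N, w3⟩, ⟨u, u0, u1, u2, N', u3⟩⟩ := hII
    let κ : ℤ → α := fun k => if 0 ≤ k then w k.toNat else u (-k).toNat
    have kp : ∀ n : ℕ, κ n = w n := fun n => by simp [κ]
    have kn : ∀ n : ℕ, κ (-n) = u n := fun n => by
      by_cases h : n = 0
      · subst h; simp [κ, w0, u0]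
      · have : ¬ (0:ℤ) ≤ -n := by omega
        simp [κ, this]
        omega
    have hnext : ∀ k, R (κ k) (κ (k+1)) := by
      intro k
      rcases le_or_gt 0 k with h | h
      · obtain ⟨n, rfl⟩ := Int.eq_ofNat_of_zero_le h
        have : ((n:ℤ)+1) = ((n+1:ℕ):ℤ) := by push_cast; ring
        rw [this, kp, kp]; exact w1 n
      · obtain ⟨n, hn⟩ := Int.eq_ofNat_of_zero_le (show 0 ≤ -k-1 by omega)
        have e1 : k = -((n+1:ℕ):ℤ) := by push_cast; omega
        have e2 : k + 1 = -(n:ℤ) := by omega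
        rw [e2, e1, kn, kn]
        exact hsymm _ _ (u1 n)
    have hft : ∀ a, {k | κ k = a}.Finite := by
      intro a
      refine (((w2 a).image (fun n : ℕ => (n:ℤ))).union ((u2 a).image (fun n : ℕ => -(n:ℤ)))).subset ?_
      intro k hk
      rcases le_total 0 k with h | h
      · obtain ⟨n, rfl⟩ := Int.eq_ofNat_of_zero_le h
        left; exact ⟨n, by rw [mem_ofPred_eq, ← kp n]; exact hk, rfl⟩
      · obtain ⟨n, hn⟩ := Int.eq_ofNat_of_zero_le (show 0 ≤ -k by omega)
        have e : k = -(n:ℤ) := by omega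
        right; exact ⟨n, by rw [mem_ofPred_eq, ← kn n, ← e]; exact hk, e.symm⟩
    have tp : ∀ k : ℤ, (N:ℤ) + N' ≤ k → κ k ∈ Out ∧ m (κ k) = c := by
      intro k hk
      obtain ⟨n, rfl⟩ := Int.eq_ofNat_of_zero_le (show 0 ≤ k by omega)
      have := w3 n (by omega)
      rwa [← kp n] at this
    have tn : ∀ k : ℤ, k ≤ -((N:ℤ) + N') → κ k ∈ Out ∧ m (κ k) = c' := by
      intro k hk
      obtain ⟨n, hn⟩ := Int.eq_ofNat_of_zero_le (show 0 ≤ -k by omega)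
      have e : k = -(n:ℤ) := by omega
      have := u3 n (by omega)
      rwa [← kn n, ← e] at this
    obtain ⟨φ, hφ, h1, h2⟩ := exists_induced (fun k l => R (κ k) (κ l)) (fun _ _ => hsymm _ _) hnext
      (fun k => by
        refine ((hfin (κ k)).biUnion (fun a _ => hft a)).subset ?_
        intro l hl
        exact mem_biUnion (show κ l ∈ {j | R (κ k) j} from hl) rfl)
      ((N:ℤ) + N') (by
        intro k l hk hl hR
        have a1 := tn k hk
        have a2 := tp l hl
        have := hm _ _ a1.1 a2.1 hR
        rw [a1.2, a2.2] at this
        exact hcc this.symm)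
    have gr : ∀ n : ℕ, φ 0 + n ≤ φ n ∧ φ (-n) ≤ φ 0 - n := by
      intro n
      induction n with
      | zero => simp
      | succ n ih =>
        have q1 := hφ (show (n:ℤ) < ((n+1:ℕ):ℤ) by push_cast; omega)
        have q2 := hφ (show -((n+1:ℕ):ℤ) < -(n:ℤ) by push_cast; omega)
        push_cast at *
        omega
    refine ⟨κ ∘ φ, h1, h2, c, c', N + N' + |φ 0|, hcc, fun k hk => tp _ ?_, fun k hk => tn _ ?_⟩
    · have := abs_nonneg (φ 0)
      obtain ⟨n, rfl⟩ := Int.eq_ofNat_of_zero_le (show 0 ≤ k by omega)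
      have := (gr n).1
      have := neg_abs_le (φ 0)
      omega
    · have := abs_nonneg (φ 0)
      obtain ⟨n, hn⟩ := Int.eq_ofNat_of_zero_le (show 0 ≤ -k by omega)
      have e : k = -(n:ℤ) := by omega
      have := (gr n).2
      have := le_abs_self (φ 0)
      rw [e]
      omega
  · left
    push Not at hII
    let Full : α → ℤ → Prop := fun i c => ∀ j, Relation.ReflTransGen R i j → j ∈ Out ∧ m j = c
    let P : α → ℤ → Prop := fun i c => RayFrom R Out m i c ∨ Full i c
    have hray : ∀ i c, RayFrom R Out m i c → ∀ c', Full i c' → c = c' := by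
      rintro i c ⟨w, w0, w1, -, N, w3⟩ c' hF
      have hreach : ∀ n, Relation.ReflTransGen R i (w n) := by
        intro n
        induction n with
        | zero => rw [w0]
        | succ n ih => exact ih.tail (w1 n)
      rw [← (w3 N le_rfl).2, ← (hF _ (hreach N)).2]
    have huniq : ∀ i c c', P i c → P i c' → c = c' := by
      rintro i c c' (h | h) (h' | h')
      · by_contra hne; exact hII i c c' hne h h'
      · exact hray _ _ h _ h'
      · exact (hray _ _ h' _ h).symm
      · rw [← (h i .refl).2, ← (h' i .refl).2]
    have hstep : ∀ i j c, R i j → P i c → P j c := by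
      rintro i j c hij (h | h)
      · exact Or.inl (h.step (hsymm _ _ hij))
      · exact Or.inr fun k hk => h k (Relation.ReflTransGen.head hij hk)
    let n : α → ℤ := fun i => if h : ∃ c, P i c then h.choose else 0
    have hn : ∀ i c, P i c → n i = c := fun i c h => by
      have h' : ∃ c, P i c := ⟨c, h⟩
      simp only [n, dif_pos h']
      exact huniq _ _ _ h'.choose_spec h
    let RO : α → α → Prop := fun i j => R i j ∧ j ∈ Out
    let reach : α → Set α := fun i => {z | Relation.ReflTransGen RO i z}
    have hmr : ∀ i, i ∈ Out → ∀ z ∈ reach i, z ∈ Out ∧ m z = m i ∧ i ∈ reach z := by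
      intro i hi z hz
      induction hz with
      | refl => exact ⟨hi, rfl, .refl⟩
      | tail _ hbc ih =>
        refine ⟨hbc.2, ?_, ?_⟩
        · rw [← ih.2.1]; exact (hm _ _ ih.1 hbc.2 hbc.1).symm
        · exact Relation.ReflTransGen.head ⟨hsymm _ _ hbc.1, ih.1⟩ ih.2.2
    let bad : Set α := Outᶜ ∪ ⋃ y ∈ {y | y ∈ (⋃ k ∈ Outᶜ, {j | R k j}) ∧ (reach y).Finite}, reach y
    refine ⟨n, bad, ?_, ?_, ?_⟩
    · refine hOut.union (Set.Finite.biUnion ?_ fun y hy => hy.2)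
      exact (hOut.biUnion fun k _ => hfin k).subset fun y hy => hy.1
    · intro i j hij
      have : P i = P j := funext fun c => propext ⟨hstep i j c hij, hstep j i c (hsymm _ _ hij)⟩
      simp only [n, this]
    · intro i hi
      have hiO : i ∈ Out := by by_contra h; exact hi (Or.inl h)
      refine ⟨hiO, hn _ _ ?_⟩
      by_cases hf : (reach i).Finite
      · right
        have key : ∀ j, Relation.ReflTransGen R i j → j ∈ reach i := by
          intro j hj
          induction hj with
          | refl => exact .refl
          | @tail b c _ hbc ih =>
            by_cases hc : c ∈ Out
            · exact ih.tail ⟨hbc, hc⟩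
            · exfalso
              apply hi
              right
              have hb := hmr i hiO b ih
              refine mem_biUnion (x := b) ⟨mem_biUnion hc (hsymm _ _ hbc), ?_⟩ hb.2.2
              exact hf.subset fun z hz => ih.trans hz
        intro j hj
        have := hmr i hiO j (key j hj)
        exact ⟨this.1, this.2.1⟩
      · left
        obtain ⟨w, w0, w1, w2, w3, w4⟩ := exists_ray R hfin Out i hiO hf
        refine ⟨w, w0, w1, fun a => ?_, 0, fun k _ => ⟨w2 k, (hmr i hiO _ (w4 k)).2.1⟩⟩
        exact Set.Subsingleton.finite fun k hk l hl => w3 (hk.trans hl.symm)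

end Dichotomy

section Discs

lemma finite_of_separated {M : Set ℂ} {R ε : ℝ} (hε : 0 < ε) (hM : M ⊆ closedBall 0 R)
    (hsep : ∀ c ∈ M, ∀ c' ∈ M, c ≠ c' → ε ≤ dist c c') : M.Finite := by
  obtain ⟨t, ht, hcov⟩ := Metric.totallyBounded_iff.1
    ((isCompact_closedBall (0:ℂ) R).totallyBounded.subset hM) (ε/2) (by linarith)
  have : M = ⋃ y ∈ t, (M ∩ ball y (ε/2)) := by
    ext x; constructor
    · intro hx
      obtain ⟨y, hy, hxy⟩ := mem_iUnion₂.1 (hcov hx)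
      exact mem_biUnion hy ⟨hx, hxy⟩
    · intro hx
      obtain ⟨y, hy, hxy⟩ := mem_iUnion₂.1 hx
      exact hxy.1
  rw [this]
  refine ht.biUnion fun y _ => Set.Subsingleton.finite ?_
  intro c hc c' hc'
  by_contra hne
  have h1 := hsep c hc.1 c' hc'.1 hne
  have h2 := dist_triangle_right c c' y
  have h3 : dist c y < ε/2 := hc.2
  have h4 : dist c' y < ε/2 := hc'.2
  linarith

/-- A locally finite family of discs covering the points of `Ω` equidistant from `A` and `B`. -/
structure DiscFamily (A B Ω M : Set ℂ) : Prop where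
  mem : ∀ c ∈ M, c ∈ Ω
  pos : ∀ c ∈ M, 0 < infDist c A
  eq : ∀ c ∈ M, infDist c A = infDist c B
  sep : ∀ c ∈ M, ∀ c' ∈ M, c ≠ c' → infDist c A / 9 ≤ dist c c'
  cover : ∀ z ∈ Ω, infDist z A = infDist z B → ∃ c ∈ M, z ∈ closedBall c (infDist c A / 8)
  sub : ∀ c ∈ M, closedBall c (infDist c A / 8) ⊆ Ω

lemma exists_discFamily {A B Ω : Set ℂ} (hA : IsClosed A) (hAn : A.Nonempty)
    (hΩA : Disjoint Ω A)
    (hΩ : ∀ z ∈ Ω, ∀ r, Disjoint (ball z r) (A ∪ B) → ball z r ⊆ Ω) :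
    ∃ M, DiscFamily A B Ω M := by
  have hpos : ∀ z ∈ Ω, 0 < infDist z A := fun z hz =>
    (hA.notMem_iff_infDist_pos hAn).1 (disjoint_left.1 hΩA hz)
  let Z := {z | z ∈ Ω ∧ infDist z A = infDist z B}
  let F : Set (Set ℂ) := {M | M ⊆ Z ∧ ∀ c ∈ M, ∀ c' ∈ M, c ≠ c' → infDist c A / 9 ≤ dist c c'}
  obtain ⟨M, hM⟩ := zorn_subset F (by
    intro C hC hchain
    refine ⟨⋃₀ C, ⟨sUnion_subset fun s hs => (hC hs).1, ?_⟩, fun s hs => subset_sUnion_of_mem hs⟩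
    rintro c ⟨s, hs, hcs⟩ c' ⟨s', hs', hcs'⟩ hne
    rcases hchain.total hs hs' with h | h
    · exact (hC hs').2 c (h hcs) c' hcs' hne
    · exact (hC hs).2 c hcs c' (h hcs') hne)
  have hMF : M ∈ F := hM.prop
  refine ⟨M, fun c hc => (hMF.1 hc).1, fun c hc => hpos c (hMF.1 hc).1, fun c hc => (hMF.1 hc).2,
    hMF.2, ?_, ?_⟩
  · intro z hz hzZ
    by_contra hcon
    push Not at hcon
    have hzM : z ∉ M := fun h => hcon z h (mem_closedBall_self (by linarith [hpos z hz]))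
    have hins : insert z M ∈ F := by
      refine ⟨insert_subset ⟨hz, hzZ⟩ hMF.1, ?_⟩
      have key : ∀ c ∈ M, infDist c A / 9 ≤ dist c z ∧ infDist z A / 9 ≤ dist c z := by
        intro c hc
        have h1 := hcon c hc
        rw [mem_closedBall, not_le, dist_comm] at h1
        have h2 : infDist z A ≤ infDist c A + dist z c := infDist_le_infDist_add_dist
        rw [dist_comm z c] at h2
        have := hpos c (hMF.1 hc).1
        constructor <;> linarith
      intro c hc c' hc' hne
      rcases hc with rfl | hc <;> rcases hc' with rfl | hc'
      · exact absurd rfl hne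
      · rw [dist_comm]; exact (key c' hc').2
      · exact (key c hc).1
      · exact hMF.2 c hc c' hc' hne
    exact hzM (hM.le_of_ge hins (subset_insert z M) (mem_insert z M))
  · intro c hc
    have hp := hpos c (hMF.1 hc).1
    refine (closedBall_subset_ball (show infDist c A / 8 < infDist c A by linarith)).trans
      (hΩ c (hMF.1 hc).1 _ ?_)
    rw [disjoint_union_right]
    refine ⟨disjoint_ball_infDist, ?_⟩
    rw [(hMF.1 hc).2]
    exact disjoint_ball_infDist

lemma DiscFamily.bounds {A B Ω M : Set ℂ} (h : DiscFamily A B Ω M) {c z : ℂ} (hc : c ∈ M)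
    (hz : z ∈ closedBall c (infDist c A / 8)) :
    infDist c A * (7/8) ≤ infDist z A ∧ infDist z A ≤ infDist c A * (9/8) ∧
    infDist c A * (7/8) ≤ infDist z B ∧ infDist z B ≤ infDist c A * (9/8) := by
  have h1 : infDist z A ≤ infDist c A + dist z c := infDist_le_infDist_add_dist
  have h2 : infDist c A ≤ infDist z A + dist c z := infDist_le_infDist_add_dist
  have h3 : infDist z B ≤ infDist c B + dist z c := infDist_le_infDist_add_dist
  have h4 : infDist c B ≤ infDist z B + dist c z := infDist_le_infDist_add_dist
  rw [mem_closedBall] at hz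
  rw [dist_comm c z] at h2 h4
  rw [← h.eq c hc] at h3 h4
  refine ⟨?_, ?_, ?_, ?_⟩ <;> linarith

lemma DiscFamily.finite_meet {A B Ω M : Set ℂ} (h : DiscFamily A B Ω M) {C : Set ℂ}
    (hC : IsCompact C) (hA : IsClosed A) (hAn : A.Nonempty) (hCA : Disjoint C A) :
    {c ∈ M | (closedBall c (infDist c A / 8) ∩ C).Nonempty}.Finite := by
  rcases C.eq_empty_or_nonempty with rfl | hCn
  · simp
  obtain ⟨z0, hz0, hmin⟩ := hC.exists_isMinOn hCn (continuous_infDist_pt A).continuousOn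
  obtain ⟨z1, hz1, hmax⟩ := hC.exists_isMaxOn hCn (continuous_infDist_pt A).continuousOn
  have hp : 0 < infDist z0 A := (hA.notMem_iff_infDist_pos hAn).1 (disjoint_left.1 hCA hz0)
  obtain ⟨R, hR⟩ := hC.isBounded.subset_closedBall 0
  refine finite_of_separated (R := R + infDist z1 A) (ε := infDist z0 A * (8/81)) (by positivity)
    ?_ ?_
  · rintro c ⟨hc, z, hz, hzC⟩
    have b := h.bounds hc hz
    have e1 : infDist z A ≤ infDist z1 A := hmax hzC
    have e2 := hR hzC
    rw [mem_closedBall] at hz e2 ⊢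
    have := dist_triangle_left c 0 z
    have := h.pos c hc
    linarith
  · rintro c ⟨hc, z, hz, hzC⟩ c' ⟨hc', -⟩ hne
    have b := h.bounds hc hz
    have e1 : infDist z0 A ≤ infDist z A := hmin hzC
    have := h.sep c hc c' hc' hne
    linarith

end Discs

section Config

variable {S : Type*} [MetricSpace S] [SphereLike S]

/-- Two closed connected sets `A`, `B` sharing the point `v`, a complementary domain `U` of
their union, and two disc-like caps `Ba`, `Bb` at points of `A \ B` and `B \ A`. -/
structure Config (A B U Ba Bb : Set S) (v : S) : Prop where
  hA : IsClosed A
  hB : IsClosed B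
  hAc : IsPreconnected A
  hBc : IsPreconnected B
  vA : v ∈ A
  vB : v ∈ B
  hU : IsOpen U
  hUc : IsPreconnected U
  hUA : Disjoint U A
  hUB : Disjoint U B
  hUcc : IsPreconnected Uᶜ
  hmax : ∀ C, IsPreconnected C → Disjoint C (A ∪ B) → (C ∩ U).Nonempty → C ⊆ U
  hfr : frontier U ⊆ A ∪ B
  oa : IsOpen Ba
  ob : IsOpen Bb
  ca : IsPreconnected Ba
  cb : IsPreconnected Bb
  ma : (A ∩ Ba).Nonempty
  mb : (B ∩ Bb).Nonempty
  aB : Disjoint Ba B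
  bA : Disjoint Bb A
  fa : ∀ z, tu v z ∈ Ba → 3 * infDist z (tu v ⁻¹' A) < infDist z (tu v ⁻¹' B)
  fb : ∀ z, tu v z ∈ Bb → 3 * infDist z (tu v ⁻¹' B) < infDist z (tu v ⁻¹' A)

variable {A B U Ba Bb : Set S} {v : S}

namespace Config

lemma vU (h : Config A B U Ba Bb v) : v ∉ U := fun hv => disjoint_left.1 h.hUA hv h.vA

lemma va (h : Config A B U Ba Bb v) : v ∉ Ba := fun hv => disjoint_left.1 h.aB hv h.vB

lemma vb (h : Config A B U Ba Bb v) : v ∉ Bb := fun hv => disjoint_left.1 h.bA hv h.vA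

lemma ne_of_U (h : Config A B U Ba Bb v) {x : S} (hx : x ∈ U) : x ≠ v := fun e => h.vU (e ▸ hx)
lemma ne_of_a (h : Config A B U Ba Bb v) {x : S} (hx : x ∈ Ba) : x ≠ v := fun e => h.va (e ▸ hx)
lemma ne_of_b (h : Config A B U Ba Bb v) {x : S} (hx : x ∈ Bb) : x ≠ v := fun e => h.vb (e ▸ hx)

lemma cA (h : Config A B U Ba Bb v) : IsClosed (tu v ⁻¹' A) := h.hA.preimage (tu_cont v)

lemma nA (h : Config A B U Ba Bb v) : (tu v ⁻¹' A).Nonempty := by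
  obtain ⟨x, hx, hxa⟩ := h.ma
  exact ⟨sg v x, by rw [mem_preimage, tu_sg v x (h.ne_of_a hxa)]; exact hx⟩

lemma nB (h : Config A B U Ba Bb v) : (tu v ⁻¹' B).Nonempty := by
  obtain ⟨x, hx, hxa⟩ := h.mb
  exact ⟨sg v x, by rw [mem_preimage, tu_sg v x (h.ne_of_b hxa)]; exact hx⟩

lemma cB (h : Config A B U Ba Bb v) : IsClosed (tu v ⁻¹' B) := h.hB.preimage (tu_cont v)

lemma exists_discs (h : Config A B U Ba Bb v) :
    ∃ M, DiscFamily (tu v ⁻¹' A) (tu v ⁻¹' B) (tu v ⁻¹' U) M := by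
  refine exists_discFamily h.cA h.nA (h.hUA.preimage _) ?_
  intro z hz r hd
  rcases le_or_gt r 0 with hr | hr
  · rw [ball_eq_empty.2 hr]; exact empty_subset _
  rw [← image_subset_iff]
  refine h.hmax _ ((convex_ball z r).isPreconnected.image _ (tu_cont v).continuousOn) ?_
    ⟨tu v z, mem_image_of_mem _ (mem_ball_self hr), hz⟩
  rw [disjoint_left]
  rintro _ ⟨w, hw, rfl⟩ hw'
  exact disjoint_left.1 hd hw hw'

/-- The image in the sphere of a disc of the family. -/
def disc (A : Set S) (v : S) {M : Set ℂ} (c : M) : Set S :=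
  tu v '' closedBall (c:ℂ) (infDist (c:ℂ) (tu v ⁻¹' A) / 8)

section
variable {M : Set ℂ}

lemma isCompact_disc (c : M) : IsCompact (disc A v c) :=
  (isCompact_closedBall _ _).image (tu_cont v)

lemma isPreconnected_disc (c : M) : IsPreconnected (disc A v c) :=
  (convex_closedBall _ _).isPreconnected.image _ (tu_cont v).continuousOn

lemma disc_subset
    (hM : DiscFamily (tu v ⁻¹' A) (tu v ⁻¹' B) (tu v ⁻¹' U) M) (c : M) : disc A v c ⊆ U := by
  rw [disc, image_subset_iff]; exact hM.sub c c.2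

lemma center_mem
    (hM : DiscFamily (tu v ⁻¹' A) (tu v ⁻¹' B) (tu v ⁻¹' U) M) (c : M) : tu v (c:ℂ) ∈ disc A v c :=
  mem_image_of_mem _ (mem_closedBall_self (by have := hM.pos c c.2; positivity))

lemma disc_a (h : Config A B U Ba Bb v)
    (hM : DiscFamily (tu v ⁻¹' A) (tu v ⁻¹' B) (tu v ⁻¹' U) M) (c : M) : Disjoint (disc A v c) Ba := by
  rw [disjoint_left]
  rintro _ ⟨z, hz, rfl⟩ hza
  have b := hM.bounds c.2 hz
  have := h.fa z hza
  have := hM.pos c c.2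
  linarith

lemma disc_b (h : Config A B U Ba Bb v)
    (hM : DiscFamily (tu v ⁻¹' A) (tu v ⁻¹' B) (tu v ⁻¹' U) M) (c : M) : Disjoint (disc A v c) Bb := by
  rw [disjoint_left]
  rintro _ ⟨z, hz, rfl⟩ hza
  have b := hM.bounds c.2 hz
  have := h.fb z hza
  have := hM.pos c c.2
  linarith

lemma finite_meet (h : Config A B U Ba Bb v)
    (hM : DiscFamily (tu v ⁻¹' A) (tu v ⁻¹' B) (tu v ⁻¹' U) M) {C : Set S} (hC : IsCompact C) (hCU : C ⊆ U) :
    {c : M | (disc A v c ∩ C).Nonempty}.Finite := by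
  have hC' : IsCompact (sg v '' C) := hC.image_of_continuousOn
    ((sg_cont v).mono fun x hx => h.ne_of_U (hCU hx))
  have := hM.finite_meet hC' h.cA h.nA (by
    rw [disjoint_left]
    rintro _ ⟨x, hx, rfl⟩ hxA
    rw [mem_preimage, tu_sg v x (h.ne_of_U (hCU hx))] at hxA
    exact disjoint_left.1 h.hUA (hCU hx) hxA)
  refine Set.Finite.of_finite_image (f := Subtype.val) (this.subset ?_) Subtype.val_injective.injOn
  rintro _ ⟨c, ⟨_, ⟨z, hz, rfl⟩, hx⟩, rfl⟩
  exact ⟨c.2, z, hz, tu v z, hx, sg_tu v z⟩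

lemma finite_adj (h : Config A B U Ba Bb v)
    (hM : DiscFamily (tu v ⁻¹' A) (tu v ⁻¹' B) (tu v ⁻¹' U) M) (c : M) : {c' : M | (disc A v c ∩ disc A v c').Nonempty}.Finite := by
  have := h.finite_meet hM (isCompact_disc c) (disc_subset hM c)
  simpa only [inter_comm] using this

lemma locFin (h : Config A B U Ba Bb v)
    (hM : DiscFamily (tu v ⁻¹' A) (tu v ⁻¹' B) (tu v ⁻¹' U) M) [CompactSpace S] {x : S} (hx : x ∈ U) :
    ∃ W ∈ 𝓝 x, W ⊆ U ∧ {c : M | (disc A v c ∩ W).Nonempty}.Finite := by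
  obtain ⟨W, hW, hWU, hWc⟩ := local_compact_nhds (h.hU.mem_nhds hx)
  exact ⟨W, hW, hWU, h.finite_meet hM hWc hWU⟩

lemma isClosed_union_discs (h : Config A B U Ba Bb v)
    (hM : DiscFamily (tu v ⁻¹' A) (tu v ⁻¹' B) (tu v ⁻¹' U) M) [CompactSpace S] (I : Set M) : IsClosed (Uᶜ ∪ ⋃ i ∈ I, disc A v i) := by
  rw [← isOpen_compl_iff, isOpen_iff_mem_nhds]
  intro x hx
  rw [compl_union, compl_compl] at hx ⊢
  obtain ⟨W, hW, hWU, hfin⟩ := h.locFin hM hx.1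
  have hcl : IsClosed (⋃ i ∈ {c : M | (disc A v c ∩ W).Nonempty} ∩ I, disc A v i) :=
    (hfin.subset inter_subset_left).isClosed_biUnion fun i _ => (isCompact_disc i).isClosed
  have hxn : x ∉ ⋃ i ∈ {c : M | (disc A v c ∩ W).Nonempty} ∩ I, disc A v i := by
    intro hxn
    obtain ⟨i, hi, hxi⟩ := mem_iUnion₂.1 hxn
    exact hx.2 (mem_biUnion hi.2 hxi)
  filter_upwards [hW, hcl.isOpen_compl.mem_nhds hxn] with y hy hy'
  refine ⟨hWU hy, fun hyI => ?_⟩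
  obtain ⟨i, hi, hyi⟩ := mem_iUnion₂.1 hyI
  exact hy' (mem_biUnion ⟨⟨y, hyi, hy⟩, hi⟩ hyi)

lemma isLog_discs (h : Config A B U Ba Bb v)
    (hM : DiscFamily (tu v ⁻¹' A) (tu v ⁻¹' B) (tu v ⁻¹' U) M) [CompactSpace S] {f L : S → ℂ} (hL : ∀ i : M, IsLog f L (disc A v i)) :
    IsLog f L (⋃ i : M, disc A v i) := by
  refine ⟨?_, fun z hz => ?_⟩
  · intro x hx
    obtain ⟨i, hxi⟩ := mem_iUnion.1 hx
    obtain ⟨W, hW, hWU, hfin⟩ := h.locFin hM (disc_subset hM i hxi)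
    have : Finite {c : M | (disc A v c ∩ W).Nonempty} := hfin
    have hc : ContinuousOn L (⋃ j : {c : M | (disc A v c ∩ W).Nonempty}, disc A v j.1) :=
      (locallyFinite_of_finite _).continuousOn_iUnion
        (fun j => (isCompact_disc j.1).isClosed) (fun j => (hL j.1).1)
    have hxW := mem_of_mem_nhds hW
    refine (hc x (mem_iUnion.2 ⟨⟨i, x, hxi, hxW⟩, hxi⟩)).mono_of_mem_nhdsWithin ?_
    rw [mem_nhdsWithin_iff_exists_mem_nhds_inter]
    refine ⟨W, hW, ?_⟩
    rintro y ⟨hyW, hy⟩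
    obtain ⟨j, hyj⟩ := mem_iUnion.1 hy
    exact mem_iUnion.2 ⟨⟨j, y, hyj, hyW⟩, hyj⟩
  · obtain ⟨i, hi⟩ := mem_iUnion.1 hz
    exact (hL i).2 z hi

lemma cluster_mem (h : Config A B U Ba Bb v)
    (hM : DiscFamily (tu v ⁻¹' A) (tu v ⁻¹' B) (tu v ⁻¹' U) M) {x : S} (hx : x ∈ closure (⋃ i : M, disc A v i)) (hxU : x ∉ U) :
    x ∈ A ∩ B := by
  by_cases hxv : x = v
  · rw [hxv]; exact ⟨h.vA, h.vB⟩
  have hsub : (⋃ i : M, disc A v i) ⊆ U := iUnion_subset fun i => disc_subset hM i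
  have hxX : x ∈ A ∪ B := h.hfr ⟨closure_mono hsub hx, by rwa [h.hU.interior_eq]⟩
  have hc := mem_closure_image (sg_contAt hxv) hx
  have hcl : IsClosed {z | infDist z (tu v ⁻¹' A) ≤ 9/7 * infDist z (tu v ⁻¹' B) ∧
      infDist z (tu v ⁻¹' B) ≤ 9/7 * infDist z (tu v ⁻¹' A)} := by
    have e1 := continuous_infDist_pt (tu v ⁻¹' A)
    have e2 := continuous_infDist_pt (tu v ⁻¹' B)
    exact (isClosed_le e1 (continuous_const.mul e2)).inter
      (isClosed_le e2 (continuous_const.mul e1))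
  have hmem := closure_minimal (t := {z | infDist z (tu v ⁻¹' A) ≤ 9/7 * infDist z (tu v ⁻¹' B) ∧
      infDist z (tu v ⁻¹' B) ≤ 9/7 * infDist z (tu v ⁻¹' A)}) (by
    rintro _ ⟨y, hy, rfl⟩
    obtain ⟨i, z, hz, rfl⟩ := mem_iUnion.1 hy
    rw [sg_tu]
    have b := hM.bounds i.2 hz
    have := hM.pos i i.2
    constructor <;> linarith) hcl hc
  have i1 : x ∈ A ↔ infDist (sg v x) (tu v ⁻¹' A) = 0 := by
    rw [← h.cA.mem_iff_infDist_zero h.nA, mem_preimage, tu_sg v x hxv]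
  have i2 : x ∈ B ↔ infDist (sg v x) (tu v ⁻¹' B) = 0 := by
    rw [← h.cB.mem_iff_infDist_zero h.nB, mem_preimage, tu_sg v x hxv]
  have p1 := infDist_nonneg (x := sg v x) (s := tu v ⁻¹' A)
  have p2 := infDist_nonneg (x := sg v x) (s := tu v ⁻¹' B)
  rw [mem_inter_iff]
  rcases hxX with hx' | hx'
  · refine ⟨hx', i2.2 ?_⟩
    have := i1.1 hx'
    linarith [hmem.1, hmem.2]
  · refine ⟨i1.2 ?_, hx'⟩
    have := i2.1 hx'
    linarith [hmem.1, hmem.2]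

lemma not_connected (h : Config A B U Ba Bb v)
    (hM : DiscFamily (tu v ⁻¹' A) (tu v ⁻¹' B) (tu v ⁻¹' U) M) {a b : S} (haU : a ∈ U) (ha : a ∈ Ba) (hb : b ∈ Bb) :
    b ∉ connectedComponentIn (Uᶜ ∪ ⋃ i : M, disc A v i)ᶜ a := by
  intro hbC
  set F := (Uᶜ ∪ ⋃ i : M, disc A v i)ᶜ with hF
  have hFU : F ⊆ U := fun x hx => by
    by_contra hxU; exact hx (Or.inl hxU)
  have hav := h.ne_of_a ha
  have hbv := h.ne_of_b hb
  have haF : a ∈ F := by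
    rintro (h' | h')
    · exact h' haU
    · obtain ⟨i, hi⟩ := mem_iUnion.1 h'
      exact disjoint_left.1 (h.disc_a hM i) hi ha
  have hcont : ContinuousOn (fun x => infDist (sg v x) (tu v ⁻¹' A) - infDist (sg v x) (tu v ⁻¹' B))
      (connectedComponentIn F a) := by
    have hs : ContinuousOn (sg v) (connectedComponentIn F a) := (sg_cont v).mono fun x hx =>
      h.ne_of_U (hFU (connectedComponentIn_subset F a hx))
    exact ((continuous_infDist_pt _).comp_continuousOn hs).sub
      ((continuous_infDist_pt _).comp_continuousOn hs)
  have f1 := h.fa (sg v a) (by rwa [tu_sg v a hav])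
  have f2 := h.fb (sg v b) (by rwa [tu_sg v b hbv])
  have p1 := infDist_nonneg (x := sg v a) (s := tu v ⁻¹' A)
  have p2 := infDist_nonneg (x := sg v b) (s := tu v ⁻¹' B)
  obtain ⟨z, hz, hz0⟩ := isPreconnected_connectedComponentIn.intermediate_value
    (mem_connectedComponentIn haF) hbC hcont
    (show (0:ℝ) ∈ Icc _ _ from ⟨by linarith, by linarith⟩)
  have hzF := connectedComponentIn_subset F a hz
  have hzv := h.ne_of_U (hFU hzF)
  obtain ⟨c, hc, hzc⟩ := hM.cover (sg v z) (by rw [mem_preimage, tu_sg v z hzv]; exact hFU hzF)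
    (by simpa [sub_eq_zero] using hz0)
  exact hzF (Or.inr (mem_iUnion.2 ⟨⟨c, hc⟩, sg v z, hzc, tu_sg v z hzv⟩))

lemma hasLog_finite (h : Config A B U Ba Bb v)
    (hM : DiscFamily (tu v ⁻¹' A) (tu v ⁻¹' B) (tu v ⁻¹' U) M) [CompactSpace S] {a b : S} (ha : a ∈ Ba) (hb : b ∈ Bb) (F : Finset M) :
    HasLog (hh v a b) (⋃ i ∈ F, disc A v i) := by
  have hcl : IsClosed (⋃ i ∈ F, disc A v i) :=
    F.finite_toSet.isClosed_biUnion fun i _ => (isCompact_disc i).isClosed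
  have hsub : ∀ z ∈ (⋃ i ∈ F, disc A v i), z ∈ U ∧ z ∉ Ba ∧ z ∉ Bb := by
    intro z hz
    obtain ⟨i, _, hi⟩ := mem_iUnion₂.1 hz
    exact ⟨disc_subset hM i hi, disjoint_left.1 (h.disc_a hM i) hi,
      disjoint_left.1 (h.disc_b hM i) hi⟩
  obtain ⟨xa, hxa, hxa'⟩ := h.ma
  obtain ⟨xb, hxb, hxb'⟩ := h.mb
  have l1 : HasLog (fun z => sg v z - sg v a) (⋃ i ∈ F, disc A v i) := by
    refine hasLog_sub_of_connected hcl (h.hAc.union xa hxa hxa' h.ca) ?_ (Or.inr ha) (Or.inl h.vA)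
      (h.ne_of_a ha)
    rw [disjoint_right]
    rintro z hz (hz' | hz')
    · exact disjoint_left.1 h.hUA (hsub z hz).1 hz'
    · exact (hsub z hz).2.1 hz'
  have l2 : HasLog (fun z => sg v z - sg v b) (⋃ i ∈ F, disc A v i) := by
    refine hasLog_sub_of_connected hcl (h.hBc.union xb hxb hxb' h.cb) ?_ (Or.inr hb) (Or.inl h.vB)
      (h.ne_of_b hb)
    rw [disjoint_right]
    rintro z hz (hz' | hz')
    · exact disjoint_left.1 h.hUB (hsub z hz).1 hz'
    · exact (hsub z hz).2.2 hz'
  refine (l1.mul l2.inv).congr fun z hz => ?_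
  rw [hh_of_ne _ _ (h.ne_of_U (hsub z hz).1), div_eq_mul_inv]

end

end Config

end Config

section Separation

variable {S : Type*} [MetricSpace S]

lemma eq_of_cluster {T : Type*} {l : Filter T} {γ : T → S} {e : S} {f : S → ℂ} {E : Set S} {κ : ℂ}
    (hf : ContinuousWithinAt f E e) (hl : ∀ᶠ t in l, γ t ∈ E ∧ f (γ t) = κ)
    (he : MapClusterPt e l γ) : f e = κ := by
  have h1 : e ∈ closure {x | x ∈ E ∧ f x = κ} := by
    rw [mem_closure_iff_nhds]
    intro W hW
    obtain ⟨t, ht1, ht2⟩ := ((mapClusterPt_iff_frequently.1 he W hW).and_eventually hl).exists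
    exact ⟨γ t, ht1, ht2⟩
  have h2 := (hf.mono (show {x | x ∈ E ∧ f x = κ} ⊆ E from fun x hx => hx.1)).mem_closure_image h1
  have h3 : f '' {x | x ∈ E ∧ f x = κ} ⊆ {κ} := by
    rintro _ ⟨x, hx, rfl⟩; exact hx.2
  simpa using closure_mono h3 h2

variable [SphereLike S] [LocallyConnectedSpace S] [PreconnectedSpace S] [CompactSpace S]
variable {A B U Ba Bb : Set S} {v : S}

lemma Config.separation (h : Config A B U Ba Bb v) {γ : ℝ → S} (hγ : IsLine U γ)
    (hγa : ∀ t, γ t ∉ Ba) (hγb : ∀ t, γ t ∉ Bb)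
    (hcl : ∀ x ∈ closure (range γ), x ∉ U → x ∈ A ∩ B)
    {a b : S} (ha : a ∈ Ba) (haU : a ∈ U) (hb : b ∈ Bb) (hbU : b ∈ U) {L G : S → ℂ} {N : Set S}
    (hL : IsLog (hh v a b) L (range γ)) (hN : IsOpen N) (hUN : Uᶜ ⊆ N)
    (hG : IsLog (hh v a b) G N) {p q : ℤ} (hpq : p ≠ q) {T : ℝ}
    (hp : ∀ t, T < t → L (γ t) = G (γ t) + p * (2 * Real.pi * Complex.I))
    (hq : ∀ t, t < -T → L (γ t) = G (γ t) + q * (2 * Real.pi * Complex.I))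
    {a' b' : S} (ha' : a' ∈ Ba) (hb' : b' ∈ Bb) {C : Set S} (hC : IsPreconnected C)
    (hCU : C ⊆ U) (hCγ : Disjoint C (range γ)) (ha'C : a' ∈ C) (hb'C : b' ∈ C) : False := by
  have hUcl : IsClosed Uᶜ := h.hU.isClosed_compl
  have hK : IsClosed (Uᶜ ∪ range γ) := hγ.isClosed_union_range h.hU
  have hUne : ∀ {x z : S}, x ∈ U → z ∈ Uᶜ → z ≠ x := fun hx hz e => hz (e ▸ hx)
  obtain ⟨l1, hl1⟩ := hasLog_hh_of_connected (v := v) h.oa.isClosed_compl h.va h.ca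
    disjoint_compl_right ha ha'
  obtain ⟨l3, hl3⟩ := hasLog_hh_of_connected (v := v) h.ob.isClosed_compl h.vb h.cb
    disjoint_compl_right hb' hb
  obtain ⟨l2, hl2⟩ := hasLog_hh_of_connected (v := v) hK (Or.inl h.vU) hC
    (by
      rw [disjoint_union_right]
      exact ⟨(disjoint_compl_right_iff_subset (s := C) (t := U)).2 hCU, hCγ⟩) ha'C hb'C
  obtain ⟨μ, hμ⟩ := hasLog_hh_of_connected (v := v) hUcl h.vU h.hUc
    disjoint_compl_right haU (hCU ha'C)
  obtain ⟨ν, hν⟩ := hasLog_hh_of_connected (v := v) hUcl h.vU h.hUc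
    disjoint_compl_right (hCU hb'C) hbU
  have hprod : ∀ z, z ≠ a' → z ≠ b' → hh v a a' z * hh v a' b' z * hh v b' b z = hh v a b z := by
    intro z h1 h2
    rw [hh_mul (h.ne_of_a ha') h1, hh_mul (h.ne_of_b hb') h2]
  obtain ⟨c1, hc1⟩ := (hG.mono hUN).unique
    (((hμ.mul (hl2.mono subset_union_left)).mul hν).congr fun z hz =>
      hprod z (hUne (hCU ha'C) hz) (hUne (hCU hb'C) hz)) h.hUcc
  have hBU : B ⊆ Uᶜ := fun x hx hxU => disjoint_left.1 h.hUB hxU hx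
  have hAU : A ⊆ Uᶜ := fun x hx hxU => disjoint_left.1 h.hUA hxU hx
  have hBa : B ⊆ Baᶜ := fun x hx hxU => disjoint_left.1 h.aB hxU hx
  have hAb : A ⊆ Bbᶜ := fun x hx hxU => disjoint_left.1 h.bA hxU hx
  obtain ⟨c2, hc2⟩ := (hμ.mono hBU).unique (hl1.mono hBa) h.hBc
  obtain ⟨c3, hc3⟩ := (hν.mono hAU).unique (hl3.mono hAb) h.hAc
  let E := (Uᶜ ∪ range γ) ∩ Baᶜ ∩ Bbᶜ ∩ N
  let H : S → ℂ := fun z => l1 z + l2 z + l3 z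
  have hKE : range γ ⊆ (Uᶜ ∪ range γ) ∩ Baᶜ ∩ Bbᶜ := by
    rintro _ ⟨t, rfl⟩
    exact ⟨⟨Or.inr ⟨t, rfl⟩, hγa t⟩, hγb t⟩
  have hH : IsLog (hh v a b) H (range γ) := by
    refine (((hl1.mono ?_).mul (hl2.mono ?_)).mul (hl3.mono ?_)).congr fun z hz => hprod z ?_ ?_
    · exact fun x hx => (hKE hx).1.2
    · exact fun x hx => (hKE hx).1.1
    · exact fun x hx => (hKE hx).2
    · exact fun e => disjoint_left.1 hCγ ha'C (e ▸ hz)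
    · exact fun e => disjoint_left.1 hCγ hb'C (e ▸ hz)
  obtain ⟨c', hc'⟩ := hL.unique hH (isPreconnected_range hγ.cont)
  have hHG : ContinuousOn (fun z => H z - G z) E := by
    refine ContinuousOn.sub (((hl1.1.mono ?_).add (hl2.1.mono ?_)).add (hl3.1.mono ?_))
      (hG.1.mono ?_)
    · exact fun x hx => hx.1.1.2
    · exact fun x hx => hx.1.1.1
    · exact fun x hx => hx.1.2
    · exact fun x hx => hx.2
  have hval : ∀ e ∈ A ∩ B, H e - G e = -(c1 + c2 + c3) * (2 * Real.pi * Complex.I) := by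
    intro e he
    have e1 := hc1 e (hAU he.1)
    have e2 := hc2 e he.2
    have e3 := hc3 e he.1
    simp only [H]
    linear_combination -e1 - e2 - e3
  obtain ⟨R, hR⟩ := hγ.tails hN hUN
  have final : ∀ (l : Filter ℝ) [l.NeBot] (m : ℤ), (∀ R, ∀ᶠ t in l, R < |t|) →
      (∀ᶠ t in l, L (γ t) = G (γ t) + m * (2 * Real.pi * Complex.I)) →
      -(c1 + c2 + c3) * (2 * Real.pi * Complex.I) = (m - c') * (2 * Real.pi * Complex.I) := by
    intro l _ m hl hm
    obtain ⟨e, heU, he⟩ := hγ.exists_cluster h.hU hl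
    have heK : e ∈ closure (range γ) := IsLine.mem_closure_range_of_cluster he
    have heAB := hcl e heK heU
    have heE : e ∈ E := ⟨⟨⟨Or.inl heU, hBa heAB.2⟩, hAb heAB.1⟩, hUN heU⟩
    rw [← hval e heAB]
    refine eq_of_cluster (f := fun z => H z - G z) (hHG e heE) ?_ he
    filter_upwards [hl R, hm] with t h1 h2
    refine ⟨⟨hKE ⟨t, rfl⟩, hR t h1⟩, ?_⟩
    have := hc' (γ t) ⟨t, rfl⟩
    linear_combination h2 - this
  have f1 := final atTop p (fun R => (tendsto_abs_atTop_atTop).eventually_gt_atTop R)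
    ((eventually_gt_atTop T).mono hp)
  have f2 := final atBot q (fun R => (tendsto_abs_atBot_atTop).eventually_gt_atTop R)
    ((eventually_lt_atBot (-T)).mono hq)
  rw [f1] at f2
  have := mul_right_cancel₀ two_pi_I_ne f2
  apply hpq
  have h4 : (p:ℂ) = q := by linear_combination this
  exact_mod_cast h4

end Separation

section LineExists

variable {S : Type*} [MetricSpace S]
variable [SphereLike S] [LocallyConnectedSpace S] [CompactSpace S]
variable {A B U Ba Bb : Set S} {v : S}

lemma Config.chain_line (h : Config A B U Ba Bb v) {M : Set ℂ}
    (hM : DiscFamily (tu v ⁻¹' A) (tu v ⁻¹' B) (tu v ⁻¹' U) M) {κ : ℤ → M}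
    (hR : ∀ k, (Config.disc A v (κ k) ∩ Config.disc A v (κ (k+1))).Nonempty)
    (hnR : ∀ k l, k + 2 ≤ l → ¬ (Config.disc A v (κ k) ∩ Config.disc A v (κ l)).Nonempty) :
    ∃ γ, IsLine U γ ∧ ∀ t, γ t ∈ Config.disc A v (κ ⌊t⌋) ∨
      γ t ∈ Config.disc A v (κ (⌊t⌋+1)) := by
  have hmeet : ∀ i j : M, (Config.disc A v i ∩ Config.disc A v j).Nonempty →
      (closedBall (i:ℂ) (infDist (i:ℂ) (tu v ⁻¹' A) / 8) ∩
        closedBall (j:ℂ) (infDist (j:ℂ) (tu v ⁻¹' A) / 8)).Nonempty := by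
    rintro i j ⟨_, ⟨z, hz, rfl⟩, ⟨w, hw, e⟩⟩
    rw [tu_injective v e] at hw
    exact ⟨z, hz, hw⟩
  have hpos : ∀ i : M, 0 < infDist (i:ℂ) (tu v ⁻¹' A) / 8 := fun i => by
    have := hM.pos i i.2; positivity
  have hne : ∀ k, κ k ≠ κ (k+1) := fun k e => by
    have h1 := hR (k+1)
    rw [← e] at h1
    exact hnR k (k+1+1) (by omega) h1
  obtain ⟨γ, g1, g2, g3⟩ := exists_polygon (c := fun k => (κ k : ℂ))
    (s := fun k => infDist (κ k : ℂ) (tu v ⁻¹' A) / 8) (fun k => hpos (κ k))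
    (fun k => dist_le_add_of_nonempty_closedBall_inter_closedBall (hmeet _ _ (hR k)))
    (fun k l hkl => by
      rw [← disjoint_closedBall_closedBall_iff (hpos _).le (hpos _).le, disjoint_left]
      intro z hz hz'
      exact hnR k l hkl ⟨tu v z, mem_image_of_mem _ hz, mem_image_of_mem _ hz'⟩)
    (fun k => by
      have hne' : (κ k : ℂ) ≠ κ (k+1) := fun e => hne k (Subtype.ext e)
      have h1 := hM.sep _ (κ k).2 _ (κ (k+1)).2 hne'
      have h2 := hM.sep _ (κ (k+1)).2 _ (κ k).2 hne'.symm
      rw [dist_comm] at h2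
      constructor <;> linarith)
    (fun k => by
      obtain ⟨z, hz, hz'⟩ := hmeet _ _ (hR k)
      have b1 := hM.bounds (κ k).2 hz
      have b2 := hM.bounds (κ (k+1)).2 hz'
      have := hpos (κ k)
      have := hpos (κ (k+1))
      constructor <;> linarith)
  have hmem : ∀ t, tu v (γ t) ∈ Config.disc A v (κ ⌊t⌋) ∨
      tu v (γ t) ∈ Config.disc A v (κ (⌊t⌋+1)) := fun t =>
    (g3 t).imp (fun h => mem_image_of_mem _ h) (fun h => mem_image_of_mem _ h)
  refine ⟨fun t => tu v (γ t), ⟨(tu_cont v).comp g1, (tu_injective v).comp g2, ?_, ?_⟩, hmem⟩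
  · intro t
    rcases hmem t with h1 | h1
    · exact disc_subset hM _ h1
    · exact disc_subset hM _ h1
  · intro C hC hCU
    have hI := h.finite_meet hM hC hCU
    have hJ : {k | (Config.disc A v (κ k) ∩ C).Nonempty}.Finite := by
      have : {k | (Config.disc A v (κ k) ∩ C).Nonempty} ⊆
        ⋃ i ∈ {c : M | (Config.disc A v c ∩ C).Nonempty}, {k | κ k = i} := fun k hk =>
          mem_biUnion (show κ k ∈ {c : M | (Config.disc A v c ∩ C).Nonempty} from hk) rfl
      refine (hI.biUnion fun i _ => ?_).subset this
      rcases eq_empty_or_nonempty {k | κ k = i} with he | ⟨k, hk⟩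
      · rw [he]; exact finite_empty
      · refine (finite_Icc (k-1) (k+1)).subset fun l hl => ?_
        have hkl : κ k = κ l := hk.trans hl.symm
        have hself : (Config.disc A v (κ k) ∩ Config.disc A v (κ k)).Nonempty :=
          ⟨_, center_mem hM (κ k), center_mem hM (κ k)⟩
        constructor
        · by_contra hc
          exact hnR l k (by omega) (by rw [← hkl]; exact hself)
        · by_contra hc
          exact hnR k l (by omega) (by rw [← hkl]; exact hself)
    obtain ⟨Q, hQ⟩ := (hJ.image (fun k => |k|)).bddAbove
    refine ⟨Q + 2, fun t ht => ?_⟩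
    have l1 := Int.floor_le t
    have l2 := Int.lt_floor_add_one t
    have hb : -(Q:ℝ) - 1 ≤ ⌊t⌋ ∧ (⌊t⌋:ℝ) ≤ Q + 1 := by
      rcases hmem t with h1 | h1
      · have := abs_le.1 (hQ ⟨_, (⟨_, h1, ht⟩ : (Config.disc A v (κ ⌊t⌋) ∩ C).Nonempty), rfl⟩)
        constructor
        · have := this.1
          have : ((-Q:ℤ):ℝ) ≤ ⌊t⌋ := by exact_mod_cast this
          push_cast at this; linarith
        · have := this.2
          have : (⌊t⌋:ℝ) ≤ Q := by exact_mod_cast this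
          linarith
      · have := abs_le.1 (hQ ⟨_, (⟨_, h1, ht⟩ : (Config.disc A v (κ (⌊t⌋+1)) ∩ C).Nonempty), rfl⟩)
        constructor
        · have := this.1
          have : ((-Q:ℤ):ℝ) ≤ ((⌊t⌋+1:ℤ):ℝ) := by exact_mod_cast this
          push_cast at this; linarith
        · have := this.2
          have : ((⌊t⌋+1:ℤ):ℝ) ≤ Q := by exact_mod_cast this
          push_cast at this
          linarith
    rw [abs_le]
    constructor <;> linarith [hb.1, hb.2]

lemma Config.no_global_log (h : Config A B U Ba Bb v) {M : Set ℂ}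
    (hM : DiscFamily (tu v ⁻¹' A) (tu v ⁻¹' B) (tu v ⁻¹' U) M) {a b : S}
    (ha : a ∈ Ba) (haU : a ∈ U) (hb : b ∈ Bb) (hbU : b ∈ U) {L G : S → ℂ} {N : Set S}
    (hL : ∀ i : M, IsLog (hh v a b) L (Config.disc A v i)) (hUN : Uᶜ ⊆ N)
    (hG : IsLog (hh v a b) G N) {n : M → ℤ} {core : Set M} (hcore : core.Finite)
    (hn : ∀ i j : M, (Config.disc A v i ∩ Config.disc A v j).Nonempty → n i = n j)
    (hi : ∀ i : M, i ∉ core → Config.disc A v i ⊆ N ∧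
      ∀ z ∈ Config.disc A v i, L z = G z + n i * (2 * Real.pi * Complex.I)) : False := by
  classical
  let ix : S → ℤ := fun z => if hz : ∃ i : M, z ∈ Config.disc A v i then n hz.choose else 0
  have hix : ∀ i : M, ∀ z ∈ Config.disc A v i, ix z = n i := by
    intro i z hz
    have hz' : ∃ i : M, z ∈ Config.disc A v i := ⟨i, hz⟩
    simp only [ix, dif_pos hz']
    exact hn _ _ ⟨z, hz'.choose_spec, hz⟩
  let g : S → ℂ := fun z => if z ∈ U then L z + (-ix z : ℤ) * (2 * Real.pi * Complex.I) else G z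
  have hgi : ∀ i : M, IsLog (hh v a b) g (Config.disc A v i) := by
    intro i
    refine ((hL i).add_int (-n i)).eqOn fun z hz => ?_
    simp only [g, if_pos (disc_subset hM i hz), hix i z hz]
  have hall := h.isLog_discs hM hgi
  have hcl1 := h.isClosed_union_discs hM coreᶜ
  have hcl2 : IsClosed (⋃ i ∈ core, Config.disc A v i) :=
    hcore.isClosed_biUnion fun i _ => (isCompact_disc i).isClosed
  have hg1 : IsLog (hh v a b) g (Uᶜ ∪ ⋃ i ∈ coreᶜ, Config.disc A v i) := by
    have hsub : (Uᶜ ∪ ⋃ i ∈ coreᶜ, Config.disc A v i) ⊆ N :=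
      union_subset hUN (iUnion₂_subset fun i hi' => (hi i hi').1)
    refine (hG.mono hsub).eqOn ?_
    rintro z (hz | hz)
    · simp only [g, if_neg hz]
    · obtain ⟨i, hic, hzi⟩ := mem_iUnion₂.1 hz
      simp only [g, if_pos (disc_subset hM i hzi), hix i z hzi]
      rw [(hi i hic).2 z hzi]
      push_cast; ring
  have hg2 : IsLog (hh v a b) g (⋃ i ∈ core, Config.disc A v i) :=
    hall.mono (iUnion₂_subset fun i _ => subset_iUnion (fun i : M => Config.disc A v i) i)
  have hF := isLog_union hg1 hg2 hcl1 hcl2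
  have heq : (Uᶜ ∪ ⋃ i ∈ coreᶜ, Config.disc A v i) ∪ (⋃ i ∈ core, Config.disc A v i) =
      Uᶜ ∪ ⋃ i : M, Config.disc A v i := by
    ext z
    simp only [mem_union, mem_iUnion, mem_compl_iff, exists_prop]
    constructor
    · rintro ((hz | ⟨i, -, hz⟩) | ⟨i, -, hz⟩)
      · exact Or.inl hz
      · exact Or.inr ⟨i, hz⟩
      · exact Or.inr ⟨i, hz⟩
    · rintro (hz | ⟨i, hz⟩)
      · exact Or.inl (Or.inl hz)
      · by_cases hc : i ∈ core
        · exact Or.inr ⟨i, hc, hz⟩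
        · exact Or.inl (Or.inr ⟨i, hc, hz⟩)
  rw [heq] at hF
  have hFcl := hcl1.union hcl2
  rw [heq] at hFcl
  refine h.not_connected hM haU ha hb (mem_component_of_hasLog hFcl ?_ ?_ (h.ne_of_a ha)
    (h.ne_of_b hb) ⟨g, hF⟩)
  · rintro (hz | hz)
    · exact hz haU
    · obtain ⟨i, hi⟩ := mem_iUnion.1 hz
      exact disjoint_left.1 (h.disc_a hM i) hi ha
  · rintro (hz | hz)
    · exact hz hbU
    · obtain ⟨i, hi⟩ := mem_iUnion.1 hz
      exact disjoint_left.1 (h.disc_b hM i) hi hb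

lemma Config.exists_sep_line [PreconnectedSpace S] (h : Config A B U Ba Bb v) {a b : S}
    (ha : a ∈ Ba) (haU : a ∈ U) (hb : b ∈ Bb) (hbU : b ∈ U) :
    ∃ γ, IsLine U γ ∧ ∀ C, IsPreconnected C → C ⊆ U → Disjoint C (range γ) →
      (C ∩ Ba).Nonempty → (C ∩ Bb).Nonempty → False := by
  classical
  obtain ⟨M, hM⟩ := h.exists_discs
  obtain ⟨L, hL⟩ := exists_global_log (D := fun i : M => Config.disc A v i)
    (fun i => isPreconnected_disc i) (fun i => center_mem hM i) (h.hasLog_finite hM ha hb)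
  obtain ⟨g, hg⟩ := hasLog_hh_of_connected (v := v) h.hU.isClosed_compl h.vU h.hUc
    disjoint_compl_right haU hbU
  obtain ⟨N, hN, hUN, -, G, hG, -⟩ := hg.extend h.hU.isClosed_compl
    (isOpen_compl_singleton (x := b)) (fun x hx e => hx (e ▸ hbU)) (hh_continuousOn (h.ne_of_b hb))
  let Out : Set M := {i | Config.disc A v i ⊆ N}
  have hOut : Outᶜ.Finite := by
    refine (h.finite_meet hM (C := Nᶜ) hN.isClosed_compl.isCompact
      (compl_subset_comm.1 hUN)).subset ?_
    intro i hi
    obtain ⟨x, hx, hxN⟩ := not_subset.1 hi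
    exact ⟨x, hx, hxN⟩
  have hmex : ∀ i : M, ∃ n : ℤ, i ∈ Out →
      ∀ z ∈ Config.disc A v i, L z = G z + n * (2 * Real.pi * Complex.I) := by
    intro i
    by_cases hi : i ∈ Out
    · obtain ⟨n, hn⟩ := (hL i).unique (hG.mono hi) (isPreconnected_disc i)
      exact ⟨n, fun _ => hn⟩
    · exact ⟨0, fun h => absurd h hi⟩
  choose m hm using hmex
  rcases graph_dichotomy (fun i j : M => (Config.disc A v i ∩ Config.disc A v j).Nonempty)
    (fun i => ⟨_, center_mem hM i, center_mem hM i⟩) (fun i j hij => by rwa [inter_comm])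
    (fun i => h.finite_adj hM i) Out hOut m (by
      rintro i j hi hj ⟨z, hzi, hzj⟩
      have e := (hm i hi z hzi).symm.trans (hm j hj z hzj)
      have := mul_right_cancel₀ two_pi_I_ne (add_left_cancel e)
      exact_mod_cast this) with ⟨n, core, h1, h2, h3⟩ | ⟨κ, h1, h2, p, q, T, hpq, hp, hq⟩
  · exfalso
    refine h.no_global_log hM ha haU hb hbU hL hUN hG h1 h2 fun i hi => ⟨(h3 i hi).1, fun z hz => ?_⟩
    rw [(h3 i hi).2]
    exact hm i (h3 i hi).1 z hz
  · obtain ⟨γ, hγ, hγκ⟩ := h.chain_line hM h1 h2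
    have hsub : range γ ⊆ ⋃ i : M, Config.disc A v i := by
      rintro _ ⟨t, rfl⟩
      rcases hγκ t with h1 | h1
      · exact mem_iUnion.2 ⟨_, h1⟩
      · exact mem_iUnion.2 ⟨_, h1⟩
    refine ⟨γ, hγ, ?_⟩
    rintro C hC hCU hCγ ⟨a', ha'C, ha'⟩ ⟨b', hb'C, hb'⟩
    refine h.separation hγ ?_ ?_ ?_ ha haU hb hbU ((h.isLog_discs hM hL).mono hsub) hN hUN hG
      hpq (T := T + 2) ?_ ?_ ha' hb' hC hCU hCγ ha'C hb'C
    · intro t hta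
      obtain ⟨i, hi⟩ := mem_iUnion.1 (hsub ⟨t, rfl⟩)
      exact disjoint_left.1 (h.disc_a hM i) hi hta
    · intro t hta
      obtain ⟨i, hi⟩ := mem_iUnion.1 (hsub ⟨t, rfl⟩)
      exact disjoint_left.1 (h.disc_b hM i) hi hta
    · intro x hx hxU
      exact h.cluster_mem hM (closure_mono hsub hx) hxU
    · intro t ht
      have hfl : T ≤ ⌊t⌋ := Int.le_floor.2 (by linarith)
      rcases hγκ t with h1 | h1
      · have e := hp _ hfl
        rw [← e.2]; exact hm _ e.1 _ h1
      · have e := hp (⌊t⌋+1) (by omega)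
        rw [← e.2]; exact hm _ e.1 _ h1
    · intro t ht
      have hfl : ⌊t⌋ + 1 ≤ -T := by
        have : (⌊t⌋:ℝ) < ((-T - 1 : ℤ):ℝ) := by
          push_cast; linarith [Int.floor_le t]
        have : ⌊t⌋ < -T - 1 := by exact_mod_cast this
        omega
      rcases hγκ t with h1 | h1
      · have e := hq ⌊t⌋ (by omega)
        rw [← e.2]; exact hm _ e.1 _ h1
      · have e := hq _ hfl
        rw [← e.2]; exact hm _ e.1 _ h1

end LineExists

section Backward

variable {S : Type*} [MetricSpace S] [SphereLike S]

lemma exists_any_line {U : Set S} {v u w : S} (hU : IsOpen U) (hv : v ∉ U)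
    (hu : u ∈ U) (hw : w ∉ U) (hwv : w ≠ v) : ∃ γ, IsLine U γ := by
  have huv : u ≠ v := fun e => hv (e ▸ hu)
  have hΩ : IsClosed (tu v ⁻¹' U)ᶜ := (hU.preimage (tu_cont v)).isClosed_compl
  have hne : (tu v ⁻¹' U)ᶜ.Nonempty := ⟨sg v w, by
    rw [mem_compl_iff, mem_preimage, tu_sg v w hwv]; exact hw⟩
  obtain ⟨q, hq, hqd⟩ := hΩ.exists_infDist_eq_dist hne (sg v u)
  set x := sg v u with hx
  have hxU : tu v x ∈ U := by rw [hx, tu_sg v u huv]; exact hu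
  have hball : ball x (dist x q) ⊆ tu v ⁻¹' U := by
    intro z hz
    by_contra hc
    have h1 := infDist_le_dist_of_mem (x := x) (show z ∈ (tu v ⁻¹' U)ᶜ from hc)
    rw [hqd] at h1
    rw [mem_ball, dist_comm] at hz
    linarith
  have hxq : x ≠ q := fun e => hq (e ▸ hxU)
  have hr : 0 < dist x q := dist_pos.2 hxq
  have hti : ∀ t : ℝ, (t:ℂ) + Complex.I ≠ 0 := fun t e => by
    have := congrArg Complex.im e
    simp at this
  have hlt : ∀ t : ℝ, ‖(t:ℂ)‖ < ‖(t:ℂ) + Complex.I‖ := fun t => by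
    refine lt_of_pow_lt_pow_left₀ 2 (norm_nonneg _) ?_
    rw [← Complex.normSq_eq_norm_sq, ← Complex.normSq_eq_norm_sq, Complex.normSq_apply,
      Complex.normSq_apply]
    simp
  let γ : ℝ → ℂ := fun t => x + (q - x) * ((t:ℂ) / ((t:ℂ) + Complex.I))
  have hγc : Continuous γ := by
    refine continuous_const.add (continuous_const.mul ?_)
    exact Complex.continuous_ofReal.div (Complex.continuous_ofReal.add continuous_const) hti
  refine ⟨fun t => tu v (γ t), (tu_cont v).comp hγc, ?_, ?_, ?_⟩
  · intro t s e
    have e1 := tu_injective v e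
    have e2 := mul_left_cancel₀ (sub_ne_zero.2 hxq.symm) (add_left_cancel e1)
    rw [div_eq_div_iff (hti t) (hti s)] at e2
    have e3 : (t:ℂ) * Complex.I = s * Complex.I := by linear_combination e2
    exact_mod_cast mul_right_cancel₀ Complex.I_ne_zero e3
  · intro t
    apply hball
    rw [mem_ball, dist_eq_norm]
    simp only [γ]
    rw [add_sub_cancel_left, norm_mul, norm_div, dist_comm, dist_eq_norm]
    have h1 : ‖(t:ℂ)‖ / ‖(t:ℂ) + Complex.I‖ < 1 :=
      (div_lt_one (norm_pos_iff.2 (hti t))).2 (hlt t)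
    have h2 : 0 < ‖q - x‖ := norm_pos_iff.2 (sub_ne_zero.2 hxq.symm)
    nlinarith
  · intro C hC hCU
    have hn : tu v ⁻¹' Cᶜ ∈ 𝓝 q := (hC.isClosed.isOpen_compl.preimage (tu_cont v)).mem_nhds
      (fun h => hq (hCU h))
    obtain ⟨ε, hε, hεb⟩ := Metric.mem_nhds_iff.1 hn
    refine ⟨‖q - x‖ / ε, fun t ht => ?_⟩
    have hd : ε ≤ dist (γ t) q := by
      by_contra hc
      exact hεb (mem_ball.2 (not_le.1 hc)) ht
    have e : γ t - q = -(q - x) * (Complex.I / ((t:ℂ) + Complex.I)) := by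
      have := hti t
      simp only [γ]
      field_simp
      ring
    rw [dist_eq_norm, e, norm_mul, norm_neg, norm_div, Complex.norm_I, mul_one_div,
      le_div_iff₀ (norm_pos_iff.2 (hti t))] at hd
    rw [le_div_iff₀ hε]
    have h1 := (hlt t).le
    rw [Complex.norm_real, Real.norm_eq_abs] at h1
    nlinarith

lemma exists_cap {v a : S} {B : Set S} (hB : IsClosed B) (hBn : (tu v ⁻¹' B).Nonempty)
    (hvB : v ∈ B) (haB : a ∉ B) : ∃ Ba : Set S, IsOpen Ba ∧ IsPreconnected Ba ∧ a ∈ Ba ∧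
      Disjoint Ba B ∧ ∀ A : Set S, a ∈ A → ∀ z, tu v z ∈ Ba →
        3 * infDist z (tu v ⁻¹' A) < infDist z (tu v ⁻¹' B) := by
  have hav : a ≠ v := fun e => haB (e ▸ hvB)
  set x := sg v a with hx
  set d := infDist x (tu v ⁻¹' B) with hd
  have hxB : x ∉ tu v ⁻¹' B := by rw [mem_preimage, hx, tu_sg v a hav]; exact haB
  have hpos : 0 < d := ((hB.preimage (tu_cont v)).notMem_iff_infDist_pos hBn).1 hxB
  have heq : tu v '' ball x (d/4) = {v}ᶜ ∩ sg v ⁻¹' ball x (d/4) := by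
    ext y; constructor
    · rintro ⟨z, hz, rfl⟩
      exact ⟨tu_ne v z, by rw [mem_preimage, sg_tu]; exact hz⟩
    · rintro ⟨hy, hy'⟩
      exact ⟨sg v y, hy', tu_sg v y hy⟩
  have hmem : ∀ z, tu v z ∈ tu v '' ball x (d/4) → dist z x < d/4 := by
    rintro z ⟨w, hw, e⟩
    rw [← tu_injective v e]; exact hw
  refine ⟨tu v '' ball x (d/4), ?_, ?_, ?_, ?_, ?_⟩
  · rw [heq]
    exact (sg_cont v).isOpen_inter_preimage isOpen_compl_singleton isOpen_ball
  · exact (convex_ball _ _).isPreconnected.image _ (tu_cont v).continuousOn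
  · exact ⟨x, mem_ball_self (by linarith), tu_sg v a hav⟩
  · rw [disjoint_left]
    rintro _ ⟨z, hz, rfl⟩ hzB
    have h1 := infDist_le_dist_of_mem (x := x) (show z ∈ tu v ⁻¹' B from hzB)
    rw [mem_ball, dist_comm] at hz
    linarith
  · intro A haA z hz
    have h1 := hmem z hz
    have h2 : infDist z (tu v ⁻¹' A) ≤ dist z x := infDist_le_dist_of_mem (by
      rw [mem_preimage, hx, tu_sg v a hav]; exact haA)
    have h3 : infDist x (tu v ⁻¹' B) ≤ infDist z (tu v ⁻¹' B) + dist x z :=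
      infDist_le_infDist_add_dist
    rw [dist_comm x z] at h3
    linarith

variable [LocallyConnectedSpace S] [PreconnectedSpace S] [CompactSpace S]

theorem backward_direction {X : Set S} (hX : IsClosed X) (hXc : IsConnected X)
    (hdec : IsDecomposable X) {U : ℕ → Set S} (hU : ∀ n, IsComplementaryDomain X (U n))
    (hdp : DoublePassCondition X U) : False := by
  obtain ⟨A, B, ⟨hAn, hA, hAc, hAX, hAne⟩, ⟨hBn, hB, hBc, hBX, hBne⟩, hAB⟩ := hdec
  obtain ⟨v, -, hvA, hvB⟩ := isPreconnected_closed_iff.1 hXc.isPreconnected A B hA hB hAB.ge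
    (by rwa [inter_eq_self_of_subset_right hAX]) (by rwa [inter_eq_self_of_subset_right hBX])
  obtain ⟨a0, ha0X, ha0B⟩ := exists_of_ssubset (hBX.ssubset_of_ne hBne)
  obtain ⟨b0, hb0X, hb0A⟩ := exists_of_ssubset (hAX.ssubset_of_ne hAne)
  have ha0A : a0 ∈ A := by rw [← hAB] at ha0X; exact ha0X.resolve_right ha0B
  have hb0B : b0 ∈ B := by rw [← hAB] at hb0X; exact hb0X.resolve_left hb0A
  have ha0v : a0 ≠ v := fun e => ha0B (e ▸ hvB)
  have hb0v : b0 ≠ v := fun e => hb0A (e ▸ hvA)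
  obtain ⟨Ba, oa, ca, ha0, aB, fa⟩ := exists_cap hB
    ⟨sg v b0, by rw [mem_preimage, tu_sg v b0 hb0v]; exact hb0B⟩ hvB ha0B
  obtain ⟨Bb, ob, cb, hb0, bA, fb⟩ := exists_cap hA
    ⟨sg v a0, by rw [mem_preimage, tu_sg v a0 ha0v]; exact ha0A⟩ hvA hb0A
  have hcfg : ∀ n, Config A B (U n) Ba Bb v := by
    intro n
    obtain ⟨x, hx, e⟩ := hU n
    have hUX : Disjoint (U n) X := by
      rw [disjoint_left, e]
      exact fun y hy => (connectedComponentIn_subset Xᶜ x hy : y ∈ Xᶜ)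
    exact
    { hA := hA, hB := hB, hAc := hAc.isPreconnected, hBc := hBc.isPreconnected, vA := hvA, vB := hvB
      hU := by rw [e]; exact hX.isOpen_compl.connectedComponentIn
      hUc := by rw [e]; exact isPreconnected_connectedComponentIn
      hUA := hUX.mono_right hAX
      hUB := hUX.mono_right hBX
      hUcc := by rw [e]; exact isPreconnected_compl_component hXc.isPreconnected _
      hmax := by
        rintro C hC hCX ⟨y, hyC, hyU⟩
        rw [hAB] at hCX
        rw [e] at hyU ⊢
        rw [connectedComponentIn_eq hyU]
        exact hC.subset_connectedComponentIn hyC fun z hz => disjoint_left.1 hCX hz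
      hfr := by rw [e, hAB]; exact frontier_component_subset hX x
      oa := oa, ob := ob, ca := ca, cb := cb
      ma := ⟨a0, ha0A, ha0⟩, mb := ⟨b0, hb0B, hb0⟩, aB := aB, bA := bA
      fa := fa A ha0A, fb := fb B hb0B }
  have hline : ∀ n, ∃ γ, IsLine (U n) γ ∧ ∀ C, IsPreconnected C → C ⊆ U n → Disjoint C (range γ) →
      (C ∩ Ba).Nonempty → (C ∩ Bb).Nonempty → False := by
    intro n
    by_cases hb : (U n ∩ Ba).Nonempty ∧ (U n ∩ Bb).Nonempty
    · obtain ⟨⟨a, haU, ha⟩, ⟨b, hbU, hb⟩⟩ := hb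
      exact (hcfg n).exists_sep_line ha haU hb hbU
    · obtain ⟨x, hx, e⟩ := hU n
      have hxU : x ∈ U n := by rw [e]; exact mem_connectedComponentIn hx
      obtain ⟨γ, hγ⟩ := exists_any_line (hcfg n).hU (hcfg n).vU hxU
        (fun h => disjoint_left.1 (hcfg n).hUA h ha0A) ha0v
      refine ⟨γ, hγ, fun C _ hCU _ h1 h2 => hb ⟨h1.mono ?_, h2.mono ?_⟩⟩
      · exact inter_subset_inter_left _ hCU
      · exact inter_subset_inter_left _ hCU
  choose γ hγ hsep using hline
  obtain ⟨Sh, hSh, hconv⟩ := hdp (fun n => range (γ n)) fun n => (hγ n).isGenCrosscut (hcfg n).hU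
  obtain ⟨ε1, hε1, hb1⟩ := Metric.isOpen_iff.1 oa a0 ha0
  obtain ⟨ε2, hε2, hb2⟩ := Metric.isOpen_iff.1 ob b0 hb0
  obtain ⟨n, hn⟩ := (hconv.eventually_lt_const (lt_min hε1 hε2)).exists
  obtain ⟨x, hx, hShx⟩ := hSh n
  have hne : (Sh n).Nonempty := by
    obtain ⟨e, heU, he⟩ := (hγ n).exists_cluster (hcfg n).hU (l := atTop)
      (fun R => (tendsto_abs_atTop_atTop).eventually_gt_atTop R)
    rw [hShx]
    exact ⟨e, (hγ n).closure_diff_subset (hcfg n).hU (hcfg n).hUc (hcfg n).vU hx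
      (IsLine.mem_closure_range_of_cluster he) heU⟩
  have hfin : hausdorffEDist (Sh n) X ≠ ⊤ := hausdorffEDist_ne_top_of_nonempty_of_bounded hne
    hXc.nonempty (isCompact_univ.isBounded.subset (subset_univ _)) hX.isCompact.isBounded
  obtain ⟨y, hy, hyd⟩ := exists_dist_lt_of_hausdorffDist_lt' ha0X
    (hn.trans_le (min_le_left _ _)) hfin
  obtain ⟨z, hz, hzd⟩ := exists_dist_lt_of_hausdorffDist_lt' hb0X
    (hn.trans_le (min_le_right _ _)) hfin
  rw [hShx] at hy hz
  have hsub := connectedComponentIn_subset (U n \ range (γ n)) x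
  refine hsep n (connectedComponentIn (U n \ range (γ n)) x) isPreconnected_connectedComponentIn
    (hsub.trans sdiff_subset) (disjoint_left.2 fun w hw => (hsub hw).2) ?_ ?_
  · obtain ⟨w, hw1, hw2⟩ := mem_closure_iff.1 hy.1 Ba oa (hb1 (mem_ball.2 hyd))
    exact ⟨w, hw2, hw1⟩
  · obtain ⟨w, hw1, hw2⟩ := mem_closure_iff.1 hz.1 Bb ob (hb2 (mem_ball.2 hzd))
    exact ⟨w, hw2, hw1⟩

lemma singleton_direction [Nontrivial S] {X : Set S} (hX : IsClosed X) (hXn : X.Nonempty)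
    (hXs : X.Subsingleton) :
    ∃ U : ℕ → Set S, (∀ n, IsComplementaryDomain X (U n)) ∧ DoublePassCondition X U := by
  obtain ⟨p, rfl⟩ : ∃ p, X = {p} := by
    obtain ⟨p, hp⟩ := hXn
    exact ⟨p, hXs.eq_singleton_of_mem hp⟩
  obtain ⟨x, hx⟩ := exists_ne p
  have hxX : x ∉ ({p} : Set S) := hx
  refine ⟨fun _ => connectedComponentIn {p}ᶜ x, fun _ => ⟨x, hxX, rfl⟩, fun K hK => ?_⟩
  have hU : IsOpen (connectedComponentIn {p}ᶜ x) := hX.isOpen_compl.connectedComponentIn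
  have hp : p ∉ connectedComponentIn {p}ᶜ x := fun h =>
    (connectedComponentIn_subset {p}ᶜ x h : p ∈ ({p} : Set S)ᶜ) rfl
  have hex : ∀ n, ∃ y, y ∈ connectedComponentIn {p}ᶜ x \ K n := by
    intro n
    obtain ⟨γ, hγ, e⟩ := (hK n).exists_line hU
    rw [← e]
    exact hγ.exists_notMem hU isPreconnected_connectedComponentIn hp
  choose y hy using hex
  refine ⟨fun n => closure (connectedComponentIn (connectedComponentIn {p}ᶜ x \ K n) (y n)) ∩
    frontier (connectedComponentIn {p}ᶜ x), fun n => ⟨y n, hy n, rfl⟩, ?_⟩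
  unfold HausdorffConvergesTo
  refine tendsto_const_nhds.congr fun n => ?_
  have hsub : closure (connectedComponentIn (connectedComponentIn {p}ᶜ x \ K n) (y n)) ∩
    frontier (connectedComponentIn {p}ᶜ x) ⊆ {p} :=
    inter_subset_right.trans (frontier_component_subset hX x)
  beta_reduce
  rcases subset_singleton_iff_eq.1 hsub with h | h
  · rw [h, hausdorffDist_empty']
  · rw [h, hausdorffDist_self_zero]

end Backward

section Final

instance factFinrankThree : Fact (Module.finrank ℝ (EuclideanSpace ℝ (Fin 3)) = 2 + 1) :=
  ⟨by simp⟩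

/-- The identification of `ℝ²` with `ℂ`. -/
noncomputable def planeIso : EuclideanSpace ℝ (Fin 2) ≃ₗᵢ[ℝ] ℂ :=
  Complex.orthonormalBasisOneI.repr.symm

noncomputable instance sphereLikeSphere :
    SphereLike (Metric.sphere (0 : EuclideanSpace ℝ (Fin 3)) 1) where
  sg v x := planeIso (stereographic' 2 v x)
  tu v z := (stereographic' 2 v).symm (planeIso.symm z)
  sg_cont v := by
    refine planeIso.continuous.comp_continuousOn ?_
    have := (stereographic' 2 v).continuousOn
    rwa [stereographic'_source] at this
  tu_cont v := by
    have := (stereographic' 2 v).continuousOn_symm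
    rw [stereographic'_target, continuousOn_univ] at this
    exact this.comp planeIso.symm.continuous
  tu_ne v z := by
    have := (stereographic' 2 v).map_target (x := planeIso.symm z) (by
      rw [stereographic'_target]; trivial)
    rw [stereographic'_source] at this
    exact this
  sg_tu v z := by
    rw [(stereographic' 2 v).right_inv (by rw [stereographic'_target]; trivial)]
    simp
  tu_sg v x hx := by
    rw [LinearIsometryEquiv.symm_apply_apply]
    exact (stereographic' 2 v).left_inv (by rw [stereographic'_source]; exact hx)

end Final

/-- **Characterization of indecomposable continua in the 2-sphere.** -/
theorem sphere_indecomposable_iff_doublePass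
    (X : Set (Metric.sphere (0 : EuclideanSpace ℝ (Fin 3)) 1))
    (hX : IsContinuum X) :
    ¬ IsDecomposable X ↔
      ∃ U : ℕ → Set (Metric.sphere (0 : EuclideanSpace ℝ (Fin 3)) 1),
        (∀ n, IsComplementaryDomain X (U n)) ∧ DoublePassCondition X U := by
  have : LocallyConnectedSpace (Metric.sphere (0 : EuclideanSpace ℝ (Fin 3)) 1) :=
    ChartedSpace.locallyConnectedSpace (EuclideanSpace ℝ (Fin 2)) _
  have : CompactSpace (Metric.sphere (0 : EuclideanSpace ℝ (Fin 3)) 1) :=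
    isCompact_iff_compactSpace.1 (isCompact_sphere _ _)
  have : PreconnectedSpace (Metric.sphere (0 : EuclideanSpace ℝ (Fin 3)) 1) :=
    Subtype.preconnectedSpace (isPreconnected_sphere (by
      rw [← Module.finrank_eq_rank]; norm_num [finrank_euclideanSpace_fin]) _ _)
  have : Nontrivial (Metric.sphere (0 : EuclideanSpace ℝ (Fin 3)) 1) := by
    obtain ⟨p, -⟩ := hX.2.nonempty
    exact ⟨⟨p, tu p 0, (tu_ne p 0).symm⟩⟩
  constructor
  · intro hind
    by_cases hs : X.Subsingleton
    · exact singleton_direction hX.1.isClosed hX.2.nonempty hs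
    · exact forward_direction hX.1.isClosed hX.2 hind hs
  · rintro ⟨U, hU, hdp⟩ hdec
    exact backward_direction hX.1.isClosed hX.2 hdec hU hdp
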